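/- arXiv:2102.12830 — 3 statements merged into one kernel-verified Lean document; each statement's English description precedes it below -/
import Mathlib

section
/- Fix an integer ℓ ≥ 12 that is divisible by 12, and let k be the smallest integer greater than 2 that does not divide ℓ (so k ≥ 5). There exists n₀ = n₀(ℓ) such that every oriented graph H on n ≥ n₀ vertices with minimum semidegree δ±(H) ≥ (n/k)·(1 − 1/(30k)) that contains no closed directed walk of length ℓ is homomorphic to the directed cycle C_k. -/
/-- The outdegree of a vertex `v` in the directed graph with edge relation `E`. -/
noncomputable def outDeg {n : ℕ} (E : Fin n → Fin n → Prop) (v : Fin n) : ℕ :=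
  {w | E v w}.ncard

/-- The indegree of a vertex `v` in the directed graph with edge relation `E`. -/
noncomputable def inDeg {n : ℕ} (E : Fin n → Fin n → Prop) (v : Fin n) : ℕ :=
  {w | E w v}.ncard

/-- The semidegree of a vertex: the minimum of its outdegree and indegree. -/
noncomputable def semiDeg {n : ℕ} (E : Fin n → Fin n → Prop) (v : Fin n) : ℕ :=
  min (outDeg E v) (inDeg E v)

/-- `E` is an oriented graph: no loops and no pair of opposite edges. -/
def Oriented {n : ℕ} (E : Fin n → Fin n → Prop) : Prop :=
  (∀ v, ¬ E v v) ∧ (∀ u v, E u v → ¬ E v u)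

/-- The graph contains a directed cycle of length exactly `t`:
`t` distinct vertices cyclically joined by edges. -/
def HasDiCycle {n : ℕ} (E : Fin n → Fin n → Prop) (t : ℕ) : Prop :=
  ∃ v : ZMod t → Fin n, Function.Injective v ∧ ∀ i, E (v i) (v (i + 1))

/-- The graph contains a closed directed walk of length `t` (vertices may repeat). -/
def HasClosedWalk {n : ℕ} (E : Fin n → Fin n → Prop) (t : ℕ) : Prop :=
  ∃ w : ℕ → Fin n, w 0 = w t ∧ ∀ i < t, E (w i) (w (i + 1))

/-- There is a directed path of length `t` from `x` to `y` (all vertices distinct). -/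
def HasPath {n : ℕ} (E : Fin n → Fin n → Prop) (x y : Fin n) (t : ℕ) : Prop :=
  ∃ u : Fin (t + 1) → Fin n, Function.Injective u ∧ u 0 = x ∧ u (Fin.last t) = y ∧
    ∀ i : Fin t, E (u i.castSucc) (u i.succ)

/-- The graph contains an `s`-shortcut: a directed path `v₀ v₁ ⋯ v_s` on distinct
vertices together with the additional edge `v₀ v_s`. -/
def HasShortcut {n : ℕ} (E : Fin n → Fin n → Prop) (s : ℕ) : Prop :=
  ∃ v : Fin (s + 1) → Fin n, Function.Injective v ∧
    (∀ i : Fin s, E (v i.castSucc) (v i.succ)) ∧ E (v 0) (v (Fin.last s))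

/-- The graph is homomorphic to the directed cycle `C_k`. -/
def HomToCycle {n : ℕ} (E : Fin n → Fin n → Prop) (k : ℕ) : Prop :=
  ∃ f : Fin n → ZMod k, ∀ u v, E u v → f v = f u + 1

namespace CycleHom

open Finset
open scoped Classical

variable {V : Type*}

/-- There is a directed walk of length `j` from `x` to `y`. -/
def DWalk (E : V → V → Prop) : ℕ → V → V → Prop
  | 0, x, y => x = y
  | j + 1, x, y => ∃ z, DWalk E j x z ∧ E z y

theorem dwalk_one {E : V → V → Prop} {x y : V} : DWalk E 1 x y ↔ E x y := by
  simp [DWalk]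

theorem DWalk.add {E : V → V → Prop} {a b : ℕ} {x y z : V} (h₁ : DWalk E a x y)
    (h₂ : DWalk E b y z) : DWalk E (a + b) x z := by
  induction b generalizing z with
  | zero => exact h₂ ▸ h₁
  | succ b ih =>
    obtain ⟨w, hw, hwz⟩ := h₂
    exact ⟨w, ih hw, hwz⟩

theorem DWalk.of_eq {E : V → V → Prop} {a b : ℕ} {x y : V} (h : DWalk E a x y) (hab : a = b) :
    DWalk E b x y := hab ▸ h

theorem DWalk.cons {E : V → V → Prop} {a : ℕ} {x y z : V} (h₁ : E x y)
    (h₂ : DWalk E a y z) : DWalk E (a + 1) x z :=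
  ((dwalk_one.2 h₁).add h₂).of_eq (by omega)

theorem DWalk.snoc {E : V → V → Prop} {a : ℕ} {x y z : V} (h₁ : DWalk E a x y)
    (h₂ : E y z) : DWalk E (a + 1) x z := ⟨y, h₁, h₂⟩

theorem DWalk.mul {E : V → V → Prop} {a : ℕ} {x : V} (h : DWalk E a x x) (u : ℕ) :
    DWalk E (u * a) x x := by
  induction u with
  | zero => simp [DWalk]
  | succ u ih => exact (ih.add h).of_eq (by ring)

theorem DWalk.swap {E : V → V → Prop} {a : ℕ} {x y : V} (h : DWalk E a x y) :
    DWalk (Function.swap E) a y x := by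
  induction a generalizing y with
  | zero => exact Eq.symm h
  | succ a ih =>
    obtain ⟨w, hw, hwy⟩ := h
    exact DWalk.cons (E := Function.swap E) hwy (ih hw)

theorem dwalk_swap {E : V → V → Prop} {a : ℕ} {x y : V} :
    DWalk (Function.swap E) a y x ↔ DWalk E a x y :=
  ⟨fun h => h.swap, fun h => h.swap⟩

theorem DWalk.map {U : Type*} {E : V → V → Prop} {E' : U → U → Prop} (f : U → V)
    (hf : ∀ u v, E' u v → E (f u) (f v)) {a : ℕ} {x y : U} (h : DWalk E' a x y) :
    DWalk E a (f x) (f y) := by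
  induction a generalizing y with
  | zero => exact congrArg f h
  | succ a ih =>
    obtain ⟨w, hw, hwy⟩ := h
    exact (ih hw).snoc (hf _ _ hwy)

theorem DWalk.exists_seq {E : V → V → Prop} {a : ℕ} {x y : V} (h : DWalk E a x y) :
    ∃ w : ℕ → V, w 0 = x ∧ w a = y ∧ ∀ i < a, E (w i) (w (i + 1)) := by
  induction a generalizing y with
  | zero => exact ⟨fun _ => x, rfl, h, by simp⟩
  | succ a ih =>
    obtain ⟨z, hz, hzy⟩ := h
    obtain ⟨w, h0, ha, hw⟩ := ih hz
    refine ⟨fun i => if i ≤ a then w i else y, by simp [h0], by simp, fun i hi => ?_⟩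
    by_cases hia : i = a
    · subst hia
      simpa [ha] using hzy
    · have h1 : i + 1 ≤ a := by omega
      have h2 : i ≤ a := by omega
      simpa [h1, h2] using hw i (by omega)

theorem dwalk_of_seq {E : V → V → Prop} (w : ℕ → V) (hw : ∀ i, E (w i) (w (i + 1)))
    (i t : ℕ) : DWalk E t (w i) (w (i + t)) := by
  induction t with
  | zero => rfl
  | succ t ih => exact ih.snoc (hw _)

/-- No closed directed walk has length `j`. -/
def NoClosed (E : V → V → Prop) (j : ℕ) : Prop := ∀ x, ¬ DWalk E j x x

theorem NoClosed.swap {E : V → V → Prop} {j : ℕ} (h : NoClosed E j) :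
    NoClosed (Function.swap E) j := fun x hx => h x (dwalk_swap.1 hx)

theorem NoClosed.of_dvd {E : V → V → Prop} {d j : ℕ} (h : NoClosed E j) (hd : d ∣ j) :
    NoClosed E d := by
  obtain ⟨u, rfl⟩ := hd
  exact fun x hx => h x ((hx.mul u).of_eq (by ring))

/-- The relation induced on a finite set of vertices. -/
def restrict (E : V → V → Prop) (W : Finset V) : W → W → Prop := fun a b => E a b

theorem NoClosed.restrict {E : V → V → Prop} {j : ℕ} (h : NoClosed E j) (W : Finset V) :
    NoClosed (restrict E W) j :=
  fun x hx => h x (hx.map (E := E) Subtype.val fun _ _ h => h)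

/-- In every nonempty set of vertices, some vertex sends edges to at most a proportion `c`
of the set. -/
def Exp (E : V → V → Prop) (c : ℝ) : Prop :=
  ∀ X : Finset V, X.Nonempty → ∃ v ∈ X, (#(X.filter (E v)) : ℝ) ≤ c * #X

theorem card_add_le_of_disjoint {s t u : Finset V} (hs : s ⊆ u) (ht : t ⊆ u)
    (h : ∀ v, v ∈ s → v ∉ t) : (#s : ℝ) + #t ≤ #u := by
  have hd : Disjoint s t := Finset.disjoint_left.2 h
  have := Finset.card_le_card (Finset.union_subset hs ht)
  rw [Finset.card_union_of_disjoint hd] at this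
  exact_mod_cast this

theorem exists_mem_of_card_lt {s t u : Finset V} (hs : s ⊆ u) (ht : t ⊆ u)
    (h : (#u : ℝ) < #s + #t) : ∃ v, v ∈ s ∧ v ∈ t := by
  by_contra! hc
  have := card_add_le_of_disjoint hs ht hc
  linarith

theorem ncast_le {s t : Finset V} (h : s ⊆ t) : (#s : ℝ) ≤ #t := by
  exact_mod_cast Finset.card_le_card h

variable [Fintype V]

/-- The set of out-neighbours. -/
noncomputable def outN (E : V → V → Prop) (v : V) : Finset V := univ.filter (E v)

/-- Every vertex has at least `δ` out-neighbours. -/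
def MinOut (E : V → V → Prop) (δ : ℝ) : Prop := ∀ v, δ ≤ (#(outN E v) : ℝ)

/-- The set of endpoints of walks of length `j` from `x`. -/
noncomputable def reachSet (E : V → V → Prop) (j : ℕ) (x : V) : Finset V :=
  univ.filter (DWalk E j x)

/-- The set of endpoints of walks of positive length at most `j` from `x`. -/
noncomputable def ball (E : V → V → Prop) (j : ℕ) (x : V) : Finset V :=
  univ.filter fun y => ∃ i, 1 ≤ i ∧ i ≤ j ∧ DWalk E i x y

@[simp] theorem mem_outN {E : V → V → Prop} {v w : V} : w ∈ outN E v ↔ E v w := by simp [outN]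

theorem mem_outN_swap {E : V → V → Prop} {v w : V} : w ∈ outN (Function.swap E) v ↔ E w v :=
  mem_outN

@[simp] theorem mem_reachSet {E : V → V → Prop} {j : ℕ} {v w : V} :
    w ∈ reachSet E j v ↔ DWalk E j v w := by simp [reachSet]

@[simp] theorem mem_ball {E : V → V → Prop} {j : ℕ} {v w : V} :
    w ∈ ball E j v ↔ ∃ i, 1 ≤ i ∧ i ≤ j ∧ DWalk E i v w := by simp [ball]

theorem exists_of_card_lt {s t : Finset V}
    (h : (Fintype.card V : ℝ) < #s + #t) : ∃ v, v ∈ s ∧ v ∈ t := by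
  by_contra! hc
  have hd : Disjoint s t := Finset.disjoint_left.2 hc
  have := Finset.card_le_univ (s ∪ t)
  rw [Finset.card_union_of_disjoint hd] at this
  have : (#s : ℝ) + #t ≤ Fintype.card V := by exact_mod_cast this
  linarith

theorem exists_out {E : V → V → Prop} {δ : ℝ} (hδ : 0 < δ) (hE : MinOut E δ) (v : V) :
    ∃ w, E v w := by
  have h := hδ.trans_le (hE v)
  obtain ⟨w, hw⟩ := Finset.card_pos.1 (by exact_mod_cast h)
  exact ⟨w, mem_outN.1 hw⟩

theorem exists_reach {E : V → V → Prop} {δ : ℝ} (hδ : 0 < δ) (hE : MinOut E δ) (j : ℕ) (v : V) :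
    ∃ w, DWalk E j v w := by
  induction j with
  | zero => exact ⟨v, rfl⟩
  | succ j ih =>
    obtain ⟨w, hw⟩ := ih
    obtain ⟨u, hu⟩ := exists_out hδ hE w
    exact ⟨u, hw.snoc hu⟩

theorem le_card_reachSet {E : V → V → Prop} {δ : ℝ} (hδ : 0 < δ) (hE : MinOut E δ) {j : ℕ}
    (hj : 1 ≤ j) (v : V) : δ ≤ #(reachSet E j v) := by
  obtain ⟨j, rfl⟩ := Nat.exists_eq_add_of_le' hj
  obtain ⟨w, hw⟩ := exists_reach hδ hE j v
  exact (hE w).trans (ncast_le fun u hu => mem_reachSet.2 (hw.snoc (mem_outN.1 hu)))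

theorem le_card_ball {E : V → V → Prop} {δ : ℝ} (hE : MinOut E δ) {j : ℕ}
    (hj : 1 ≤ j) (v : V) : δ ≤ #(ball E j v) :=
  (hE v).trans (ncast_le fun _ hu => mem_ball.2 ⟨1, le_rfl, hj, dwalk_one.2 (mem_outN.1 hu)⟩)

theorem ball_mono (E : V → V → Prop) {i j : ℕ} (h : i ≤ j) (v : V) : ball E i v ⊆ ball E j v := by
  intro u
  simp only [mem_ball]
  rintro ⟨a, h1, h2, h3⟩
  exact ⟨a, h1, h2.trans h, h3⟩

theorem ball_growth {E : V → V → Prop} {δ c : ℝ} (hE : MinOut E δ) (hc : Exp E c) {j : ℕ}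
    (hj : 1 ≤ j) (x : V) : δ + (1 - c) * #(ball E j x) ≤ #(ball E (j + 1) x) := by
  rcases (ball E j x).eq_empty_or_nonempty with h | h
  · simpa [h] using le_card_ball hE (by omega : 1 ≤ j + 1) x
  obtain ⟨v, hv, hvc⟩ := hc _ h
  have h1 : (#(ball E j x) : ℝ) + #(outN E v \ ball E j x) ≤ #(ball E (j + 1) x) := by
    refine card_add_le_of_disjoint (ball_mono E (by omega) x) ?_ ?_
    · intro u hu
      obtain ⟨i, h1, h2, h3⟩ := mem_ball.1 hv
      exact mem_ball.2 ⟨i + 1, by omega, by omega, h3.snoc (mem_outN.1 (mem_sdiff.1 hu).1)⟩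
    · intro u hu hu'
      exact (mem_sdiff.1 hu').2 hu
  have h2 : (#(outN E v) : ℝ) ≤
      #(outN E v \ ball E j x) + #((ball E j x).filter (E v)) := by
    have : outN E v ⊆ (outN E v \ ball E j x) ∪ (ball E j x).filter (E v) := by
      intro u hu
      by_cases h : u ∈ ball E j x
      · exact mem_union_right _ (mem_filter.2 ⟨h, mem_outN.1 hu⟩)
      · exact mem_union_left _ (mem_sdiff.2 ⟨hu, h⟩)
    exact_mod_cast (Finset.card_le_card this).trans (Finset.card_union_le _ _)
  have := hE v
  linarith

theorem ball_closed_form {E : V → V → Prop} {δ c : ℝ} (hE : MinOut E δ) (hc : Exp E c)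
    (hc1 : c ≤ 1) {j : ℕ} (hj : 1 ≤ j) (x : V) :
    δ * (1 - (1 - c) ^ j) ≤ c * #(ball E j x) ∨ c ≤ 0 := by
  by_cases h0 : c ≤ 0
  · exact Or.inr h0
  push Not at h0
  left
  induction j, hj using Nat.le_induction with
  | base =>
    have := mul_le_mul_of_nonneg_left (le_card_ball hE le_rfl x) h0.le
    linarith
  | succ j hj ih =>
    have h1 := mul_le_mul_of_nonneg_left (ball_growth hE hc hj x) h0.le
    have h2 := mul_le_mul_of_nonneg_left ih (sub_nonneg.2 hc1)
    rw [pow_succ]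
    nlinarith

theorem ball_add_of_disjoint {E : V → V → Prop} {δ : ℝ} (hδ : 0 < δ) (hE : MinOut E δ) {j : ℕ}
    {x : V} (h : ∀ i, 1 ≤ i → i ≤ j → ∀ y, DWalk E i x y → ¬ DWalk E (j + 1) x y) :
    (#(ball E j x) : ℝ) + δ ≤ #(ball E (j + 1) x) := by
  have h1 := le_card_reachSet hδ hE (by omega : 1 ≤ j + 1) x
  have h2 := card_add_le_of_disjoint (s := ball E j x) (t := reachSet E (j + 1) x)
    (u := ball E (j + 1) x) (ball_mono E (by omega) x)
    (fun u hu => mem_ball.2 ⟨j + 1, by omega, le_rfl, mem_reachSet.1 hu⟩) (by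
      intro u hu hu'
      obtain ⟨i, h1, h2, h3⟩ := mem_ball.1 hu
      exact h i h1 h2 _ h3 (mem_reachSet.1 hu'))
  linarith

theorem ball_mul_of_disjoint {E : V → V → Prop} {δ : ℝ} (hδ : 0 < δ) (hE : MinOut E δ) {j : ℕ}
    {x : V} (h : ∀ a b, 1 ≤ a → a < b → b ≤ j → ∀ y, DWalk E a x y → ¬ DWalk E b x y) :
    j * δ ≤ #(ball E j x) := by
  induction j with
  | zero => simp
  | succ j ih =>
    have h1 := ih fun a b ha hab hb => h a b ha hab (by omega)
    have h2 := ball_add_of_disjoint hδ hE (j := j) (x := x)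
      fun i h1 h2 => h i (j + 1) h1 (by omega) le_rfl
    push_cast
    linarith

theorem meet {E : V → V → Prop} {i j : ℕ} {x y : V}
    (h : (Fintype.card V : ℝ) < #(ball E i y) + #(ball (Function.swap E) j x)) :
    ∃ r, 2 ≤ r ∧ r ≤ i + j ∧ DWalk E r y x := by
  obtain ⟨v, hv, hv'⟩ := exists_of_card_lt h
  obtain ⟨a, h1, h2, h3⟩ := mem_ball.1 hv
  obtain ⟨b, h4, h5, h6⟩ := mem_ball.1 hv'
  exact ⟨a + b, by omega, by omega, h3.add (dwalk_swap.1 h6)⟩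

theorem exists_sink {E : V → V → Prop} {ℓ j R : ℕ} (hno : NoClosed E ℓ) {x : V}
    {X : Finset V} (hne : X.Nonempty) (hX : ∀ y ∈ X, DWalk E j x y) (hjR : j + R ≤ ℓ)
    (hret : ∀ y, ∃ r, r ≤ R ∧ DWalk E r y x) : ∃ v ∈ X, ∀ w ∈ X, ¬ E v w := by
  by_contra! hc
  choose! f hf hEf using hc
  obtain ⟨z, hz⟩ := hne
  have hmem : ∀ i, f^[i] z ∈ X := by
    intro i
    induction i with
    | zero => exact hz
    | succ i ih =>
      rw [Function.iterate_succ_apply']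
      exact hf _ ih
  have hw : ∀ i, E (f^[i] z) (f^[i + 1] z) := by
    intro i
    rw [Function.iterate_succ_apply']
    exact hEf _ (hmem i)
  obtain ⟨r, hr, hrx⟩ := hret (f^[ℓ] z)
  have h1 := dwalk_of_seq (fun i => f^[i] z) hw (j + r) (ℓ - (j + r))
  rw [show j + r + (ℓ - (j + r)) = ℓ by omega] at h1
  exact hno x ((((hX _ (hmem _)).add h1).add hrx).of_eq (by omega))

theorem ball_two_of_sink {E : V → V → Prop} {δ : ℝ} (hδ : 0 < δ) (hE : MinOut E δ) {ℓ R : ℕ}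
    (hno : NoClosed E ℓ) {x : V} (hR : 1 + R ≤ ℓ)
    (hret : ∀ y, ∃ r, r ≤ R ∧ DWalk E r y x) : 2 * δ ≤ #(ball E 2 x) := by
  obtain ⟨w, hw⟩ := exists_out hδ hE x
  obtain ⟨v, hv, hvX⟩ := exists_sink hno (X := outN E x) ⟨w, mem_outN.2 hw⟩
    (fun y hy => dwalk_one.2 (mem_outN.1 hy)) hR hret
  have h := card_add_le_of_disjoint (s := outN E x) (t := outN E v) (u := ball E 2 x)
    (fun u hu => mem_ball.2 ⟨1, le_rfl, by omega, dwalk_one.2 (mem_outN.1 hu)⟩)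
    (fun u hu => mem_ball.2 ⟨2, by omega, le_rfl,
      (dwalk_one.2 (mem_outN.1 hv)).snoc (mem_outN.1 hu)⟩)
    (fun u hu hu' => hvX u hu (mem_outN.1 hu'))
  have h1 := hE x
  have h2 := hE v
  linarith

theorem exists_large_indegree [Nonempty V] {E : V → V → Prop} {δ : ℝ} (hE : MinOut E δ) :
    ∃ x, δ ≤ #(outN (Function.swap E) x) := by
  by_contra! hc
  have h := Finset.sum_card_bipartiteAbove_eq_sum_card_bipartiteBelow (s := (univ : Finset V))
    (t := (univ : Finset V)) E
  have h1 : ∑ v : V, (#(outN E v) : ℝ) = ∑ v : V, (#(outN (Function.swap E) v) : ℝ) := by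
    exact_mod_cast h
  have h2 : ∑ v : V, δ ≤ ∑ v : V, (#(outN E v) : ℝ) := Finset.sum_le_sum fun v _ => hE v
  have h3 : ∑ v : V, (#(outN (Function.swap E) v) : ℝ) < ∑ v : V, δ :=
    Finset.sum_lt_sum_of_nonempty univ_nonempty fun v _ => hc v
  linarith

theorem exists_hub [Nonempty V] {E : V → V → Prop} {c c₁ : ℝ} {J : ℕ} (hc₁ : 0 < c₁)
    (hc : c₁ < c) (hJ : 1 ≤ J) (hpow : (1 - c₁) ^ J < c₁)
    (hE : MinOut E (c * Fintype.card V)) (hexp : Exp E c) :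
    ∃ x, c * Fintype.card V ≤ #(ball (Function.swap E) 1 x) ∧
      ∀ y, ∃ r, 2 ≤ r ∧ r ≤ J + 1 ∧ DWalk E r y x := by
  obtain ⟨x, hx⟩ := exists_large_indegree hE
  have hm : (0 : ℝ) < Fintype.card V := by exact_mod_cast Fintype.card_pos
  have hx1 : (#(outN (Function.swap E) x) : ℝ) ≤ #(ball (Function.swap E) 1 x) :=
    ncast_le fun u hu => mem_ball.2 ⟨1, le_rfl, le_rfl, dwalk_one.2 (mem_outN.1 hu)⟩
  have hc1 : c ≤ 1 := by
    have h1 : (#(outN (Function.swap E) x) : ℝ) ≤ Fintype.card V := by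
      exact_mod_cast Finset.card_le_univ _
    by_contra! h
    nlinarith
  refine ⟨x, hx.trans hx1, fun y => meet (i := J) (j := 1) ?_⟩
  have h1 := (ball_closed_form hE hexp hc1 hJ y).resolve_right (by linarith)
  have h2 : (1 - c) ^ J ≤ (1 - c₁) ^ J := pow_le_pow_left₀ (by linarith) (by linarith) J
  have h3 : Fintype.card V * (1 - (1 - c) ^ J) ≤ #(ball E J y) := by
    have h4 : c * (Fintype.card V * (1 - (1 - c) ^ J)) ≤ c * #(ball E J y) := by linarith
    exact le_of_mul_le_mul_left h4 (by linarith)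
  nlinarith

theorem exp_of_extremal (E : V → V → Prop) (c₁ : ℝ)
    (H : ∀ W : Finset V, W.Nonempty → ∀ c, c₁ < c →
      MinOut (restrict E W) (c * Fintype.card W) → Exp (restrict E W) c → False) : Exp E c₁ := by
  by_contra hc
  unfold Exp at hc
  push Not at hc
  obtain ⟨X, hX, hXc⟩ := hc
  have key : ∀ W : Finset V, ∃ q : ℝ, W.Nonempty →
      (∀ v ∈ W, q * #W ≤ #(W.filter (E v))) ∧ ∃ v ∈ W, (#(W.filter (E v)) : ℝ) = q * #W := by
    intro W
    by_cases hW : W.Nonempty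
    · obtain ⟨v, hv, hmin⟩ := Finset.exists_min_image W (fun v => #(W.filter (E v))) hW
      have hpos : (0 : ℝ) < #W := by exact_mod_cast hW.card_pos
      refine ⟨#(W.filter (E v)) / #W, fun _ => ⟨fun u hu => ?_, v, hv, ?_⟩⟩
      · rw [div_mul_cancel₀ _ hpos.ne']
        exact_mod_cast hmin u hu
      · rw [div_mul_cancel₀ _ hpos.ne']
    · exact ⟨0, fun h => absurd h hW⟩
  choose q hq using key
  obtain ⟨W, hW, hmax⟩ := Finset.exists_max_image
    ((univ : Finset (Finset V)).filter Finset.Nonempty) q ⟨X, by simpa using hX⟩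
  have hW : W.Nonempty := by simpa using hW
  have hmax : ∀ Y : Finset V, Y.Nonempty → q Y ≤ q W := fun Y hY => hmax Y (by simpa using hY)
  have hcq : c₁ < q W := by
    obtain ⟨v, hv, hvq⟩ := (hq X hX).2
    have h1 := hXc v hv
    rw [hvq] at h1
    have h2 : c₁ < q X := lt_of_mul_lt_mul_right h1 (Nat.cast_nonneg _)
    exact h2.trans_le (hmax X hX)
  refine H W hW (q W) hcq (fun v => ?_) (fun Y hY => ?_)
  · have h1 := (hq W hW).1 v v.2
    have h2 : #((W.filter (E v))) = #(outN (restrict E W) v) := by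
      rw [← Finset.card_map (Function.Embedding.subtype _) (s := outN (restrict E W) v)]
      congr 1
      ext u
      simp [restrict, and_comm]
    rw [Fintype.card_coe, ← h2]
    exact h1
  · set Z := Y.map (Function.Embedding.subtype _) with hZ
    have hZne : Z.Nonempty := by simpa [hZ] using hY
    obtain ⟨v, hv, hvq⟩ := (hq Z hZne).2
    obtain ⟨y, hy, rfl⟩ := Finset.mem_map.1 hv
    refine ⟨y, hy, ?_⟩
    have h2 : #(Z.filter (E y)) = #(Y.filter (restrict E W y)) := by
      rw [← Finset.card_map (Function.Embedding.subtype _) (s := Y.filter (restrict E W y))]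
      congr 1
      ext u
      simp only [hZ, mem_filter, mem_map, Function.Embedding.coe_subtype, restrict]
      aesop
    have h3 : #Z = #Y := Finset.card_map _
    rw [← h2, ← h3]
    change (#(Z.filter (E y)) : ℝ) = _ at hvq
    rw [hvq]
    exact mul_le_mul_of_nonneg_right (hmax Z hZne) (Nat.cast_nonneg _)

end CycleHom

namespace CycleHom

open Finset
open scoped Classical

variable {V : Type*}

variable [Fintype V]

theorem exists_common_of_layers {E : V → V → Prop} {δ : ℝ} {k : ℕ} (hδ : 0 < δ)
    (hE : MinOut E δ) (hcard : (Fintype.card V : ℝ) < (k + 1) * δ) {x : V}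
    (hdisj : ∀ α β, 2 ≤ α → α < β → β ≤ k + 1 → ∀ y, DWalk E α x y → ¬ DWalk E β x y)
    {c : ℕ} (hc : 2 ≤ c) (hck : c ≤ k + 1) {A B : Finset V} (hA : A ⊆ reachSet E c x)
    (hB : B ⊆ reachSet E c x) (hAδ : δ ≤ #A) (hBδ : δ ≤ #B) : ∃ y, y ∈ A ∧ y ∈ B := by
  by_contra! hAB
  have h1 := card_add_le_of_disjoint hA hB hAB
  have h2 : ∑ i ∈ Icc 2 (k + 1), (#(reachSet E i x) : ℝ) ≤ Fintype.card V := by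
    have h3 : #((Icc 2 (k + 1)).biUnion fun i => reachSet E i x)
        = ∑ i ∈ Icc 2 (k + 1), #(reachSet E i x) := by
      refine Finset.card_biUnion fun i hi j hj hij => Finset.disjoint_left.2 fun y hy hy' => ?_
      rw [mem_coe, mem_Icc] at hi hj
      replace hy := mem_reachSet.1 hy
      replace hy' := mem_reachSet.1 hy'
      rcases lt_or_gt_of_ne hij with h | h
      · exact hdisj i j hi.1 h hj.2 y hy hy'
      · exact hdisj j i hj.1 h hi.2 y hy' hy
    have h4 := Finset.card_le_univ ((Icc 2 (k + 1)).biUnion fun i => reachSet E i x)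
    rw [h3] at h4
    exact_mod_cast h4
  have hmem : c ∈ Icc 2 (k + 1) := mem_Icc.2 ⟨hc, hck⟩
  rw [← Finset.add_sum_erase _ _ hmem] at h2
  have h5 : (#((Icc 2 (k + 1)).erase c)) • δ ≤
      ∑ i ∈ (Icc 2 (k + 1)).erase c, (#(reachSet E i x) : ℝ) := by
    refine Finset.card_nsmul_le_sum _ _ _ fun i hi => le_card_reachSet hδ hE ?_ x
    have := (mem_Icc.1 (mem_erase.1 hi).2).1
    omega
  rw [Finset.card_erase_of_mem hmem, Nat.card_Icc, nsmul_eq_mul] at h5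
  have h6 : ((k + 1 + 1 - 2 - 1 : ℕ) : ℝ) = k - 1 := by
    have : 1 ≤ k := by omega
    rw [show k + 1 + 1 - 2 - 1 = k - 1 by omega]
    push_cast [this]
    ring
  rw [h6] at h5
  linarith

/-- If walks from a common vertex with slightly different lengths never meet, then the graph
is homomorphic to a directed cycle. -/
theorem hom_of_separated {E : V → V → Prop} {δ : ℝ} {k : ℕ} (hk : 3 ≤ k) (hδ : 0 < δ)
    (hE : MinOut E δ) (hcard : (Fintype.card V : ℝ) < (k + 1) * δ)
    (hP : ∀ u α β, 1 ≤ α → α < β → β ≤ k + 1 → β ≤ α + (k - 1) →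
      ∀ y, DWalk E α u y → ¬ DWalk E β u y) :
    ∃ f : V → ZMod k, ∀ u v, E u v → f v = f u + 1 := by
  rcases isEmpty_or_nonempty V with hV | ⟨⟨x⟩⟩
  · exact ⟨fun _ => 0, fun u => hV.elim u⟩
  have hdisj : ∀ α β, 2 ≤ α → α < β → β ≤ k + 1 →
      ∀ y, DWalk E α x y → ¬ DWalk E β x y := fun α β h1 h2 h3 y =>
    hP x α β (by omega) h2 h3 (by omega) y
  have hlayer : ∀ v, ∃ i w, 1 ≤ i ∧ i ≤ k ∧ E v w ∧ DWalk E i x w := by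
    intro v
    have h1 := ball_mul_of_disjoint hδ hE (j := k) (x := x) fun a b ha hab hb y =>
      hP x a b ha hab (by omega) (by omega) y
    have h2 := hE v
    obtain ⟨w, hw, hw'⟩ := exists_of_card_lt (s := ball E k x) (t := outN E v) (by linarith)
    obtain ⟨i, h3, h4, h5⟩ := mem_ball.1 hw
    exact ⟨i, w, h3, h4, mem_outN.1 hw', h5⟩
  choose i w hi1 hik hvw hxw using hlayer
  have merge : ∀ {i j s t : ℕ} {u a b : V}, 1 ≤ i → i ≤ j → j ≤ k → DWalk E i x a →
      DWalk E j x b → DWalk E s u a → DWalk E t u b →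
      ∃ y, DWalk E (s + (j + 1 - i)) u y ∧ DWalk E (t + 1) u y := by
    intro i j s t u a b hi hij hj hxa hxb hua hub
    obtain ⟨y, hy, hy'⟩ := exists_common_of_layers hδ hE hcard hdisj (c := j + 1) (by omega)
      (by omega) (A := reachSet E (j + 1 - i) a) (B := reachSet E 1 b)
      (fun y hy => mem_reachSet.2 ((hxa.add (mem_reachSet.1 hy)).of_eq (by omega)))
      (fun y hy => mem_reachSet.2 (hxb.add (mem_reachSet.1 hy)))
      (le_card_reachSet hδ hE (by omega) a) (le_card_reachSet hδ hE le_rfl b)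
    exact ⟨y, hua.add (mem_reachSet.1 hy), hub.add (mem_reachSet.1 hy')⟩
  refine ⟨fun v => (i v : ZMod k), fun u v huv => ?_⟩
  have := hi1 u
  have := hi1 v
  have := hik u
  have := hik v
  change (i v : ZMod k) = (i u : ZMod k) + 1
  rcases le_or_gt (i u) (i v) with hij | hij
  · obtain ⟨y, h1, h2⟩ := merge (hi1 u) hij (hik v) (hxw u) (hxw v) (dwalk_one.2 (hvw u))
      (DWalk.cons huv (dwalk_one.2 (hvw v)))
    have h3 : i v = i u + 1 := by
      by_contra h
      rcases lt_or_gt_of_ne (show 1 + (i v + 1 - i u) ≠ 1 + 1 + 1 by omega) with h4 | h4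
      · exact hP u _ _ (by omega) h4 (by omega) (by omega) y h1 h2
      · exact hP u _ _ (by omega) h4 (by omega) (by omega) y h2 h1
    rw [h3]
    push_cast
    rfl
  · obtain ⟨y, h1, h2⟩ := merge (hi1 v) hij.le (hik u) (hxw v) (hxw u)
      (DWalk.cons huv (dwalk_one.2 (hvw v))) (dwalk_one.2 (hvw u))
    have h3 : i u = k ∧ i v = 1 := by
      by_contra h
      exact hP u _ _ (by omega) (show 1 + 1 < 1 + 1 + (i u + 1 - i v) by omega) (by omega)
        (by omega) y h2 h1
    rw [h3.1, h3.2]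
    simp

end CycleHom

namespace CycleHom

open Finset
open scoped Classical

theorem exists_combination {ℓ L d : ℕ} (hL : 1 ≤ L) (hd : 1 ≤ d) (hdvd : d ∣ ℓ)
    (h : L * (L + d - 2) ≤ ℓ) : ∃ u v, u * L + v * (L + d) = ℓ := by
  obtain ⟨q, rfl⟩ := hdvd
  have hq := Nat.div_add_mod q L
  have hs := Nat.mod_lt q hL
  set t := q / L
  set s := q % L
  have hle : s ≤ t * d := by
    by_contra! hc
    have h2 : 2 ≤ L := by omega
    obtain ⟨M, rfl⟩ := Nat.exists_eq_add_of_le' h2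
    rw [show M + 2 + d - 2 = M + d by omega] at h
    have h3 : t * d ≤ M := by omega
    have h4 : s ≤ M + 1 := by omega
    have h5 : d * q = (t * d) * (M + 2) + d * s := by rw [← hq]; ring
    have h6 : (t * d) * (M + 2) ≤ M * (M + 2) := Nat.mul_le_mul_right _ h3
    have h7 : d * s ≤ d * (M + 1) := Nat.mul_le_mul_left _ h4
    nlinarith
  obtain ⟨u, hu⟩ := Nat.exists_eq_add_of_le' hle
  refine ⟨u, s, ?_⟩
  have h5 : d * q = (t * d) * L + d * s := by rw [← hq]; ring
  rw [h5, hu]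
  ring

variable {V : Type*}

theorem no_meeting {E : V → V → Prop} {ℓ a d r : ℕ} (hno : NoClosed E ℓ) (hd : 1 ≤ d)
    (hdvd : d ∣ ℓ) (hL : 1 ≤ a + r) (h : (a + r) * (a + r + d - 2) ≤ ℓ) {x y : V}
    (h₁ : DWalk E a x y) (h₂ : DWalk E (a + d) x y) (h₃ : DWalk E r y x) : False := by
  obtain ⟨u, v, huv⟩ := exists_combination hL hd hdvd h
  refine hno x ((((h₁.add h₃).mul u).add ((h₂.add h₃).mul v)).of_eq ?_)
  rw [← huv]
  ring

theorem no_meeting_of_le {E : V → V → Prop} {ℓ a b r A B : ℕ} (hno : NoClosed E ℓ) (hab : a < b)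
    (hdvd : b - a ∣ ℓ) (hL : 1 ≤ a + r) (hA : a + r ≤ A) (hB : b + r ≤ B + 2) (h : A * B ≤ ℓ)
    {x y : V} (h₁ : DWalk E a x y) (h₂ : DWalk E b x y) (h₃ : DWalk E r y x) : False :=
  no_meeting hno (by omega) hdvd hL ((Nat.mul_le_mul hA (by omega)).trans h) h₁
    (h₂.of_eq (by omega)) h₃

variable [Fintype V]

theorem card_ball_add_le {E : V → V → Prop} {i j : ℕ} {x : V}
    (h : ∀ r, 2 ≤ r → r ≤ i + j → ¬ DWalk E r x x) :
    (#(ball E i x) : ℝ) + #(ball (Function.swap E) j x) ≤ Fintype.card V := by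
  by_contra! hc
  obtain ⟨r, h1, h2, h3⟩ := meet hc
  exact h r h1 h2 h3

theorem exp_of_large {E : V → V → Prop} {ℓ k J : ℕ} (hk : 3 ≤ k) (hJ : 1 ≤ J)
    (hdiv : ∀ d, 1 ≤ d → d < k → d ∣ ℓ) (hno : NoClosed E ℓ)
    (hpow : (1 - 1 / ((k : ℝ) - 1)) ^ J < 1 / ((k : ℝ) - 1))
    (hℓ : (k - 2 + J) * (k - 3 + J) ≤ ℓ) : Exp E (1 / ((k : ℝ) - 1)) := by
  have hk' : (3 : ℝ) ≤ k := by exact_mod_cast hk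
  refine exp_of_extremal E _ fun W hW c hc hmin hexp => ?_
  have hno' := hno.restrict W
  have : Nonempty W := hW.to_subtype
  have hm : (0 : ℝ) < Fintype.card W := by exact_mod_cast Fintype.card_pos
  have hc₁ : 0 < 1 / ((k : ℝ) - 1) := by apply one_div_pos.2; linarith
  obtain ⟨x, hx, hret⟩ := exists_hub hc₁ hc hJ hpow hmin hexp
  have h1 := ball_mul_of_disjoint (mul_pos (hc₁.trans hc) hm) hmin (j := k - 2) (x := x)
    fun a b ha hab hb y h₁ h₂ => by
      obtain ⟨r, h2, hr, h₃⟩ := hret y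
      exact no_meeting_of_le hno' hab (hdiv _ (by omega) (by omega)) (by omega)
        (show a + r ≤ k - 2 + J by omega) (show b + r ≤ k - 3 + J + 2 by omega) hℓ h₁ h₂ h₃
  have h2 := card_ball_add_le (E := restrict E W) (i := k - 2) (j := 1) (x := x)
    fun r h2 hr => hno'.of_dvd (hdiv r (by omega) (by omega)) x
  rw [Nat.cast_sub (by omega)] at h1
  push_cast at h1
  have h3 : 1 < ((k : ℝ) - 1) * c := by
    rw [div_lt_iff₀ (by linarith)] at hc
    linarith
  nlinarith

theorem hom_of_large {E : V → V → Prop} {ℓ k J h : ℕ} (hk : 3 ≤ k) (hJ : 1 ≤ J) (hh : 1 ≤ h)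
    (hdiv : ∀ d, 1 ≤ d → d < k → d ∣ ℓ) (hno : NoClosed E ℓ)
    (hpow : (1 - 1 / ((k : ℝ) - 1)) ^ J < 1 / ((k : ℝ) - 1))
    (hJℓ : (k - 2 + J) * (k - 3 + J) ≤ ℓ)
    (hh1 : 1 < 2 * (((k : ℝ) - 1) / k * (1 - 1 / (30 * k)) * (1 - (1 - 1 / ((k : ℝ) - 1)) ^ h)))
    (hhℓ : (k + 2 * h) * (k + 2 * h - 1) ≤ ℓ)
    (hout : MinOut E (Fintype.card V / k * (1 - 1 / (30 * k))))
    (hin : MinOut (Function.swap E) (Fintype.card V / k * (1 - 1 / (30 * k)))) :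
    ∃ f : V → ZMod k, ∀ u v, E u v → f v = f u + 1 := by
  have hk' : (3 : ℝ) ≤ k := by exact_mod_cast hk
  rcases isEmpty_or_nonempty V with hV | hV
  · exact ⟨fun _ => 0, fun u => hV.elim u⟩
  have hm : (0 : ℝ) < Fintype.card V := by exact_mod_cast Fintype.card_pos
  have hfac : (0 : ℝ) < 1 - 1 / (30 * k) := by
    rw [sub_pos, div_lt_one (by positivity)]
    linarith
  set δ : ℝ := Fintype.card V / k * (1 - 1 / (30 * k)) with hδdef
  have hδ : 0 < δ := by positivity
  have hc₁ : 0 < 1 / ((k : ℝ) - 1) := by apply one_div_pos.2; linarith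
  have hc₁' : 1 / ((k : ℝ) - 1) ≤ 1 := by
    rw [div_le_one (by linarith)]
    linarith
  have hball : ∀ F : V → V → Prop, NoClosed F ℓ → MinOut F δ → ∀ x,
      (Fintype.card V : ℝ) < 2 * #(ball F h x) := by
    intro F hF hmin x
    have h1 := (ball_closed_form hmin (exp_of_large hk hJ hdiv hF hpow hJℓ) hc₁' hh x).resolve_right
      (by linarith)
    set p := 1 - (1 - 1 / ((k : ℝ) - 1)) ^ h
    have h2 : ((k : ℝ) - 1) * (δ * p) ≤ #(ball F h x) := by
      have := mul_le_mul_of_nonneg_left h1 (by linarith : (0 : ℝ) ≤ (k : ℝ) - 1)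
      rwa [← mul_assoc ((k : ℝ) - 1) (1 / ((k : ℝ) - 1)), mul_one_div_cancel (by linarith),
        one_mul] at this
    have h3 : 2 * (((k : ℝ) - 1) * (δ * p)) = Fintype.card V *
        (2 * (((k : ℝ) - 1) / k * (1 - 1 / (30 * k)) * p)) := by
      rw [hδdef]
      ring
    nlinarith
  refine hom_of_separated hk hδ hout ?_ fun x a b ha hab hb hd y h₁ h₂ => ?_
  · have h1 : ((k : ℝ) + 1) * δ =
        Fintype.card V * (1 + (29 * k - 1) / (30 * k ^ 2)) := by
      rw [hδdef]
      field_simp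
      ring
    have h2 : (0 : ℝ) < (29 * k - 1) / (30 * k ^ 2) := by
      apply div_pos
      · linarith
      · positivity
    rw [h1]
    nlinarith
  · obtain ⟨r, h2, hr, h₃⟩ := meet (E := E) (i := h) (j := h) (x := x) (y := y) (by
      have h3 := hball E hno hout y
      have h4 := hball _ hno.swap hin x
      linarith)
    exact no_meeting_of_le hno hab (hdiv _ (by omega) (by omega)) (by omega)
      (show a + r ≤ k + 2 * h by omega) (show b + r ≤ k + 2 * h - 1 + 2 by omega) hhℓ h₁ h₂ h₃

end CycleHom

namespace CycleHom

theorem choose_dvd_of_forall_dvd {ℓ n j : ℕ} (hℓ : ℓ ≠ 0) (hj : j ≤ n)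
    (hdiv : ∀ d, 1 ≤ d → d ≤ n → d ∣ ℓ) : n.choose j ∣ ℓ := by
  rcases Nat.eq_zero_or_pos n with rfl | hn
  · obtain rfl : j = 0 := by omega
    simp
  refine (Nat.factorization_le_iff_dvd (Nat.choose_pos hj).ne' hℓ).1 fun p => ?_
  by_cases hp : p.Prime
  · exact (hp.pow_dvd_iff_le_factorization hℓ).1
      (hdiv _ (Nat.pow_pos hp.pos) (Nat.pow_factorization_choose_le hn))
  · simp [Nat.factorization_eq_zero_of_not_prime _ hp]

theorem one_sub_inv_pow_le {k j : ℕ} (hk : 2 ≤ k) :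
    (1 - 1 / ((k : ℝ) - 1)) ^ j ≤ Real.exp (-(j / ((k : ℝ) - 1))) := by
  have hk' : (2 : ℝ) ≤ k := by exact_mod_cast hk
  have h0 : 0 ≤ 1 - 1 / ((k : ℝ) - 1) := by
    rw [sub_nonneg, div_le_one (by linarith)]
    linarith
  have h1 := Real.add_one_le_exp (-(1 / ((k : ℝ) - 1)))
  calc (1 - 1 / ((k : ℝ) - 1)) ^ j ≤ (Real.exp (-(1 / ((k : ℝ) - 1)))) ^ j :=
        pow_le_pow_left₀ h0 (by linarith) j
    _ = _ := by
        rw [← Real.exp_nat_mul]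
        congr 1
        ring

theorem one_sub_inv_pow_mul_le {k j : ℕ} (hk : 2 ≤ k) :
    (1 - 1 / ((k : ℝ) - 1)) ^ (j * k) ≤ (1 / 2.7) ^ j := by
  have hk' : (2 : ℝ) ≤ k := by exact_mod_cast hk
  refine (one_sub_inv_pow_le hk).trans ?_
  have h1 : Real.exp (-1) ≤ 1 / 2.7 := by
    rw [Real.exp_neg, ← one_div]
    apply one_div_le_one_div_of_le (by norm_num)
    linarith [Real.exp_one_gt_d9]
  calc Real.exp (-(((j * k : ℕ) : ℝ) / ((k : ℝ) - 1))) ≤ Real.exp (j * (-1)) := by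
        apply Real.exp_le_exp.2
        have : (j : ℝ) ≤ ((j * k : ℕ) : ℝ) / ((k : ℝ) - 1) := by
          rw [le_div_iff₀ (by linarith)]
          push_cast
          nlinarith [(Nat.cast_nonneg j : (0 : ℝ) ≤ j)]
        linarith
    _ = Real.exp (-1) ^ j := Real.exp_nat_mul _ _
    _ ≤ _ := pow_le_pow_left₀ (Real.exp_pos _).le h1 j

theorem one_sub_inv_pow_pred_le {k : ℕ} (hk : 2 ≤ k) :
    (1 - 1 / ((k : ℝ) - 1)) ^ (k - 1) ≤ 1 / 2.7 := by
  have hk' : (2 : ℝ) ≤ k := by exact_mod_cast hk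
  refine (one_sub_inv_pow_le hk).trans ?_
  rw [Nat.cast_sub (by omega), Nat.cast_one, div_self (by linarith), Real.exp_neg, ← one_div]
  apply one_div_le_one_div_of_le (by norm_num)
  linarith [Real.exp_one_gt_d9]

theorem return_bound_of_pow {ℓ k j : ℕ} (hk : 10 ≤ k) (hj : 1 ≤ j) (h1 : (k : ℝ) ≤ 2.7 ^ j)
    (h2 : (j + 1) * k * ((j + 1) * k - 4) ≤ ℓ) :
    ∃ J, 1 ≤ J ∧ (1 - 1 / ((k : ℝ) - 1)) ^ J < 1 / ((k : ℝ) - 1) ∧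
      (k - 2 + J) * (k - 3 + J) ≤ ℓ := by
  have hk' : (10 : ℝ) ≤ k := by exact_mod_cast hk
  have h3 : (j + 1) * k = j * k + k := by ring
  have h4 : 1 * k ≤ j * k := Nat.mul_le_mul_right _ hj
  refine ⟨j * k, by omega, (one_sub_inv_pow_mul_le (by omega)).trans_lt ?_, ?_⟩
  · rw [one_div_pow]
    apply one_div_lt_one_div_of_lt <;> linarith
  · rw [h3] at h2
    obtain ⟨i, hi⟩ := Nat.exists_eq_add_of_le' (show 4 ≤ j * k + k by omega)
    rw [hi, Nat.add_sub_cancel] at h2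
    rw [show k - 2 + j * k = i + 2 by omega, show k - 3 + j * k = i + 1 by omega]
    have : 10 ≤ i := by omega
    nlinarith

theorem le_of_choose_six_dvd {ℓ k : ℕ} (hk : 400 < k) (hℓ : 0 < ℓ)
    (hdvd : (k - 1).choose 6 ∣ ℓ) : (k + 1) * k * ((k + 1) * k) ≤ ℓ := by
  have hch : (k - 1).choose 6 ≤ ℓ := Nat.le_of_dvd hℓ hdvd
  have hpow := Nat.pow_sub_le_descFactorial (k - 1) 6
  rw [Nat.descFactorial_eq_factorial_mul_choose] at hpow
  obtain ⟨i, rfl⟩ := Nat.exists_eq_add_of_le' (show 6 ≤ k by omega)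
  rw [show i + 6 - 1 + 1 - 6 = i by omega] at hpow
  have h720 : Nat.factorial 6 = 720 := rfl
  rw [h720] at hpow
  have hi : 395 ≤ i := by omega
  have hbig : i ^ 6 ≤ 720 * ℓ := hpow.trans (Nat.mul_le_mul_left _ hch)
  have hi2 : 150000 ≤ i ^ 2 := by nlinarith
  have hi4 : 208 * i ^ 4 ≤ ℓ := by
    have h1 : 150000 * i ^ 4 ≤ i ^ 2 * i ^ 4 := Nat.mul_le_mul_right _ hi2
    have h2 : i ^ 2 * i ^ 4 = i ^ 6 := by ring
    generalize i ^ 4 = a at *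
    omega
  have hsq : (i + 6 + 1) * (i + 6) ≤ 2 * i ^ 2 := by nlinarith
  have hfour := Nat.mul_le_mul hsq hsq
  have hfour' : (2 * i ^ 2) * (2 * i ^ 2) = 4 * i ^ 4 := by ring
  refine hfour.trans ?_
  rw [hfour']
  generalize i ^ 4 = a at *
  omega

theorem exists_return_bound {ℓ k : ℕ} (hk : 10 ≤ k) (hℓ : 0 < ℓ)
    (hdiv : ∀ d, 1 ≤ d → d < k → d ∣ ℓ) :
    (∃ J, 1 ≤ J ∧ (1 - 1 / ((k : ℝ) - 1)) ^ J < 1 / ((k : ℝ) - 1) ∧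
      (k - 2 + J) * (k - 3 + J) ≤ ℓ) ∧ 3 * k * (3 * k) ≤ ℓ := by
  have h2520 : 2520 ∣ ℓ :=
    Nat.Coprime.mul_dvd_of_dvd_of_dvd (m := 5 * 7) (n := 8 * 9) (by norm_num)
      (Nat.Coprime.mul_dvd_of_dvd_of_dvd (by norm_num) (hdiv 5 (by omega) (by omega))
        (hdiv 7 (by omega) (by omega)))
      (Nat.Coprime.mul_dvd_of_dvd_of_dvd (by norm_num) (hdiv 8 (by omega) (by omega))
        (hdiv 9 (by omega) (by omega)))
  have hle : 2520 ≤ ℓ := Nat.le_of_dvd hℓ h2520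
  rcases le_or_gt k 11 with hk11 | hk11
  · refine ⟨return_bound_of_pow (j := 3) hk (by norm_num) ?_ ?_, ?_⟩
    · have : (k : ℝ) ≤ 11 := by exact_mod_cast hk11
      norm_num
      linarith
    · exact (Nat.mul_le_mul (show (3 + 1) * k ≤ 44 by omega)
        (show (3 + 1) * k - 4 ≤ 40 by omega)).trans (by omega)
    · exact (Nat.mul_le_mul (show 3 * k ≤ 33 by omega)
        (show 3 * k ≤ 33 by omega)).trans (by omega)
  have h27720 : 27720 ∣ ℓ := Nat.Coprime.mul_dvd_of_dvd_of_dvd (m := 2520) (n := 11) (by norm_num)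
    h2520 (hdiv 11 (by omega) (by omega))
  have hle : 27720 ≤ ℓ := Nat.le_of_dvd hℓ h27720
  rcases le_or_gt k 19 with hk19 | hk19
  · refine ⟨return_bound_of_pow (j := 3) hk (by norm_num) ?_ ?_, ?_⟩
    · have : (k : ℝ) ≤ 19 := by exact_mod_cast hk19
      norm_num
      linarith
    · exact (Nat.mul_le_mul (show (3 + 1) * k ≤ 76 by omega)
        (show (3 + 1) * k - 4 ≤ 76 by omega)).trans (by omega)
    · exact (Nat.mul_le_mul (show 3 * k ≤ 57 by omega)
        (show 3 * k ≤ 57 by omega)).trans (by omega)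
  have hbig : 27720 * (13 * (17 * 19)) ∣ ℓ :=
    Nat.Coprime.mul_dvd_of_dvd_of_dvd (by norm_num) h27720
      (Nat.Coprime.mul_dvd_of_dvd_of_dvd (by norm_num) (hdiv 13 (by omega) (by omega))
        (Nat.Coprime.mul_dvd_of_dvd_of_dvd (by norm_num) (hdiv 17 (by omega) (by omega))
          (hdiv 19 (by omega) (by omega))))
  have hle : 116396280 ≤ ℓ := Nat.le_of_dvd hℓ hbig
  rcases le_or_gt k 400 with hk400 | hk400
  · refine ⟨return_bound_of_pow (j := 7) hk (by norm_num) ?_ ?_, ?_⟩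
    · have : (k : ℝ) ≤ 400 := by exact_mod_cast hk400
      norm_num
      linarith
    · exact (Nat.mul_le_mul (show (7 + 1) * k ≤ 3200 by omega)
        (show (7 + 1) * k - 4 ≤ 3200 by omega)).trans (by omega)
    · exact (Nat.mul_le_mul (show 3 * k ≤ 1200 by omega)
        (show 3 * k ≤ 1200 by omega)).trans (by omega)
  have hch := le_of_choose_six_dvd hk400 hℓ
    (choose_dvd_of_forall_dvd hℓ.ne' (by omega) fun d h1 h2 => hdiv d h1 (by omega))
  refine ⟨return_bound_of_pow (j := k) hk (by omega) ?_
    ((Nat.mul_le_mul_left _ (Nat.sub_le _ _)).trans hch), ?_⟩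
  · have h1 := one_add_mul_le_pow (show (-2 : ℝ) ≤ 1.7 by norm_num) k
    have h2 : (1 : ℝ) + 1.7 = 2.7 := by norm_num
    rw [h2] at h1
    have h3 : (0 : ℝ) ≤ k := Nat.cast_nonneg k
    linarith
  · have h1 : 3 * k ≤ (k + 1) * k := Nat.mul_le_mul_right _ (by omega)
    exact (Nat.mul_le_mul h1 h1).trans hch

theorem exists_params {ℓ k : ℕ} (hk : 8 ≤ k) (hℓ : 0 < ℓ)
    (hdiv : ∀ d, 1 ≤ d → d < k → d ∣ ℓ) :
    ∃ J h, 1 ≤ J ∧ 1 ≤ h ∧ (1 - 1 / ((k : ℝ) - 1)) ^ J < 1 / ((k : ℝ) - 1) ∧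
      (k - 2 + J) * (k - 3 + J) ≤ ℓ ∧
      1 < 2 * (((k : ℝ) - 1) / k * (1 - 1 / (30 * k)) * (1 - (1 - 1 / ((k : ℝ) - 1)) ^ h)) ∧
      (k + 2 * h) * (k + 2 * h - 1) ≤ ℓ := by
  have h105 : 3 * (5 * 7) ∣ ℓ :=
    Nat.Coprime.mul_dvd_of_dvd_of_dvd (by norm_num) (hdiv 3 (by omega) (by omega))
      (Nat.Coprime.mul_dvd_of_dvd_of_dvd (by norm_num) (hdiv 5 (by omega) (by omega))
        (hdiv 7 (by omega) (by omega)))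
  rcases eq_or_ne k 8 with rfl | hk8
  · have hle : 420 ≤ ℓ := Nat.le_of_dvd hℓ (Nat.Coprime.mul_dvd_of_dvd_of_dvd
      (m := 3 * (5 * 7)) (n := 4) (by norm_num) h105 (hdiv 4 (by omega) (by omega)))
    refine ⟨13, 6, by norm_num, by norm_num, by norm_num, by omega, by norm_num, by omega⟩
  rcases eq_or_ne k 9 with rfl | hk9
  · have hle : 840 ≤ ℓ := Nat.le_of_dvd hℓ (Nat.Coprime.mul_dvd_of_dvd_of_dvd
      (m := 3 * (5 * 7)) (n := 8) (by norm_num) h105 (hdiv 8 (by omega) (by omega)))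
    refine ⟨16, 7, by norm_num, by norm_num, by norm_num, by omega, by norm_num, by omega⟩
  have hk10 : 10 ≤ k := by omega
  have hk' : (10 : ℝ) ≤ k := by exact_mod_cast hk10
  obtain ⟨⟨J, hJ, hJ1, hJ2⟩, hJ3⟩ := exists_return_bound hk10 hℓ hdiv
  refine ⟨J, k - 1, hJ, by omega, hJ1, hJ2, ?_, ?_⟩
  · have h1 := one_sub_inv_pow_pred_le (show 2 ≤ k by omega)
    have h2 : (0.9 : ℝ) ≤ ((k : ℝ) - 1) / k := by
      rw [le_div_iff₀ (by linarith)]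
      linarith
    have h3 : (299 / 300 : ℝ) ≤ 1 - 1 / (30 * k) := by
      have : 1 / (30 * (k : ℝ)) ≤ 1 / 300 := one_div_le_one_div_of_le (by norm_num) (by linarith)
      linarith
    have h4 : (0.9 : ℝ) * (299 / 300) ≤ ((k : ℝ) - 1) / k * (1 - 1 / (30 * k)) :=
      mul_le_mul h2 h3 (by norm_num) (by linarith)
    have h5 : (1 - 1 / 2.7 : ℝ) ≤ 1 - (1 - 1 / ((k : ℝ) - 1)) ^ (k - 1) := by linarith
    have h6 := mul_le_mul h4 h5 (by norm_num) (by linarith)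
    norm_num at h6 ⊢
    linarith
  · exact (Nat.mul_le_mul (show k + 2 * (k - 1) ≤ 3 * k by omega)
      (show k + 2 * (k - 1) - 1 ≤ 3 * k by omega)).trans hJ3

end CycleHom

namespace CycleHom

set_option synthInstance.maxSize 2000 in
set_option synthInstance.maxHeartbeats 400000 in
theorem sixty_combination : ∀ a < 11, ∀ b < 11, ∀ r < 11, ∀ g < 10,
    (1 ≤ a ∧ a < b ∧ b ≤ 8 ∧ b ≤ a + 6 ∧ 2 ≤ r ∧ (4 ≤ b → r ≤ 9) ∧ (5 ≤ b → r ≤ 8) ∧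
      7 ≤ g ∧ (5 ≤ b → g ≤ 8)) →
    ∃ v < 7, ∃ w < 7, v * (a + r) + w * (b + r) ≤ 60 ∧
      (60 - (v * (a + r) + w * (b + r))) % g = 0 := by decide +kernel

open Finset
open scoped Classical

variable {V : Type*}

theorem disjoint_of_sixty {E : V → V → Prop} {x : V} {R B : ℕ} (hno : NoClosed E 60)
    (hB : B ≤ 3 ∧ R ≤ 10 ∨ B ≤ 4 ∧ R ≤ 9 ∨ B ≤ 8 ∧ R ≤ 8)
    (hret : ∀ y, ∃ r, 2 ≤ r ∧ r ≤ R ∧ DWalk E r y x) (a b : ℕ) (ha : 1 ≤ a) (hab : a < b)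
    (hb : b ≤ B) (hb' : b ≤ a + 6) (y : V) (h₁ : DWalk E a x y) : ¬ DWalk E b x y := by
  intro h₂
  obtain ⟨r, hr, hrR, h₃⟩ := hret y
  obtain ⟨g, hg, hgR, h₄⟩ := hret x
  have hg' : ¬ g ∣ 60 := fun h => hno.of_dvd h x h₄
  have hg7 : 7 ≤ g ∧ g < 10 := by
    constructor
    · by_contra! h
      interval_cases g <;> omega
    · by_contra! h
      obtain rfl : g = 10 := by omega
      omega
  obtain ⟨v, _, w, _, h5, h6⟩ := sixty_combination a (by omega) b (by omega) r (by omega) g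
    (by omega) (by omega)
  obtain ⟨q, hq⟩ := Nat.dvd_of_mod_eq_zero h6
  refine hno x (((((h₁.add h₃).mul v).add ((h₂.add h₃).mul w)).add (h₄.mul q)).of_eq ?_)
  rw [mul_comm g q] at hq
  omega

variable [Fintype V]

theorem exp_of_sixty {E : V → V → Prop} (hno : NoClosed E 60) : Exp E 0.191 := by
  refine exp_of_extremal E _ fun W hW c hc hmin hexp => ?_
  have hno' := hno.restrict W
  have : Nonempty W := hW.to_subtype
  have hm : (0 : ℝ) < Fintype.card W := by exact_mod_cast Fintype.card_pos
  obtain ⟨x, hx, hret⟩ := exists_hub (J := 8) (by norm_num) hc (by norm_num) (by norm_num)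
    hmin hexp
  have h1 := ball_mul_of_disjoint (mul_pos (by linarith) hm) hmin (j := 4) (x := x)
    fun a b ha hab hb => disjoint_of_sixty hno' (B := 4) (by omega) hret a b ha hab hb (by omega)
  have h2 := card_ball_add_le (E := restrict E W) (i := 5) (j := 1) (x := x)
    fun r h2 hr => hno'.of_dvd (by interval_cases r <;> omega) x
  have h3 := ball_growth hmin hexp (by norm_num : 1 ≤ 4) x
  have h4 : (#(ball (restrict E W) 4 x) : ℝ) ≤ Fintype.card W := by
    exact_mod_cast Finset.card_le_univ _
  push_cast at h1
  have h5 : c ≤ 1 / 4 := by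
    by_contra! h
    nlinarith
  have h6 := mul_le_mul_of_nonneg_left h1 (show 0 ≤ 1 - c by linarith)
  have h7 : Fintype.card W * (6 * c - 4 * c ^ 2) ≤ (Fintype.card W : ℝ) := by nlinarith
  have h8 : 1 < 6 * c - 4 * c ^ 2 := by nlinarith
  nlinarith

theorem hom_seven {E : V → V → Prop} (hno : NoClosed E 60)
    (hout : MinOut E (209 / 1470 * Fintype.card V))
    (hin : MinOut (Function.swap E) (209 / 1470 * Fintype.card V)) :
    ∃ f : V → ZMod 7, ∀ u v, E u v → f v = f u + 1 := by
  rcases isEmpty_or_nonempty V with hV | hV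
  · exact ⟨fun _ => 0, fun u => hV.elim u⟩
  have hm : (0 : ℝ) < Fintype.card V := by exact_mod_cast Fintype.card_pos
  set n : ℝ := (Fintype.card V : ℝ) with hn
  set δ : ℝ := 209 / 1470 * n with hδdef
  have hδ : 0 < δ := by positivity
  -- Lower bounds on balls pass to return walks of bounded length, in both directions.
  have returns : ∀ {β : ℝ} {i j : ℕ}, (∀ F : V → V → Prop, NoClosed F 60 → MinOut F δ →
      MinOut (Function.swap F) δ → ∀ x, n < #(ball F i x) + β ∧ β ≤ #(ball F j x)) →
      ∀ F : V → V → Prop, NoClosed F 60 → MinOut F δ → MinOut (Function.swap F) δ →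
      ∀ x y, ∃ r, 2 ≤ r ∧ r ≤ i + j ∧ DWalk F r y x := by
    intro β i j h F h1 h2 h3 x y
    refine meet ?_
    have h4 := (h F h1 h2 h3 y).1
    have h5 := (h (Function.swap F) h1.swap h3 h2 x).2
    linarith
  have ret12 := returns (β := n / 2) (i := 6) (j := 6) fun F h1 h2 h3 x => by
    have := (ball_closed_form h2 (exp_of_sixty h1) (by norm_num) (show 1 ≤ 6 by norm_num)
      x).resolve_right (by norm_num)
    norm_num at this
    constructor <;> linarith
  have ret10 := returns (β := 3.5224 * δ) (i := 5) (j := 5) fun F h1 h2 h3 x => by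
    have e2 := ball_two_of_sink (R := 12) hδ h2 h1 (by norm_num) (x := x) fun y => by
      obtain ⟨r, _, h5, h6⟩ := ret12 F h1 h2 h3 x y
      exact ⟨r, h5, h6⟩
    have e3 := ball_growth h2 (exp_of_sixty h1) (show 1 ≤ 2 by norm_num) x
    have e4 := ball_growth h2 (exp_of_sixty h1) (show 1 ≤ 3 by norm_num) x
    have e5 := ball_growth h2 (exp_of_sixty h1) (show 1 ≤ 4 by norm_num) x
    norm_num at e3 e4 e5
    constructor <;> linarith
  have ret9 := returns (β := 3.7724 * δ) (i := 4) (j := 5) fun F h1 h2 h3 x => by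
    have e3 := ball_mul_of_disjoint hδ h2 (j := 3) (x := x) fun a b ha hab hb =>
      disjoint_of_sixty h1 (B := 3) (by omega) (ret10 F h1 h2 h3 x) a b ha hab hb (by omega)
    have e4 := ball_growth h2 (exp_of_sixty h1) (show 1 ≤ 3 by norm_num) x
    have e5 := ball_growth h2 (exp_of_sixty h1) (show 1 ≤ 4 by norm_num) x
    norm_num at e3 e4 e5
    constructor <;> linarith
  have ret8 := returns (β := n / 2) (i := 4) (j := 4) fun F h1 h2 h3 x => by
    have e4 := ball_mul_of_disjoint hδ h2 (j := 4) (x := x) fun a b ha hab hb =>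
      disjoint_of_sixty h1 (B := 4) (by omega) (ret9 F h1 h2 h3 x) a b ha hab hb (by omega)
    norm_num at e4
    constructor <;> linarith
  refine hom_of_separated (by norm_num) hδ hout (by norm_num; linarith)
    fun x a b ha hab hb hb' => disjoint_of_sixty hno (B := 8) (by omega)
      (ret8 E hno hout hin x) a b ha hab hb (by omega)

end CycleHom

namespace CycleHom

open Finset

theorem card_le_two_of_no_consecutive :
    ∀ S : Finset (ZMod 5), (∀ i, i ∈ S → i + 1 ∉ S) → #S ≤ 2 := by decide +kernel

open scoped Classical

variable {V : Type*}

theorem NoClosed.twelve {E : V → V → Prop} (hno : NoClosed E 12) {r : ℕ}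
    (hr : r = 1 ∨ r = 2 ∨ r = 3 ∨ r = 4 ∨ r = 6 ∨ r = 12) (x : V) : ¬ DWalk E r x x :=
  hno.of_dvd (by rcases hr with rfl | rfl | rfl | rfl | rfl | rfl <;> norm_num) x

theorem NoClosed.five_seven {E : V → V → Prop} (hno : NoClosed E 12) {x : V}
    (h5 : DWalk E 5 x x) (h7 : DWalk E 7 x x) : False := hno x (h5.add h7)

variable [Fintype V]

theorem exp_of_twelve {E : V → V → Prop} (hno : NoClosed E 12) : Exp E 0.293 := by
  refine exp_of_extremal E _ fun W hW c hc hmin hexp => ?_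
  have hno' := hno.restrict W
  have : Nonempty W := hW.to_subtype
  have hm : (0 : ℝ) < Fintype.card W := by exact_mod_cast Fintype.card_pos
  obtain ⟨x, hx, hret⟩ := exists_hub (J := 4) (by norm_num) hc (by norm_num) (by norm_num)
    hmin hexp
  have h1 := ball_two_of_sink (R := 5) (mul_pos (by linarith) hm) hmin hno' (by norm_num)
    (x := x) fun y => by
      obtain ⟨r, _, h5, h6⟩ := hret y
      exact ⟨r, h5, h6⟩
  have h2 := card_ball_add_le (E := restrict E W) (i := 3) (j := 1) (x := x)
    fun r h2 hr => hno'.twelve (by omega) x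
  have h3 := ball_growth hmin hexp (by norm_num : 1 ≤ 2) x
  have h4 : (#(ball (restrict E W) 2 x) : ℝ) ≤ Fintype.card W := by
    exact_mod_cast Finset.card_le_univ _
  have h5 : c ≤ 1 / 2 := by
    by_contra! h
    nlinarith
  have h6 := mul_le_mul_of_nonneg_left h1 (show 0 ≤ 1 - c by linarith)
  have h7 : Fintype.card W * (4 * c - 2 * c ^ 2) ≤ (Fintype.card W : ℝ) := by nlinarith
  have h8 : 1 < 4 * c - 2 * c ^ 2 := by nlinarith
  nlinarith

theorem exp_of_twelve_of_five {E : V → V → Prop} (hno : NoClosed E 12) (hno5 : NoClosed E 5) :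
    Exp E 0.236 := by
  refine exp_of_extremal E _ fun W hW c hc hmin hexp => ?_
  have hno' := hno.restrict W
  have : Nonempty W := hW.to_subtype
  have hm : (0 : ℝ) < Fintype.card W := by exact_mod_cast Fintype.card_pos
  obtain ⟨x, hx, hret⟩ := exists_hub (J := 6) (by norm_num) hc (by norm_num) (by norm_num)
    hmin hexp
  have h1 := ball_two_of_sink (R := 7) (mul_pos (by linarith) hm) hmin hno' (by norm_num)
    (x := x) fun y => by
      obtain ⟨r, _, h5, h6⟩ := hret y
      exact ⟨r, h5, h6⟩
  have h2 := card_ball_add_le (E := restrict E W) (i := 5) (j := 1) (x := x) fun r h2 hr => by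
    rcases eq_or_ne r 5 with rfl | h
    · exact hno5.restrict W x
    · exact hno'.twelve (by omega) x
  have h3 := ball_growth hmin hexp (by norm_num : 1 ≤ 2) x
  have h4 := ball_growth hmin hexp (by norm_num : 1 ≤ 3) x
  have h5 := ball_growth hmin hexp (by norm_num : 1 ≤ 4) x
  have h6 : (#(ball (restrict E W) 2 x) : ℝ) ≤ Fintype.card W := by
    exact_mod_cast Finset.card_le_univ _
  have h7 : c ≤ 1 / 2 := by
    by_contra! h
    nlinarith
  have h0 : 0 ≤ 1 - c := by linarith
  simp only [Nat.reduceAdd] at h3 h4 h5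
  set m : ℝ := (Fintype.card W : ℝ)
  have g3 : m * (1 - (1 - c) * (1 - 2 * c)) ≤ #(ball (restrict E W) 3 x) := by
    have := mul_le_mul_of_nonneg_left h1 h0
    linarith
  have g4 : m * (1 - (1 - c) ^ 2 * (1 - 2 * c)) ≤ #(ball (restrict E W) 4 x) := by
    have := mul_le_mul_of_nonneg_left g3 h0
    linarith
  have g5 : m * (1 - (1 - c) ^ 3 * (1 - 2 * c)) ≤ #(ball (restrict E W) 5 x) := by
    have := mul_le_mul_of_nonneg_left g4 h0
    linarith
  have h8 : (1 - c) ^ 3 * (1 - 2 * c) ≤ 0.764 ^ 3 * 0.528 :=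
    mul_le_mul (pow_le_pow_left₀ h0 (by linarith) 3) (by linarith) (by linarith) (by norm_num)
  norm_num at h8
  nlinarith

theorem returns_le_eight {E : V → V → Prop} (hno : NoClosed E 12)
    (hpos : 0 < (Fintype.card V : ℝ))
    (hout : MinOut E (149 / 750 * Fintype.card V))
    (hin : MinOut (Function.swap E) (149 / 750 * Fintype.card V)) (x y : V) :
    ∃ r, r ≤ 8 ∧ DWalk E r y x := by
  have key : ∀ F : V → V → Prop, NoClosed F 12 → MinOut F (149 / 750 * Fintype.card V) →
      ∀ x, (Fintype.card V : ℝ) / 2 < #(ball F 4 x) := fun F h1 h2 x => by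
    have e1 := le_card_ball h2 le_rfl x
    have e2 := ball_growth h2 (exp_of_twelve h1) (show 1 ≤ 1 by norm_num) x
    have e3 := ball_growth h2 (exp_of_twelve h1) (show 1 ≤ 2 by norm_num) x
    have e4 := ball_growth h2 (exp_of_twelve h1) (show 1 ≤ 3 by norm_num) x
    norm_num at e2 e3 e4
    linarith
  obtain ⟨r, _, h1, h2⟩ := meet (i := 4) (j := 4) (x := x) (y := y) (E := E) (by
    have h1 := key E hno hout y
    have h2 := key _ hno.swap hin x
    linarith)
  exact ⟨r, h1, h2⟩

theorem no_transitive_triangle {E : V → V → Prop} (hno : NoClosed E 12)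
    (hout : MinOut E (149 / 750 * Fintype.card V))
    (hin : MinOut (Function.swap E) (149 / 750 * Fintype.card V)) {x y z : V}
    (hxz : E x z) (hzy : E z y) (hxy : E x y) : False := by
  have hpos : 0 < (Fintype.card V : ℝ) := by
    have : Nonempty V := ⟨x⟩
    exact_mod_cast Fintype.card_pos
  set δ : ℝ := 149 / 750 * (Fintype.card V : ℝ) with hδdef
  have hδ : 0 < δ := by positivity
  have two : ∀ F : V → V → Prop, NoClosed F 12 → MinOut F δ → MinOut (Function.swap F) δ →
      ∀ x, 2 * δ ≤ #(ball F 2 x) := fun F h1 h2 h3 x =>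
    ball_two_of_sink (R := 8) hδ h2 h1 (by norm_num) (returns_le_eight h1 hpos h2 h3 x)
  have three : ∀ F : V → V → Prop, NoClosed F 12 → MinOut F δ → MinOut (Function.swap F) δ →
      ∀ {x y z}, F x z → F z y → F x y → 3 * δ ≤ #(ball F 3 y) := by
    intro F h1 h2 h3 x y z hxz hzy hxy
    have h4 := two F h1 h2 h3 y
    obtain ⟨v, hv, hvX⟩ := exists_sink h1 (x := x) (j := 3) (R := 8) (X := ball F 2 y)
      (Finset.card_pos.1 (by
        have : (0 : ℝ) < #(ball F 2 y) := by linarith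
        exact_mod_cast this))
      (fun w hw => by
        obtain ⟨i, hi1, hi2, hi⟩ := mem_ball.1 hw
        rcases (show i = 1 ∨ i = 2 by omega) with rfl | rfl
        · exact DWalk.cons hxz (DWalk.cons hzy hi)
        · exact DWalk.cons hxy hi) (by norm_num) (returns_le_eight h1 hpos h2 h3 x)
    have h5 := card_add_le_of_disjoint (s := ball F 2 y) (t := outN F v) (u := ball F 3 y)
      (ball_mono F (by norm_num) y) (fun u hu => by
        obtain ⟨i, hi1, hi2, hi⟩ := mem_ball.1 hv
        exact mem_ball.2 ⟨i + 1, by omega, by omega, hi.snoc (mem_outN.1 hu)⟩)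
      (fun u hu hu' => hvX u hu (mem_outN.1 hu'))
    have h6 := h2 v
    linarith
  have hy := three E hno hout hin hxz hzy hxy
  have hx := three (Function.swap E) hno.swap hin hout (x := y) (y := x) (z := z) hzy hxz hxy
  obtain ⟨r, h1, h2, h3⟩ := meet (E := E) (i := 3) (j := 3) (x := x) (y := y) (by linarith)
  have h4 : DWalk E (r + 1) x x := DWalk.cons hxy h3
  have h5 : DWalk E (r + 1 + 1) x x := DWalk.cons hxz (DWalk.cons hzy h3)
  rcases eq_or_ne r 6 with rfl | h6
  · have h6 := two E hno hout hin x
    have h7 := ball_growth hout (exp_of_twelve hno) (show 1 ≤ 2 by norm_num) x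
    norm_num at h7
    obtain ⟨g, hg1, hg2, hg⟩ := meet (E := E) (i := 3) (j := 3) (x := x) (y := x) (by linarith)
    rcases eq_or_ne g 5 with rfl | hg5
    · exact hno.five_seven hg h4
    · exact hno.twelve (by omega) x hg
  · rcases (show r = 2 ∨ r = 3 ∨ r = 5 ∨ r = 4 by omega) with rfl | rfl | rfl | rfl
    · exact hno.twelve (by norm_num) x h4
    · exact hno.twelve (by norm_num) x h4
    · exact hno.twelve (by norm_num) x h4
    · exact hno.twelve (by norm_num) x h5

theorem exists_closed_five [Nonempty V] {E : V → V → Prop} (hno : NoClosed E 12)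
    (hout : MinOut E (149 / 750 * Fintype.card V))
    (hin : MinOut (Function.swap E) (149 / 750 * Fintype.card V)) : ∃ x, DWalk E 5 x x := by
  by_contra! hc
  have hc : NoClosed E 5 := hc
  have hpos : 0 < (Fintype.card V : ℝ) := by exact_mod_cast Fintype.card_pos
  set δ : ℝ := 149 / 750 * (Fintype.card V : ℝ) with hδdef
  have hδ : 0 < δ := by positivity
  have three : ∀ F : V → V → Prop, NoClosed F 12 → NoClosed F 5 → MinOut F δ →
      MinOut (Function.swap F) δ → ∀ x, 2.528 * δ ≤ #(ball F 3 x) := by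
    intro F h1 h1' h2 h3 x
    have h4 := ball_two_of_sink (R := 8) hδ h2 h1 (by norm_num) (returns_le_eight h1 hpos h2 h3 x)
    have h5 := ball_growth h2 (exp_of_twelve_of_five h1 h1') (show 1 ≤ 2 by norm_num) x
    norm_num at h5 ⊢
    linarith
  obtain ⟨x⟩ := ‹Nonempty V›
  have h1 := three E hno hc hout hin x
  have h2 := three _ hno.swap hc.swap hin hout x
  obtain ⟨g, hg1, hg2, hg⟩ := meet (E := E) (i := 3) (j := 3) (x := x) (y := x) (by
    norm_num at h1 h2
    linarith)
  rcases eq_or_ne g 5 with rfl | hg5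
  · exact hc x hg
  · exact hno.twelve (by omega) x hg

end CycleHom

namespace CycleHom

open Finset
open scoped Classical

variable {V : Type*}

/-- The indices of the in-neighbours of a vertex on the five-cycle. -/
noncomputable def inIdx (E : V → V → Prop) (C : ZMod 5 → V) (v : V) : Finset (ZMod 5) :=
  univ.filter fun i => E (C i) v

/-- The indices of the out-neighbours of a vertex on the five-cycle. -/
noncomputable def outIdx (E : V → V → Prop) (C : ZMod 5 → V) (v : V) : Finset (ZMod 5) :=
  univ.filter fun i => E v (C i)

@[simp] theorem mem_inIdx {E : V → V → Prop} {C : ZMod 5 → V} {v : V} {i : ZMod 5} :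
    i ∈ inIdx E C v ↔ E (C i) v := by simp [inIdx]

@[simp] theorem mem_outIdx {E : V → V → Prop} {C : ZMod 5 → V} {v : V} {i : ZMod 5} :
    i ∈ outIdx E C v ↔ E v (C i) := by simp [outIdx]

theorem card_inIdx_swap (E : V → V → Prop) (C : ZMod 5 → V) (v : V) :
    #(inIdx (Function.swap E) (fun i => C (-i)) v) = #(outIdx E C v) :=
  Finset.card_equiv (Equiv.neg _) fun i => by simp [Function.swap]

theorem card_outIdx_swap (E : V → V → Prop) (C : ZMod 5 → V) (v : V) :
    #(outIdx (Function.swap E) (fun i => C (-i)) v) = #(inIdx E C v) :=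
  Finset.card_equiv (Equiv.neg _) fun i => by simp [Function.swap]

variable [Fintype V]

/-- A closed walk of length five in a graph without closed walks of length twelve and with large
minimum semidegree. -/
structure FiveCycle (E : V → V → Prop) (C : ZMod 5 → V) : Prop where
  noClosed : NoClosed E 12
  out : MinOut E (149 / 750 * Fintype.card V)
  inn : MinOut (Function.swap E) (149 / 750 * Fintype.card V)
  cyc : ∀ i, E (C i) (C (i + 1))

/-- The vertices which can replace the `j`-th vertex of the five-cycle. -/
noncomputable def twins (E : V → V → Prop) (C : ZMod 5 → V) (j : ZMod 5) : Finset V :=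
  univ.filter fun v => E (C (j - 1)) v ∧ E v (C (j + 1))

@[simp] theorem mem_twins {E : V → V → Prop} {C : ZMod 5 → V} {v : V} {j : ZMod 5} :
    v ∈ twins E C j ↔ E (C (j - 1)) v ∧ E v (C (j + 1)) := by simp [twins]

theorem le_sum_card_outIdx {E : V → V → Prop} {δ : ℝ} (hin : MinOut (Function.swap E) δ)
    (C : ZMod 5 → V) : 5 * δ ≤ ∑ v, (#(outIdx E C v) : ℝ) := by
  have h := Finset.sum_card_bipartiteAbove_eq_sum_card_bipartiteBelow (s := (univ : Finset V))
    (t := (univ : Finset (ZMod 5))) fun v i => E v (C i)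
  have h1 : ∑ v : V, (#(outIdx E C v) : ℝ) = ∑ i, (#(outN (Function.swap E) (C i)) : ℝ) := by
    exact_mod_cast h
  have h2 : ∑ _i : ZMod 5, δ ≤ ∑ i, (#(outN (Function.swap E) (C i)) : ℝ) :=
    Finset.sum_le_sum fun i _ => hin (C i)
  rw [h1]
  simpa using h2

namespace FiveCycle

variable {E : V → V → Prop} {C : ZMod 5 → V}

theorem swap (h : FiveCycle E C) : FiveCycle (Function.swap E) fun i => C (-i) where
  noClosed := h.noClosed.swap
  out := h.inn
  inn := h.out
  cyc i := by
    have := h.cyc (-(i + 1))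
    rwa [show -(i + 1) + 1 = -i by ring] at this

theorem card_pos (_h : FiveCycle E C) : 0 < (Fintype.card V : ℝ) := by
  have : Nonempty V := ⟨C 0⟩
  exact_mod_cast Fintype.card_pos

theorem no_triangle (h : FiveCycle E C) {x y z : V} (hxz : E x z) (hzy : E z y)
    (hxy : E x y) : False :=
  no_transitive_triangle h.noClosed h.out h.inn hxz hzy hxy

theorem no_cyclic_triangle (h : FiveCycle E C) {x y z : V} (hxy : E x y) (hyz : E y z)
    (hzx : E z x) : False :=
  h.noClosed.twelve (r := 3) (by norm_num) x
    (DWalk.cons hxy (DWalk.cons hyz (dwalk_one.2 hzx)))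

theorem walk (h : FiveCycle E C) (i : ZMod 5) (t : ℕ) : DWalk E t (C i) (C (i + t)) := by
  induction t with
  | zero => simp [DWalk]
  | succ t ih =>
    have := ih.snoc (h.cyc _)
    rw [add_assoc] at this
    simpa using this

theorem closed (h : FiveCycle E C) {t : ℕ} {i j : ZMod 5} (hw : DWalk E t (C i) (C j)) :
    DWalk E (t + (i - j).val) (C i) (C i) := by
  refine hw.add ?_
  have := h.walk j (i - j).val
  rwa [ZMod.natCast_zmod_val, add_sub_cancel] at this

theorem length_ne (h : FiveCycle E C) {t : ℕ} {i j : ZMod 5} (hw : DWalk E t (C i) (C j)) :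
    ¬ (t + (i - j).val = 1 ∨ t + (i - j).val = 2 ∨ t + (i - j).val = 3 ∨ t + (i - j).val = 4 ∨
      t + (i - j).val = 6 ∨ t + (i - j).val = 7 ∨ t + (i - j).val = 12) := by
  intro hlen
  have h1 := h.closed hw
  by_cases h7 : t + (i - j).val = 7
  · have h5 := h.walk i 5
    rw [show i + ((5 : ℕ) : ZMod 5) = i by
      rw [ZMod.natCast_self, add_zero]] at h5
    exact h.noClosed.five_seven h5 (h1.of_eq h7)
  · exact h.noClosed.twelve (by omega) _ h1

theorem walk_two (h : FiveCycle E C) {i j : ZMod 5} (hw : DWalk E 2 (C i) (C j)) :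
    j = i + 2 := by
  have h1 := h.length_ne hw
  have h2 := ZMod.val_lt (i - j)
  have h3 : (i - j).val = 3 := by omega
  clear * - h3
  revert i j
  decide

theorem walk_three (h : FiveCycle E C) {i j : ZMod 5} (hw : DWalk E 3 (C i) (C j)) :
    j = i + 3 := by
  have h1 := h.length_ne hw
  have h2 := ZMod.val_lt (i - j)
  have h3 : (i - j).val = 2 := by omega
  clear * - h3
  revert i j
  decide

theorem walk_four (h : FiveCycle E C) {i j : ZMod 5} (hw : DWalk E 4 (C i) (C j)) :
    j = i + 4 ∨ j = i + 1 := by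
  have h1 := h.length_ne hw
  have h2 := ZMod.val_lt (i - j)
  have h3 : (i - j).val = 1 ∨ (i - j).val = 4 := by omega
  clear * - h3
  revert i j
  decide

theorem walk_five (h : FiveCycle E C) {i j : ZMod 5} (hw : DWalk E 5 (C i) (C j)) :
    j ≠ i + 4 ∧ j ≠ i + 3 := by
  have h1 := h.length_ne hw
  have h2 := ZMod.val_lt (i - j)
  have h3 : (i - j).val ≠ 1 ∧ (i - j).val ≠ 2 := by omega
  clear * - h3
  revert i j
  decide

theorem card_inIdx_le (h : FiveCycle E C) (v : V) : #(inIdx E C v) ≤ 2 :=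
  card_le_two_of_no_consecutive _ fun i hi hi' =>
    h.no_triangle (h.cyc i) (mem_inIdx.1 hi') (mem_inIdx.1 hi)

theorem eq_of_inIdx_outIdx (h : FiveCycle E C) {v : V} {i j : ZMod 5} (hi : E (C i) v)
    (hj : E v (C j)) : j = i + 2 :=
  h.walk_two (DWalk.cons hi (dwalk_one.2 hj))

theorem card_add_card_le (h : FiveCycle E C) (v : V) :
    #(inIdx E C v) + #(outIdx E C v) ≤ 2 := by
  have h1 := h.card_inIdx_le v
  have h2 := h.swap.card_inIdx_le v
  rw [card_inIdx_swap] at h2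
  rcases (inIdx E C v).eq_empty_or_nonempty with h3 | ⟨i, hi⟩
  · rw [h3, card_empty]
    omega
  rcases (outIdx E C v).eq_empty_or_nonempty with h4 | ⟨j, hj⟩
  · rw [h4, card_empty]
    omega
  have h5 : #(inIdx E C v) ≤ 1 := Finset.card_le_one.2 fun a ha b hb => by
    have h6 := h.eq_of_inIdx_outIdx (mem_inIdx.1 ha) (mem_outIdx.1 hj)
    have h7 := h.eq_of_inIdx_outIdx (mem_inIdx.1 hb) (mem_outIdx.1 hj)
    exact add_right_cancel (h6.symm.trans h7)
  have h8 : #(outIdx E C v) ≤ 1 := Finset.card_le_one.2 fun a ha b hb => by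
    have h6 := h.eq_of_inIdx_outIdx (mem_inIdx.1 hi) (mem_outIdx.1 ha)
    have h7 := h.eq_of_inIdx_outIdx (mem_inIdx.1 hi) (mem_outIdx.1 hb)
    exact h6.trans h7.symm
  omega

theorem card_deficient_le (h : FiveCycle E C) :
    (#(univ.filter fun v => #(inIdx E C v) + #(outIdx E C v) ≤ 1) : ℝ) ≤
      1 / 75 * Fintype.card V := by
  have h1 := le_sum_card_outIdx h.inn C
  have h2 := le_sum_card_outIdx h.swap.inn fun i => C (-i)
  simp only [card_outIdx_swap] at h2
  have h3 : ∑ v : V, ((#(inIdx E C v) : ℝ) + #(outIdx E C v) +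
      if #(inIdx E C v) + #(outIdx E C v) ≤ 1 then 1 else 0) ≤ ∑ _v : V, (2 : ℝ) := by
    refine Finset.sum_le_sum fun v _ => ?_
    split_ifs with hv
    · have : ((#(inIdx E C v) : ℝ) + #(outIdx E C v)) ≤ 1 := by exact_mod_cast hv
      linarith
    · have : ((#(inIdx E C v) : ℝ) + #(outIdx E C v)) ≤ 2 := by
        exact_mod_cast h.card_add_card_le v
      linarith
  rw [Finset.sum_add_distrib, Finset.sum_add_distrib, Finset.sum_boole, Finset.sum_const,
    nsmul_eq_mul, Finset.card_univ] at h3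
  linarith

theorem two_in_large (h : FiveCycle E C) {x : V} (hx : #(inIdx E C x) = 2) :
    (0.63 : ℝ) * Fintype.card V ≤ #(univ.filter fun v => #(inIdx E C v) = 2) ∧
      ∃ w, #(outIdx E C w) = 2 := by
  have hn := h.card_pos
  have hsep : ∀ {y w : V}, #(inIdx E C y) = 2 → E y w → outIdx E C w = ∅ := by
    intro y w hy hyw
    by_contra hne
    obtain ⟨m, hm⟩ := Finset.nonempty_iff_ne_empty.2 hne
    obtain ⟨a, ha, b, hb, hab⟩ := Finset.one_lt_card.1 (by omega : 1 < #(inIdx E C y))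
    have h1 := h.walk_three (DWalk.cons (mem_inIdx.1 ha)
      (DWalk.cons hyw (dwalk_one.2 (mem_outIdx.1 hm))))
    have h2 := h.walk_three (DWalk.cons (mem_inIdx.1 hb)
      (DWalk.cons hyw (dwalk_one.2 (mem_outIdx.1 hm))))
    exact hab (add_right_cancel (h1.symm.trans h2))
  constructor
  · obtain ⟨y, hy, hyc⟩ := exp_of_twelve h.noClosed
      (univ.filter fun v => #(inIdx E C v) = 2) ⟨x, by simpa using hx⟩
    have hy2 : #(inIdx E C y) = 2 := by simpa using hy
    have h1 : outN E y ⊆ ((univ.filter fun v => #(inIdx E C v) = 2).filter (E y)) ∪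
        univ.filter fun v => #(inIdx E C v) + #(outIdx E C v) ≤ 1 := by
      intro w hw
      have h2 := hsep hy2 (mem_outN.1 hw)
      have h3 := h.card_inIdx_le w
      simp only [mem_union, mem_filter, mem_univ, true_and]
      rw [h2, card_empty]
      have := mem_outN.1 hw
      by_cases h4 : #(inIdx E C w) = 2
      · exact Or.inl ⟨h4, this⟩
      · right
        omega
    have h2 : (#(outN E y) : ℝ) ≤ #((univ.filter fun v => #(inIdx E C v) = 2).filter (E y)) +
        #(univ.filter fun v => #(inIdx E C v) + #(outIdx E C v) ≤ 1) := by
      exact_mod_cast (Finset.card_le_card h1).trans (Finset.card_union_le _ _)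
    have h3 := h.card_deficient_le
    have h4 := h.out y
    linarith
  · by_contra! hc
    have hle : ∀ v, #(outIdx E C v) ≤ 1 := fun v => by
      have h1 := h.card_add_card_le v
      have h2 := hc v
      omega
    have h1 := le_sum_card_outIdx h.inn C
    have h2 : ∑ v : V, ((#(outIdx E C v) : ℝ) + if E x v then 1 else 0) ≤ ∑ _v : V, (1 : ℝ) := by
      refine Finset.sum_le_sum fun v _ => ?_
      split_ifs with hv
      · rw [hsep hx hv, card_empty]
        norm_num
      · have : (#(outIdx E C v) : ℝ) ≤ 1 := by exact_mod_cast hle v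
        linarith
    rw [Finset.sum_add_distrib, Finset.sum_boole, Finset.sum_const,
      nsmul_eq_mul, Finset.card_univ] at h2
    have h3 : (149 / 750 : ℝ) * Fintype.card V ≤ #(univ.filter (E x)) := h.out x
    linarith

theorem card_inIdx_le_one (h : FiveCycle E C) (v : V) : #(inIdx E C v) ≤ 1 := by
  by_contra! hc
  have hv : #(inIdx E C v) = 2 := by
    have := h.card_inIdx_le v
    omega
  obtain ⟨h1, w, hw⟩ := h.two_in_large hv
  rw [← card_inIdx_swap] at hw
  have h2 := (h.swap.two_in_large hw).1
  have hn := h.card_pos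
  obtain ⟨y, hy, hy'⟩ := exists_of_card_lt (s := univ.filter fun v => #(inIdx E C v) = 2)
    (t := univ.filter fun v => #(inIdx (Function.swap E) (fun i => C (-i)) v) = 2)
    (by linarith)
  simp only [mem_filter, mem_univ, true_and, card_inIdx_swap] at hy hy'
  have := h.card_add_card_le y
  omega

theorem card_exceptional_le (h : FiveCycle E C) :
    (#(univ.filter fun v => ∀ j, v ∉ twins E C j) : ℝ) ≤ 1 / 75 * Fintype.card V := by
  refine (ncast_le fun v hv => ?_).trans h.card_deficient_le
  simp only [mem_filter, mem_univ, true_and] at hv ⊢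
  by_contra! hc
  have h1 := h.card_inIdx_le_one v
  have h2 := h.swap.card_inIdx_le_one v
  rw [card_inIdx_swap] at h2
  obtain ⟨i, hi⟩ := Finset.card_pos.1 (by omega : 0 < #(inIdx E C v))
  obtain ⟨j, hj⟩ := Finset.card_pos.1 (by omega : 0 < #(outIdx E C v))
  have h3 := h.eq_of_inIdx_outIdx (mem_inIdx.1 hi) (mem_outIdx.1 hj)
  refine hv (i + 1) (mem_twins.2 ⟨?_, ?_⟩)
  · rw [add_sub_cancel_right]
    exact mem_inIdx.1 hi
  · rw [show i + 1 + 1 = j by rw [h3]; ring]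
    exact mem_outIdx.1 hj

theorem concentrated (h : FiveCycle E C) {X : Finset V}
    (hX : (149 / 750 : ℝ) * Fintype.card V ≤ #X) {b : ZMod 5}
    (hb : ∀ w ∈ X, ∀ j, w ∈ twins E C j → j = b) :
    (139 / 750 : ℝ) * Fintype.card V ≤ #(X ∩ twins E C b) := by
  have h1 : X ⊆ (X ∩ twins E C b) ∪ univ.filter fun v => ∀ j, v ∉ twins E C j := by
    intro w hw
    by_cases hj : ∃ j, w ∈ twins E C j
    · obtain ⟨j, hj⟩ := hj
      obtain rfl := hb w hw j hj
      exact mem_union_left _ (mem_inter.2 ⟨hw, hj⟩)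
    · push Not at hj
      exact mem_union_right _ (by simpa using hj)
  have h2 : (#X : ℝ) ≤ #(X ∩ twins E C b) + #(univ.filter fun v => ∀ j, v ∉ twins E C j) := by
    exact_mod_cast (Finset.card_le_card h1).trans (Finset.card_union_le _ _)
  have h3 := h.card_exceptional_le
  linarith

theorem exists_twin (h : FiveCycle E C) {X : Finset V}
    (hX : (149 / 750 : ℝ) * Fintype.card V ≤ #X) : ∃ w ∈ X, ∃ j, w ∈ twins E C j := by
  by_contra! hc
  have hn := h.card_pos
  have h1 : X ⊆ univ.filter fun v => ∀ j, v ∉ twins E C j := fun w hw => by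
    simpa using hc w hw
  have h2 := ncast_le h1
  have h3 := h.card_exceptional_le
  linarith

theorem twins_edge (h : FiveCycle E C) {u v : V} {a b : ZMod 5} (hu : u ∈ twins E C a)
    (hv : v ∈ twins E C b) (huv : E u v) : b = a + 1 := by
  have := h.walk_three (DWalk.cons (mem_twins.1 hu).1 (DWalk.cons huv
    (dwalk_one.2 (mem_twins.1 hv).2)))
  clear * - this
  revert a b
  decide

theorem twins_path (h : FiveCycle E C) {u v w : V} {a b : ZMod 5} (hu : u ∈ twins E C a)
    (hw : w ∈ twins E C b) (huv : E u v) (hvw : E v w) : b = a + 2 ∨ b = a - 1 := by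
  have := h.walk_four (DWalk.cons (mem_twins.1 hu).1 (DWalk.cons huv (DWalk.cons hvw
    (dwalk_one.2 (mem_twins.1 hw).2))))
  clear * - this
  revert a b
  decide

theorem mem_twins_self (h : FiveCycle E C) (j : ZMod 5) : C j ∈ twins E C j := by
  have := h.cyc (j - 1)
  rw [sub_add_cancel] at this
  exact mem_twins.2 ⟨this, h.cyc j⟩

theorem le_card_twins (h : FiveCycle E C) (b : ZMod 5) :
    (139 / 750 : ℝ) * Fintype.card V ≤ #(twins E C b) := by
  refine (h.concentrated (h.out (C (b - 1))) (b := b) fun w hw j hj => ?_).trans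
    (ncast_le inter_subset_right)
  rw [h.twins_edge (h.mem_twins_self _) hj (mem_outN.1 hw), sub_add_cancel]

theorem card_twins_le (h : FiveCycle E C) (b : ZMod 5) :
    (#(twins E C b) : ℝ) ≤ 194 / 750 * Fintype.card V := by
  have h1 : #((univ : Finset (ZMod 5)).biUnion (twins E C)) = ∑ j, #(twins E C j) := by
    refine Finset.card_biUnion fun i _ j _ hij => Finset.disjoint_left.2 fun v hv hv' => hij ?_
    have := h.eq_of_inIdx_outIdx (mem_twins.1 hv).1 (mem_twins.1 hv').2
    clear * - this
    revert i j
    decide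
  have h2 := Finset.card_le_univ ((univ : Finset (ZMod 5)).biUnion (twins E C))
  rw [h1, ← Finset.add_sum_erase _ _ (mem_univ b)] at h2
  have h3 : (#(twins E C b) : ℝ) + ∑ j ∈ univ.erase b, (#(twins E C j) : ℝ) ≤ Fintype.card V := by
    exact_mod_cast h2
  have h4 := Finset.card_nsmul_le_sum (univ.erase b) (fun j => (#(twins E C j) : ℝ)) _
    fun j _ => h.le_card_twins j
  rw [Finset.card_erase_of_mem (mem_univ b), Finset.card_univ, ZMod.card, nsmul_eq_mul] at h4
  have h5 : ((5 - 1 : ℕ) : ℝ) = 4 := by norm_num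
  rw [h5] at h4
  linarith

theorem no_backward_path (h : FiveCycle E C) {u v w : V} {i : ZMod 5} (hu : u ∈ twins E C i)
    (hw : w ∈ twins E C (i - 1)) (huv : E u v) (hvw : E v w) : False := by
  have hn := h.card_pos
  have hP : (#(outN (Function.swap E) v ∩ twins E C i) : ℝ) ≤ 55 / 750 * Fintype.card V := by
    have h1 := h.concentrated (h.out w) (b := i) fun z hz j hj => by
      rw [h.twins_edge hw hj (mem_outN.1 hz), sub_add_cancel]
    have h2 := card_add_le_of_disjoint
      (inter_subset_right : outN (Function.swap E) v ∩ twins E C i ⊆ _)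
      (inter_subset_right : outN E w ∩ twins E C i ⊆ _) fun z hz hz' =>
        h.no_cyclic_triangle hvw (mem_outN.1 (mem_inter.1 hz').1) (mem_outN_swap.1 (mem_inter.1 hz).1)
    have h3 := h.card_twins_le i
    linarith
  have hQ : (#(outN E v ∩ twins E C (i - 1)) : ℝ) ≤ 55 / 750 * Fintype.card V := by
    have h1 := h.concentrated (h.inn u) (b := i - 1) fun z hz j hj => by
      rw [h.twins_edge hj hu (mem_outN_swap.1 hz), add_sub_cancel_right]
    have h2 := card_add_le_of_disjoint
      (inter_subset_right : outN E v ∩ twins E C (i - 1) ⊆ _)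
      (inter_subset_right : outN (Function.swap E) u ∩ twins E C (i - 1) ⊆ _) fun z hz hz' =>
        h.no_cyclic_triangle huv (mem_outN.1 (mem_inter.1 hz).1) (mem_outN_swap.1 (mem_inter.1 hz').1)
    have h3 := h.card_twins_le (i - 1)
    linarith
  have hex : ∃ z, E z v ∧ z ∈ twins E C (i + 2) := by
    by_contra! hc
    have h1 := h.concentrated (h.inn v) (b := i) fun z hz j hj => by
      have h2 := h.twins_path hj hw (mem_outN_swap.1 hz) hvw
      by_contra hji
      refine hc z (mem_outN_swap.1 hz) ?_
      have h3 : j = i + 2 := by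
        clear * - h2 hji
        revert i j
        decide
      exact h3 ▸ hj
    linarith
  obtain ⟨z, hzv, hz⟩ := hex
  have h1 := h.concentrated (h.out v) (b := i - 1) fun y hy j hj => by
    have h2 := h.twins_path hu hj huv (mem_outN.1 hy)
    have h3 := h.twins_path hz hj hzv (mem_outN.1 hy)
    clear * - h2 h3
    revert i j
    decide
  linarith

theorem exists_index (h : FiveCycle E C) (v : V) : ∃ a : ZMod 5,
    (∀ u j, E u v → u ∈ twins E C j → j = a - 1) ∧ (∀ w j, E v w → w ∈ twins E C j → j = a + 1) := by
  obtain ⟨u, hu, i, hi⟩ := h.exists_twin (h.inn v)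
  have key : ∀ {u w : V} {i j : ZMod 5}, E u v → E v w → u ∈ twins E C i → w ∈ twins E C j →
      j = i + 2 := by
    intro u w i j huv hvw hu hw
    rcases h.twins_path hu hw huv hvw with h1 | rfl
    · exact h1
    · exact (h.no_backward_path hu hw huv hvw).elim
  obtain ⟨w, hw, j, hj⟩ := h.exists_twin (h.out v)
  have h1 := key (mem_outN_swap.1 hu) (mem_outN.1 hw) hi hj
  refine ⟨i + 1, fun u' i' hu' hi' => ?_, fun w' j' hw' hj' => ?_⟩
  · have h2 := key hu' (mem_outN.1 hw) hi' hj
    rw [add_sub_cancel_right]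
    exact add_right_cancel (h2.symm.trans h1)
  · rw [key (mem_outN_swap.1 hu) hw' hi hj']
    ring

theorem exists_hom (h : FiveCycle E C) : ∃ f : V → ZMod 5, ∀ u v, E u v → f v = f u + 1 := by
  choose f hin hout using h.exists_index
  have hn := h.card_pos
  have h_out : ∀ v, (139 / 750 : ℝ) * Fintype.card V ≤ #(outN E v ∩ twins E C (f v + 1)) :=
    fun v => h.concentrated (h.out v) fun w hw j hj => hout v w j (mem_outN.1 hw) hj
  have h_in : ∀ v, (139 / 750 : ℝ) * Fintype.card V ≤
      #(outN (Function.swap E) v ∩ twins E C (f v - 1)) :=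
    fun v => h.concentrated (h.inn v) fun w hw j hj => hin v w j (mem_outN_swap.1 hw) hj
  refine ⟨f, fun u v huv => ?_⟩
  have h1 : f v - 1 ≠ f u + 1 := by
    intro heq
    have h2 := h_in v
    rw [heq] at h2
    obtain ⟨w, hw, hw'⟩ := exists_mem_of_card_lt
      (inter_subset_right : outN E u ∩ twins E C (f u + 1) ⊆ _)
      (inter_subset_right : outN (Function.swap E) v ∩ twins E C (f u + 1) ⊆ _)
      (by linarith [h_out u, h.card_twins_le (f u + 1)])
    exact h.no_triangle (mem_outN.1 (mem_inter.1 hw).1) (mem_outN_swap.1 (mem_inter.1 hw').1) huv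
  have h2 : f v + 1 ≠ f u - 1 := by
    intro heq
    have h2 := h_out v
    rw [heq] at h2
    obtain ⟨w, hw, hw'⟩ := exists_mem_of_card_lt
      (inter_subset_right : outN E v ∩ twins E C (f u - 1) ⊆ _)
      (inter_subset_right : outN (Function.swap E) u ∩ twins E C (f u - 1) ⊆ _)
      (by linarith [h_in u, h.card_twins_le (f u - 1)])
    exact h.no_cyclic_triangle huv (mem_outN.1 (mem_inter.1 hw).1) (mem_outN_swap.1 (mem_inter.1 hw').1)
  obtain ⟨w, hw⟩ := Finset.card_pos.1 (by
    have : (0 : ℝ) < #(outN E v ∩ twins E C (f v + 1)) := by linarith [h_out v]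
    exact_mod_cast this)
  obtain ⟨z, hz⟩ := Finset.card_pos.1 (by
    have : (0 : ℝ) < #(outN (Function.swap E) u ∩ twins E C (f u - 1)) := by linarith [h_in u]
    exact_mod_cast this)
  rw [mem_inter, mem_outN, mem_twins] at hw
  rw [mem_inter, mem_outN_swap, mem_twins] at hz
  have h3 := h.walk_five (DWalk.cons hz.2.1 (DWalk.cons hz.1 (DWalk.cons huv
    (DWalk.cons hw.1 (dwalk_one.2 hw.2.2)))))
  generalize f u = a at *
  generalize f v = b at *
  clear * - h1 h2 h3
  revert a b
  decide

end FiveCycle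

theorem hom_five {E : V → V → Prop} (hno : NoClosed E 12)
    (hout : MinOut E (149 / 750 * Fintype.card V))
    (hin : MinOut (Function.swap E) (149 / 750 * Fintype.card V)) :
    ∃ f : V → ZMod 5, ∀ u v, E u v → f v = f u + 1 := by
  rcases isEmpty_or_nonempty V with hV | hV
  · exact ⟨fun _ => 0, fun u => hV.elim u⟩
  obtain ⟨x, hx⟩ := exists_closed_five hno hout hin
  obtain ⟨w, h0, h5, hw⟩ := hx.exists_seq
  refine FiveCycle.exists_hom (C := fun i => w i.val) ⟨hno, hout, hin, fun i => ?_⟩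
  have h1 := hw i.val (ZMod.val_lt i)
  have h2 : (i.val + 1 = (i + 1).val) ∨ (i.val + 1 = 5 ∧ (i + 1).val = 0) := by
    clear * -
    revert i
    decide
  rcases h2 with h2 | ⟨h2, h3⟩
  · rwa [h2] at h1
  · rw [h2, h5] at h1
    rw [h3, h0]
    exact h1

end CycleHom

namespace CycleHom

theorem cast_outDeg {n : ℕ} (E : Fin n → Fin n → Prop) (v : Fin n) :
    outDeg E v = Finset.card (outN E v) := by
  rw [outDeg, ← Set.ncard_coe_finset]
  congr 1
  ext w
  simp

theorem cast_inDeg {n : ℕ} (E : Fin n → Fin n → Prop) (v : Fin n) :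
    inDeg E v = Finset.card (outN (Function.swap E) v) :=
  cast_outDeg (Function.swap E) v

theorem minOut_of_semiDeg {n : ℕ} {E : Fin n → Fin n → Prop} {δ : ℝ}
    (h : ∀ v, δ ≤ (semiDeg E v : ℝ)) : MinOut E δ ∧ MinOut (Function.swap E) δ := by
  refine ⟨fun v => (h v).trans ?_, fun v => (h v).trans ?_⟩
  · rw [← cast_outDeg]
    exact_mod_cast min_le_left _ _
  · rw [← cast_inDeg]
    exact_mod_cast min_le_right _ _

theorem noClosed_of_not_hasClosedWalk {n ℓ : ℕ} {E : Fin n → Fin n → Prop}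
    (h : ¬ HasClosedWalk E ℓ) : NoClosed E ℓ := fun _ hx =>
  let ⟨w, h0, hℓ, hw⟩ := hx.exists_seq
  h ⟨w, h0.trans hℓ.symm, hw⟩

end CycleHom

/-- For `ℓ` divisible by `12`, with `k` the smallest integer greater than `2` not dividing
`ℓ`, every sufficiently large oriented graph with minimum semidegree at least
`(n/k)(1 - 1/(30k))` that has no closed directed walk of length `ℓ` is homomorphic
to the directed cycle `C_k`. -/
theorem hom_to_cycle_of_no_closed_walk (ℓ k : ℕ) (hℓ : 12 ≤ ℓ) (hdvd : 12 ∣ ℓ)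
    (hk2 : 2 < k) (hkd : ¬ k ∣ ℓ) (hkmin : ∀ m : ℕ, 2 < m → ¬ m ∣ ℓ → k ≤ m) :
    ∃ n₀ : ℕ, ∀ n : ℕ, n₀ ≤ n → ∀ E : Fin n → Fin n → Prop, Oriented E →
      (∀ v, (n : ℝ) / k * (1 - 1 / (30 * k)) ≤ (semiDeg E v : ℝ)) →
      ¬ HasClosedWalk E ℓ →
      HomToCycle E k := by
  have hdiv : ∀ d, 1 ≤ d → d < k → d ∣ ℓ := by
    intro d hd hdk
    by_contra hnd
    rcases Nat.lt_or_ge 2 d with h2 | h2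
    · exact absurd (hkmin d h2 hnd) (by omega)
    · interval_cases d <;> omega
  refine ⟨0, fun n _ E _ hdeg hwalk => ?_⟩
  obtain ⟨hout, hin⟩ := CycleHom.minOut_of_semiDeg hdeg
  have hno := CycleHom.noClosed_of_not_hasClosedWalk hwalk
  rcases Nat.lt_or_ge k 8 with hk8 | hk8
  · have hk57 : k = 5 ∨ k = 7 := by
      interval_cases k <;> omega
    rcases hk57 with rfl | rfl
    · have hδ : (n : ℝ) / (5 : ℕ) * (1 - 1 / (30 * (5 : ℕ))) =
          149 / 750 * Fintype.card (Fin n) := by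
        rw [Fintype.card_fin]
        push_cast
        ring
      rw [hδ] at hout hin
      exact CycleHom.hom_five (hno.of_dvd hdvd) hout hin
    · have hδ : (n : ℝ) / (7 : ℕ) * (1 - 1 / (30 * (7 : ℕ))) =
          209 / 1470 * Fintype.card (Fin n) := by
        rw [Fintype.card_fin]
        push_cast
        ring
      rw [hδ] at hout hin
      have h5 := hdiv 5 (by norm_num) (by norm_num)
      exact CycleHom.hom_seven (hno.of_dvd (by omega)) hout hin
  · obtain ⟨J, h, hJ, hh, hpow, hJℓ, hh1, hhℓ⟩ :=
      CycleHom.exists_params hk8 (by omega) hdiv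
    have hn : (n : ℝ) = Fintype.card (Fin n) := by rw [Fintype.card_fin]
    rw [hn] at hout hin
    exact CycleHom.hom_of_large hk2 hJ hh hdiv hno hpow hJℓ hh1 hhℓ hout hin
end

section
/- Fix an integer ℓ ≥ 12 that is divisible by 12, and let k be the smallest integer greater than 2 that does not divide ℓ (so k ≥ 5). There exists n₀ = n₀(ℓ) such that if H is an oriented graph on n ≥ n₀ vertices with minimum semidegree δ±(H) ≥ (n/k)·(1 − 1/(30k)) that contains no closed directed walk of length ℓ, then for any two distinct vertices x, y of H there exists a directed path from x to y of length at most 10·⌊(k−1)/3⌋. Additionally, if k = 7, there exists such a path of length at most 12. -/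
/-- There is a directed walk of length `t` from `x` to `y` (vertices may repeat). -/
def HasWalk {V : Type*} (E : V → V → Prop) (t : ℕ) (x y : V) : Prop :=
  ∃ f : ℕ → V, f 0 = x ∧ f t = y ∧ ∀ i < t, E (f i) (f (i + 1))

namespace HasWalk

variable {V : Type*} {E : V → V → Prop} {s t : ℕ} {x y z : V}

lemma of_edge (h : E x y) : HasWalk E 1 x y :=
  ⟨fun i => if i = 0 then x else y, by simp, by simp, by
    intro i hi
    obtain rfl : i = 0 := by omega
    simpa using h⟩

lemma trans (h₁ : HasWalk E s x y) (h₂ : HasWalk E t y z) : HasWalk E (s + t) x z := by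
  obtain ⟨f, rfl, hfy, hf⟩ := h₁
  obtain ⟨g, hgy, rfl, hg⟩ := h₂
  refine ⟨fun i => if i ≤ s then f i else g (i - s), by simp, ?_, ?_⟩
  · rcases Nat.eq_zero_or_pos t with rfl | ht
    · simp [hfy, hgy]
    · simp [ht.ne']
  · intro i hi
    rcases lt_trichotomy i s with h | rfl | h
    · simpa [h.le, Nat.succ_le_of_lt h] using hf i h
    · simpa [hfy, ← hgy] using hg 0 (by omega)
    · have := hg (i - s) (by omega)
      simpa [h.not_ge, show ¬ i + 1 ≤ s by omega, show i + 1 - s = i - s + 1 by omega] using this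

lemma reverse (h : HasWalk (fun u v => E v u) t x y) : HasWalk E t y x := by
  obtain ⟨f, hx, hy, hf⟩ := h
  refine ⟨fun i => f (t - i), by simpa using hy, by simpa using hx, fun i hi => ?_⟩
  have := hf (t - (i + 1)) (by omega)
  rwa [show t - (i + 1) + 1 = t - i by omega] at this

/-- A walk contains a path with the same ends. -/
lemma exists_hasPath {n : ℕ} {E : Fin n → Fin n → Prop} {x y : Fin n}
    (h : HasWalk E t x y) : ∃ s ≤ t, HasPath E x y s := by
  classical
  have hex : ∃ s, HasWalk E s x y := ⟨t, h⟩
  refine ⟨Nat.find hex, Nat.find_le h, ?_⟩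
  have hmin : ∀ s < Nat.find hex, ¬ HasWalk E s x y := fun s hs => Nat.find_min hex hs
  obtain ⟨f, hx, hy, hf⟩ := Nat.find_spec hex
  set s := Nat.find hex
  have hne : ∀ a b, a < b → b ≤ s → f a ≠ f b := by
    intro a b hab hb heq
    have h₁ : HasWalk E a x (f a) := ⟨f, hx, rfl, fun i hi => hf i (by omega)⟩
    have h₂ : HasWalk E (s - b) (f a) y :=
      ⟨fun i => f (b + i), by simp [heq], by simp [Nat.add_sub_cancel' hb, hy],
        fun i hi => hf (b + i) (by omega)⟩
    exact hmin _ (by omega) (h₁.trans h₂)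
  refine ⟨fun i => f i, fun a b hab => ?_, by simpa using hx, by simpa using hy,
    fun i => by simpa using hf i i.2⟩
  rcases lt_trichotomy (a : ℕ) b with h | h | h
  · exact absurd hab (hne _ _ h (by omega))
  · exact Fin.ext h
  · exact absurd hab.symm (hne _ _ h (by omega))

/-- Going round a closed walk repeatedly. -/
lemma hasClosedWalk_of_dvd {n ℓ : ℕ} {E : Fin n → Fin n → Prop} {x : Fin n} (ht : 0 < t)
    (hdvd : t ∣ ℓ) (h : HasWalk E t x x) : HasClosedWalk E ℓ := by
  obtain ⟨f, h0, ht', hf⟩ := h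
  refine ⟨fun i => f (i % t), by simp [Nat.mod_eq_zero_of_dvd hdvd], fun i _ => ?_⟩
  have hlt := Nat.mod_lt i ht
  have := hf (i % t) hlt
  by_cases hi : i % t + 1 = t
  · have h1 : (i + 1) % t = 0 := by rw [← Nat.mod_add_mod, hi, Nat.mod_self]
    rw [hi, ht'] at this
    simpa [h1, h0] using this
  · have h1 : (i + 1) % t = i % t + 1 := by
      rw [← Nat.mod_add_mod, Nat.mod_eq_of_lt (by omega)]
    simpa [h1] using this

end HasWalk

section Expansion

open Finset
open scoped Classical

variable {V : Type*} (E : V → V → Prop)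

/-- The vertices of `S` reachable from `v` by a walk of length between `1` and `i` whose
vertices after `v` lie in `S`. -/
noncomputable def outBall (S : Finset V) (v : V) : ℕ → Finset V
  | 0 => ∅
  | i + 1 => outBall S v i ∪ {w ∈ S | E v w ∨ ∃ u ∈ outBall S v i, E u w}

variable {E}

lemma outBall_subset (S : Finset V) (v : V) : ∀ i, outBall E S v i ⊆ S
  | 0 => empty_subset S
  | i + 1 => union_subset (outBall_subset S v i) (filter_subset _ _)

lemma exists_hasWalk_of_mem_outBall {S : Finset V} {v w : V} {i : ℕ}
    (h : w ∈ outBall E S v i) : ∃ t, 0 < t ∧ t ≤ i ∧ HasWalk E t v w := by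
  induction i generalizing w with
  | zero => simp [outBall] at h
  | succ i ih =>
    simp only [outBall, mem_union, mem_filter] at h
    rcases h with h | ⟨-, h | ⟨u, hu, h⟩⟩
    · obtain ⟨t, h0, hi, ht⟩ := ih h
      exact ⟨t, h0, by omega, ht⟩
    · exact ⟨1, one_pos, by omega, .of_edge h⟩
    · obtain ⟨t, h0, hi, ht⟩ := ih hu
      exact ⟨t + 1, by omega, by omega, ht.trans (.of_edge h)⟩

/-- If each smaller ball has a vertex of small outdegree inside it, then the ball is large. -/
lemma le_mul_card_outBall {S : Finset V} {v : V} {c d : ℝ} {i : ℕ} (hc : 0 ≤ c) (hc1 : c ≤ 1)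
    (hv : v ∈ S) (hd : ∀ u ∈ S, d ≤ #{w ∈ S | E u w})
    (hlow : ∀ j < i, (outBall E S v j).Nonempty →
      ∃ u ∈ outBall E S v j, (#{w ∈ outBall E S v j | E u w} : ℝ) ≤ c * #(outBall E S v j)) :
    d * (1 - (1 - c) ^ i) ≤ c * #(outBall E S v i) := by
  induction i with
  | zero => simp [outBall]
  | succ i ih =>
    specialize ih fun j hj => hlow j (by omega)
    set B := outBall E S v i with hB
    have key : (1 - c) * #B + d ≤ #(outBall E S v (i + 1)) := by
      obtain ⟨u, huS, hu, hlow⟩ : ∃ u ∈ S, (∀ w ∈ S, E u w → w ∈ outBall E S v (i + 1)) ∧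
          (#{w ∈ B | E u w} : ℝ) ≤ c * #B := by
        rcases B.eq_empty_or_nonempty with h | h
        · exact ⟨v, hv, fun w hw h' => by simp [outBall, hw, h'], by simp [h]⟩
        · obtain ⟨u, hu, hl⟩ := hlow i i.lt_succ_self h
          refine ⟨u, outBall_subset S v i hu, fun w hw h' => ?_, hl⟩
          simp only [outBall, mem_union, mem_filter]
          exact Or.inr ⟨hw, Or.inr ⟨u, hu, h'⟩⟩
      have hsub : B ∪ {w ∈ S | E u w} ⊆ outBall E S v (i + 1) := by
        refine union_subset subset_union_left fun w hw => ?_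
        rw [mem_filter] at hw
        exact hu w hw.1 hw.2
      have hinter : #(B ∩ {w ∈ S | E u w}) ≤ #{w ∈ B | E u w} := by
        refine card_le_card fun w hw => ?_
        simp only [mem_inter, mem_filter] at hw ⊢
        exact ⟨hw.1, hw.2.2⟩
      have h1 := card_union_add_card_inter B {w ∈ S | E u w}
      have h2 := card_le_card hsub
      have h3 : (#B + #{w ∈ S | E u w} : ℝ) ≤
          #(outBall E S v (i + 1)) + #{w ∈ B | E u w} := by
        exact_mod_cast (by omega)
      linarith [hd u huS]
    have h1 := mul_le_mul_of_nonneg_left key hc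
    have h2 := mul_le_mul_of_nonneg_left ih (sub_nonneg.2 hc1)
    rw [pow_succ]
    linarith

/-- In an asymmetric relation on `S` some vertex is related to at most half of `S`. -/
lemma exists_two_mul_card_le {S : Finset V} (hS : S.Nonempty) (R : V → V → Prop) [DecidableRel R]
    (hR : ∀ u v, R u v → ¬ R v u) : ∃ v ∈ S, 2 * #{w ∈ S | R v w} ≤ #S := by
  by_contra! h
  have hsum := sum_lt_sum_of_nonempty hS h
  have hswap : ∑ v ∈ S, #{w ∈ S | R v w} = ∑ v ∈ S, #{w ∈ S | R w v} :=
    sum_card_bipartiteAbove_eq_sum_card_bipartiteBelow R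
  have hle : ∑ v ∈ S, (#{w ∈ S | R v w} + #{w ∈ S | R w v}) ≤ ∑ _v ∈ S, #S := by
    refine sum_le_sum fun v _ => ?_
    rw [← card_union_of_disjoint]
    · exact card_le_card (union_subset (filter_subset _ _) (filter_subset _ _))
    · exact disjoint_filter.2 fun w _ h => hR _ _ h
  rw [sum_add_distrib, ← hswap, ← two_mul, mul_sum] at hle
  exact absurd hsum hle.not_gt

/-- A digraph without closed walks of length at most `2 * j` has, in every nonempty vertex set
`S`, a vertex of outdegree at most `c * #S` inside `S`, provided that `(1 - c) ^ j ≤ 1 / 2`. -/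
lemma exists_card_filter_le {j : ℕ} {c : ℝ} (hc : 0 < c) (hc1 : c ≤ 1)
    (hcj : (1 - c) ^ j ≤ 1 / 2) (hE : ∀ t, 0 < t → t ≤ 2 * j → ∀ v, ¬ HasWalk E t v v)
    {S : Finset V} (hS : S.Nonempty) : ∃ u ∈ S, (#{w ∈ S | E u w} : ℝ) ≤ c * #S := by
  induction S using Finset.strongInduction with
  | H S ih =>
    obtain ⟨u, hu, hmin⟩ := exists_min_image S (fun u => #{w ∈ S | E u w}) hS
    refine ⟨u, hu, ?_⟩
    by_contra! hlt
    obtain ⟨v, hv, hcard⟩ := exists_two_mul_card_le hS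
      (fun v w => w ∈ outBall E S v j) (fun a b h₁ h₂ => by
        obtain ⟨s, hs0, hs, hsw⟩ := exists_hasWalk_of_mem_outBall h₁
        obtain ⟨t, ht0, ht, htw⟩ := exists_hasWalk_of_mem_outBall h₂
        exact hE (s + t) (by omega) (by omega) _ (hsw.trans htw))
    have hgrow := le_mul_card_outBall (i := j) hc.le hc1 hv
      (fun u' hu' => Nat.cast_le.2 (hmin u' hu')) fun i hi hne => by
        refine ih _ ((outBall_subset S v i).ssubset_of_ne fun h => ?_) hne
        obtain ⟨t, h0, hti, ht⟩ := exists_hasWalk_of_mem_outBall (h.symm ▸ hv)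
        exact hE t h0 (by omega) _ ht
    have hcard' : 2 * #(outBall E S v j) ≤ #S :=
      le_trans (Nat.mul_le_mul_left 2 (card_le_card fun w hw =>
        mem_filter.2 ⟨outBall_subset S v j hw, hw⟩)) hcard
    have hcast : (2 * #(outBall E S v j) : ℝ) ≤ #S := by exact_mod_cast hcard'
    nlinarith [Nat.cast_nonneg (α := ℝ) #{w ∈ S | E u w}]

/-- In a digraph with large minimum outdegree and no short closed walks, balls are large. -/
lemma card_lt_two_mul_card_outBall [Fintype V] {j r : ℕ} {c d : ℝ} (hc : 0 < c) (hc1 : c ≤ 1)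
    (hcj : (1 - c) ^ j ≤ 1 / 2) (hE : ∀ t, 0 < t → t ≤ 2 * j → ∀ v, ¬ HasWalk E t v v)
    (hd : ∀ u, d ≤ #{w | E u w}) (hr : c * Fintype.card V < 2 * (d * (1 - (1 - c) ^ r))) (v : V) :
    Fintype.card V < 2 * #(outBall E univ v r) := by
  have hgrow := le_mul_card_outBall (i := r) hc.le hc1 (mem_univ v) (fun u _ => hd u)
    fun i _ hne => exists_card_filter_le hc hc1 hcj hE hne
  have : c * (Fintype.card V : ℝ) < c * (2 * #(outBall E univ v r)) := by linarith
  exact_mod_cast lt_of_mul_lt_mul_left this hc.le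

/-- In a digraph with large minimum semidegree and no short closed walks, any two vertices are
joined by a short walk. -/
lemma exists_hasWalk_le [Fintype V] {j r : ℕ} {c d : ℝ} (hc : 0 < c) (hc1 : c ≤ 1)
    (hcj : (1 - c) ^ j ≤ 1 / 2) (hE : ∀ t, 0 < t → t ≤ 2 * j → ∀ v, ¬ HasWalk E t v v)
    (hout : ∀ u, d ≤ #{w | E u w}) (hin : ∀ u, d ≤ #{w | E w u})
    (hr : c * Fintype.card V < 2 * (d * (1 - (1 - c) ^ r))) (x y : V) :
    ∃ t ≤ 2 * r, HasWalk E t x y := by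
  have hx := card_lt_two_mul_card_outBall hc hc1 hcj hE hout hr x
  have hy := card_lt_two_mul_card_outBall (E := fun u v => E v u) hc hc1 hcj
    (fun t h0 ht v h => hE t h0 ht v h.reverse) hin hr y
  obtain ⟨z, hz⟩ := inter_nonempty_of_card_lt_card_add_card (subset_univ _) (subset_univ _)
    (show #univ < #(outBall E univ x r) + #(outBall (fun u v => E v u) univ y r) by
      rw [card_univ]; omega)
  rw [mem_inter] at hz
  obtain ⟨s, -, hs, hxz⟩ := exists_hasWalk_of_mem_outBall hz.1
  obtain ⟨t, -, ht, hzy⟩ := exists_hasWalk_of_mem_outBall hz.2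
  exact ⟨s + t, by omega, hxz.trans hzy.reverse⟩

end Expansion

/-- A choice of parameters for which balls of radius `r` cover more than half of a digraph with
minimum semidegree `(n / k) * (1 - 1 / (30 * k))` and no closed walk of length less than `k`. -/
def GoodRadius (k r : ℕ) : Prop :=
  ∃ (j : ℕ) (c : ℝ), 2 * j < k ∧ 0 < c ∧ c ≤ 1 ∧ (1 - c) ^ j ≤ 1 / 2 ∧
    c < 2 * (1 / k * (1 - 1 / (30 * k)) * (1 - (1 - c) ^ r))

lemma goodRadius_seven : GoodRadius 7 6 :=
  ⟨3, 0.21, by norm_num, by norm_num, by norm_num, by norm_num, by norm_num⟩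

lemma goodRadius_of_large {j k r : ℕ} (hj : 5 ≤ j) (hjk : 2 * j < k) (hkj : k ≤ 2 * j + 2)
    (hr : 3 * j ≤ r) : GoodRadius k r := by
  have hj' : (5 : ℝ) ≤ j := by exact_mod_cast hj
  have hk : (11 : ℝ) ≤ k := by exact_mod_cast (by omega : 11 ≤ k)
  have hkj' : (k : ℝ) ≤ 2 * j + 2 := by exact_mod_cast hkj
  have hc0 : (0 : ℝ) < 0.7 / j := by positivity
  have hc1 : (0.7 : ℝ) / j ≤ 1 := by rw [div_le_one (by linarith)]; linarith
  have hhalf : (1 - 0.7 / j : ℝ) ^ j ≤ 1 / 2 := by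
    have h1 := Real.one_sub_div_pow_le_exp_neg (n := j) (t := 0.7) (by linarith)
    have h2 : Real.exp (-0.7) ≤ Real.exp (-Real.log 2) :=
      Real.exp_le_exp.2 (by linarith [Real.log_two_lt_d9])
    rw [Real.exp_neg (Real.log 2), Real.exp_log two_pos] at h2
    linarith
  refine ⟨j, 0.7 / j, hjk, hc0, hc1, hhalf, ?_⟩
  have hq0 : (0 : ℝ) ≤ 1 - 0.7 / j := by linarith
  have hpow : (1 - 0.7 / j : ℝ) ^ r ≤ 1 / 8 := by
    calc (1 - 0.7 / j : ℝ) ^ r ≤ (1 - 0.7 / j) ^ (j * 3) :=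
          pow_le_pow_of_le_one hq0 (by linarith) (by omega)
      _ = ((1 - 0.7 / j) ^ j) ^ 3 := pow_mul _ _ _
      _ ≤ (1 / 2) ^ 3 := by gcongr
      _ = 1 / 8 := by norm_num
  have hck : 0.7 / j ≤ 1.68 * (1 / (k : ℝ)) := by
    rw [mul_one_div, div_le_div_iff₀ (by linarith) (by linarith)]
    linarith
  have hk0 : 0 < 1 / (k : ℝ) := by positivity
  have hk30 : 1 / (30 * (k : ℝ)) ≤ 1 / 330 := by
    apply one_div_le_one_div_of_le <;> linarith
  have hprod : (329 / 330 : ℝ) * (7 / 8) ≤ (1 - 1 / (30 * k)) * (1 - (1 - 0.7 / j) ^ r) :=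
    mul_le_mul (by linarith) (by linarith) (by norm_num) (by linarith)
  rw [mul_assoc (1 / (k : ℝ))]
  linarith [mul_le_mul_of_nonneg_left hprod hk0.le]

lemma goodRadius {k : ℕ} (hk : 5 ≤ k) (hk6 : k ≠ 6) : GoodRadius k (5 * ((k - 1) / 3)) := by
  by_cases h : 11 ≤ k ∧ k ≠ 15
  · refine goodRadius_of_large (j := (k - 1) / 2) (by omega) (by omega) (by omega) ?_
    obtain h' | h' := Nat.lt_or_ge k 16
    · interval_cases k <;> omega
    · omega
  · obtain rfl | rfl | rfl | rfl | rfl | rfl :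
        k = 5 ∨ k = 7 ∨ k = 8 ∨ k = 9 ∨ k = 10 ∨ k = 15 := by omega
    · exact ⟨2, 0.3, by norm_num, by norm_num, by norm_num, by norm_num, by norm_num⟩
    · exact ⟨3, 0.21, by norm_num, by norm_num, by norm_num, by norm_num, by norm_num⟩
    · exact ⟨3, 0.21, by norm_num, by norm_num, by norm_num, by norm_num, by norm_num⟩
    · exact ⟨4, 0.16, by norm_num, by norm_num, by norm_num, by norm_num, by norm_num⟩
    · exact ⟨4, 0.16, by norm_num, by norm_num, by norm_num, by norm_num, by norm_num⟩
    · exact ⟨7, 0.1, by norm_num, by norm_num, by norm_num, by norm_num, by norm_num⟩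

lemma GoodRadius.exists_hasPath {n k r : ℕ} {E : Fin n → Fin n → Prop} (h : GoodRadius k r)
    (hdeg : ∀ v, (n : ℝ) / k * (1 - 1 / (30 * k)) ≤ (semiDeg E v : ℝ))
    (hE : ∀ t, 0 < t → t < k → ∀ v, ¬ HasWalk E t v v) (x y : Fin n) :
    ∃ t ≤ 2 * r, HasPath E x y t := by
  classical
  obtain ⟨j, c, hjk, hc, hc1, hcj, hr⟩ := h
  have hcard (p : Fin n → Prop) : {w | p w}.ncard = Finset.card {w | p w} := by
    rw [← Set.ncard_coe_finset, Finset.coe_filter_univ]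
  have hn : (0 : ℝ) < n := by exact_mod_cast x.pos
  obtain ⟨t, ht, hw⟩ := exists_hasWalk_le (E := E) (r := r) hc hc1 hcj
    (fun t h0 ht => hE t h0 (by omega))
    (d := (n : ℝ) / k * (1 - 1 / (30 * k)))
    (fun u => (hdeg u).trans (Nat.cast_le.2 ((min_le_left _ _).trans_eq (hcard _))))
    (fun u => (hdeg u).trans (Nat.cast_le.2 ((min_le_right _ _).trans_eq (hcard _))))
    (by
      rw [Fintype.card_fin]
      calc c * n < 2 * (1 / k * (1 - 1 / (30 * k)) * (1 - (1 - c) ^ r)) * n := by gcongr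
        _ = _ := by ring) x y
  obtain ⟨s, hs, hp⟩ := hw.exists_hasPath
  exact ⟨s, hs.trans ht, hp⟩

/-- For `ℓ` divisible by `12`, with `k` the smallest integer greater than `2` not dividing
`ℓ`, in every sufficiently large oriented graph with minimum semidegree at least
`(n/k)(1 - 1/(30k))` and no closed directed walk of length `ℓ`, any two distinct vertices
are joined by a directed path of length at most `10⌊(k-1)/3⌋`; moreover if `k = 7` there
is such a path of length at most `12`. -/
theorem short_diameter_of_no_closed_walk (ℓ k : ℕ) (hℓ : 12 ≤ ℓ) (hdvd : 12 ∣ ℓ)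
    (hk2 : 2 < k) (hkd : ¬ k ∣ ℓ) (hkmin : ∀ m : ℕ, 2 < m → ¬ m ∣ ℓ → k ≤ m) :
    ∃ n₀ : ℕ, ∀ n : ℕ, n₀ ≤ n → ∀ E : Fin n → Fin n → Prop, Oriented E →
      (∀ v, (n : ℝ) / k * (1 - 1 / (30 * k)) ≤ (semiDeg E v : ℝ)) →
      ¬ HasClosedWalk E ℓ →
      ∀ x y : Fin n, x ≠ y →
        (∃ t : ℕ, t ≤ 10 * ((k - 1) / 3) ∧ HasPath E x y t) ∧
        (k = 7 → ∃ t : ℕ, t ≤ 12 ∧ HasPath E x y t) := by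
  refine ⟨0, fun n _ E _ hdeg hwalk x y _ => ?_⟩
  have hsmall : ∀ m, 0 < m → m < k → m ∣ ℓ := by
    intro m hm hmk
    rcases Nat.lt_or_ge 2 m with h | h
    · by_contra hm'
      exact absurd (hkmin m h hm') (by omega)
    · exact (show m ∣ 12 by interval_cases m <;> norm_num).trans hdvd
  have hk12 : ¬ k ∣ 12 := fun h => hkd (h.trans hdvd)
  have hk5 : 5 ≤ k := by
    by_contra! h
    interval_cases k <;> omega
  have hk6 : k ≠ 6 := by
    rintro rfl
    omega
  have hE : ∀ t, 0 < t → t < k → ∀ v, ¬ HasWalk E t v v :=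
    fun t h0 ht v h => hwalk (h.hasClosedWalk_of_dvd h0 (hsmall t h0 ht))
  refine ⟨?_, ?_⟩
  · obtain ⟨t, ht, hp⟩ := (goodRadius hk5 hk6).exists_hasPath hdeg hE x y
    exact ⟨t, by omega, hp⟩
  · rintro rfl
    exact goodRadius_seven.exists_hasPath hdeg hE x y
end

section
/- Fix an integer ℓ ≥ 12 that is divisible by 12, and let k be the smallest integer greater than 2 that does not divide ℓ (so k ≥ 5). There exists n₀ = n₀(ℓ) such that if H is an oriented graph on n ≥ n₀ vertices with minimum semidegree δ±(H) ≥ (n/k)·(1 − 1/(30k)) that contains no closed directed walk of length ℓ, then H does not contain an s-shortcut for any s with 2 ≤ s ≤ ⌊k/2⌋ + 1. -/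
namespace DirectedWalk

open Finset
open scoped Classical

section Basic

variable {α : Type*} {E E' : α → α → Prop}

/-- There is a directed walk of length `t` from `x` to `y`. -/
def Walk (E : α → α → Prop) : ℕ → α → α → Prop
  | 0, x, y => x = y
  | t + 1, x, y => ∃ z, E x z ∧ Walk E t z y

theorem Walk.refl (x : α) : Walk E 0 x x := rfl

theorem Walk.cons {t : ℕ} {x y z : α} (h : E x y) (hw : Walk E t y z) : Walk E (t + 1) x z :=
  ⟨y, h, hw⟩

theorem walk_one {x y : α} : Walk E 1 x y ↔ E x y := by
  constructor
  · rintro ⟨z, h, rfl⟩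
    exact h
  · exact fun h => ⟨y, h, rfl⟩

theorem Walk.append {s t : ℕ} {x y z : α} (h : Walk E s x y) (h' : Walk E t y z) :
    Walk E (s + t) x z := by
  induction s generalizing x with
  | zero => cases h; simpa using h'
  | succ s ih =>
    obtain ⟨u, hu, hw⟩ := h
    rw [show s + 1 + t = (s + t) + 1 by ring]
    exact ⟨u, hu, ih hw⟩

theorem Walk.cast {s t : ℕ} {x y : α} (h : Walk E s x y) (e : s = t) : Walk E t x y := e ▸ h

theorem Walk.snoc {t : ℕ} {x y z : α} (h : Walk E t x y) (h' : E y z) : Walk E (t + 1) x z :=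
  h.append (walk_one.2 h')

theorem Walk.split {s t : ℕ} {x z : α} (h : Walk E (s + t) x z) :
    ∃ y, Walk E s x y ∧ Walk E t y z := by
  induction s generalizing x with
  | zero => exact ⟨x, rfl, by simpa using h⟩
  | succ s ih =>
    rw [show s + 1 + t = (s + t) + 1 by ring] at h
    obtain ⟨u, hu, hw⟩ := h
    obtain ⟨y, h1, h2⟩ := ih hw
    exact ⟨y, ⟨u, hu, h1⟩, h2⟩

theorem Walk.mono (hE : ∀ x y, E x y → E' x y) {t : ℕ} {x y : α} (h : Walk E t x y) :
    Walk E' t x y := by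
  induction t generalizing x with
  | zero => exact h
  | succ t ih =>
    obtain ⟨u, hu, hw⟩ := h
    exact ⟨u, hE _ _ hu, ih hw⟩

theorem Walk.reverse {t : ℕ} {x y : α} (h : Walk E t x y) : Walk (flip E) t y x := by
  induction t generalizing x with
  | zero => exact h.symm
  | succ t ih =>
    obtain ⟨u, hu, hw⟩ := h
    exact (ih hw).snoc hu

theorem walk_flip {t : ℕ} {x y : α} : Walk (flip E) t y x ↔ Walk E t x y :=
  ⟨fun h => h.reverse, fun h => h.reverse⟩

theorem Walk.mul {c : ℕ} {v : α} (h : Walk E c v v) (m : ℕ) : Walk E (m * c) v v := by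
  induction m with
  | zero => simpa using Walk.refl v
  | succ m ih => exact (ih.append h).cast (by ring)

theorem no_closed_walk_combination {ℓ : ℕ} {v : α} (hc : ¬ Walk E ℓ v v) {a b c : ℕ}
    (ha : Walk E a v v) (hb : Walk E b v v) (hc' : Walk E c v v) (p q r : ℕ) :
    p * a + q * b + r * c ≠ ℓ := fun h =>
  hc ((((ha.mul p).append (hb.mul q)).append (hc'.mul r)).cast h)

theorem Walk.exists_seq {t : ℕ} {x y : α} (h : Walk E t x y) :
    ∃ w : ℕ → α, w 0 = x ∧ w t = y ∧ ∀ i < t, E (w i) (w (i + 1)) := by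
  induction t generalizing x with
  | zero => exact ⟨fun _ => x, rfl, h, by simp⟩
  | succ t ih =>
    obtain ⟨u, hu, hw⟩ := h
    obtain ⟨w, h0, h1, h2⟩ := ih hw
    refine ⟨fun i => Nat.casesOn i x w, rfl, h1, ?_⟩
    rintro (_ | i) hi
    · simpa [h0] using hu
    · exact h2 i (by omega)

theorem walk_of_seq {w : ℕ → α} (h : ∀ i, E (w i) (w (i + 1))) (s t : ℕ) :
    Walk E t (w s) (w (s + t)) := by
  induction t generalizing s with
  | zero => exact rfl
  | succ t ih =>
    rw [show s + (t + 1) = s + 1 + t by ring]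
    exact (ih (s + 1)).cons (h s)

/-- All closed walks of positive length have length at least `g`. -/
def GirthGE (E : α → α → Prop) (g : ℕ) : Prop :=
  ∀ t, 1 ≤ t → t < g → ∀ x, ¬ Walk E t x x

theorem GirthGE.le {g g' : ℕ} (h : GirthGE E g) (hg : g' ≤ g) : GirthGE E g' :=
  fun t h1 h2 x hw => h t h1 (by omega) x hw

theorem GirthGE.flip {g : ℕ} (h : GirthGE E g) : GirthGE (flip E) g :=
  fun t h1 h2 x hw => h t h1 h2 x (walk_flip.1 hw)

end Basic

section OutDegree

variable {α : Type*} {E : α → α → Prop}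

/-- The out-neighbours of `x` inside `S`. -/
noncomputable def outIn (E : α → α → Prop) (S : Finset α) (x : α) : Finset α := S.filter (E x)

theorem mem_outIn {S : Finset α} {x y : α} : y ∈ outIn E S x ↔ y ∈ S ∧ E x y := by
  simp [outIn]

theorem outIn_subset {S : Finset α} {x : α} : outIn E S x ⊆ S := filter_subset _ _

theorem outIn_eq_empty {S : Finset α} {x : α} (h : ∀ y ∈ S, ¬ E x y) : outIn E S x = ∅ :=
  filter_eq_empty_iff.2 fun _ hy => h _ hy

theorem sum_card_outIn (S : Finset α) :
    ∑ x ∈ S, #(outIn E S x) = ∑ x ∈ S, #(outIn (flip E) S x) := by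
  have := sum_card_bipartiteAbove_eq_sum_card_bipartiteBelow (s := S) (t := S) E
  simp only [bipartiteAbove, bipartiteBelow] at this
  convert this <;> (ext; simp [mem_outIn, flip])

theorem exists_indegree_ge {S : Finset α} (hS : S.Nonempty) {r : ℕ}
    (h : ∀ x ∈ S, r ≤ #(outIn E S x)) : ∃ v ∈ S, r ≤ #(outIn (flip E) S v) := by
  by_contra! hc
  have h1 := sum_lt_sum_of_nonempty hS hc
  rw [← sum_card_outIn] at h1
  exact absurd (sum_le_sum h) (not_le.2 h1)

theorem outdegree_bound_three {S : Finset α} (hS : S.Nonempty) {r : ℕ} (hg : GirthGE E 3)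
    (h : ∀ x ∈ S, r ≤ #(outIn E S x)) : 2 * r + 1 ≤ #S := by
  have h1 : ∑ x ∈ S, (#(outIn E S x) + #(outIn (flip E) S x)) ≤ ∑ x ∈ S, (#S - 1) := by
    refine sum_le_sum fun x hx => ?_
    rw [← card_union_of_disjoint, ← card_erase_of_mem hx]
    · refine card_le_card fun y hy => ?_
      simp only [mem_union, mem_outIn, mem_erase] at hy ⊢
      refine ⟨?_, by tauto⟩
      rintro rfl
      exact hg 1 le_rfl (by norm_num) y (walk_one.2 (hy.elim And.right And.right))
    · rw [disjoint_left]
      intro y hy hy'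
      rw [mem_outIn] at hy hy'
      exact hg 2 (by norm_num) (by norm_num) x (Walk.cons hy.2 (walk_one.2 hy'.2))
  rw [sum_add_distrib, ← sum_card_outIn] at h1
  have h2 := sum_le_sum h
  simp only [sum_const, smul_eq_mul] at h1 h2
  have h3 : #S * (2 * r) ≤ #S * (#S - 1) := by nlinarith
  have h4 := Nat.le_of_mul_le_mul_left h3 hS.card_pos
  have := hS.card_pos
  omega

theorem exists_min_outdegree {S : Finset α} (hS : S.Nonempty) :
    ∃ x ∈ S, ∀ y ∈ S, #(outIn E S x) ≤ #(outIn E S y) :=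
  exists_min_image S _ hS

theorem outdegree_bound_four {S : Finset α} (hS : S.Nonempty) {r : ℕ} (hg : GirthGE E 4)
    (h : ∀ x ∈ S, r ≤ #(outIn E S x)) : 5 * r ≤ 2 * #S := by
  obtain ⟨v, hv, hvr⟩ := exists_indegree_ge hS h
  rcases Nat.eq_zero_or_pos r with rfl | hr
  · simp
  have hA : (outIn E S v).Nonempty := card_pos.1 (hr.trans_le (h v hv))
  obtain ⟨w, hw, hmin⟩ := exists_min_outdegree (E := E) hA
  have hw3 := outdegree_bound_three hA (hg.le (by norm_num)) hmin
  have hwS := outIn_subset hw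
  have hwr := h w hwS
  rw [mem_outIn] at hw
  have hAr := h v hv
  have hsub : outIn E (outIn E S v) w = outIn E S v ∩ outIn E S w := by
    ext y; simp only [mem_outIn, mem_inter]; tauto
  rw [hsub] at hw3
  have hun := card_union_add_card_inter (outIn E S v) (outIn E S w)
  have hdis : Disjoint (outIn E S v ∪ outIn E S w) (outIn (flip E) S v) := by
    rw [disjoint_left]
    intro y hy hy'
    simp only [mem_union, mem_outIn] at hy hy'
    rcases hy with hy | hy
    · exact hg 2 (by norm_num) (by norm_num) v (Walk.cons hy.2 (walk_one.2 hy'.2))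
    · exact hg 3 (by norm_num) (by norm_num) v
        (Walk.cons hw.2 (Walk.cons hy.2 (walk_one.2 hy'.2)))
  have hle : #(outIn E S v ∪ outIn E S w ∪ outIn (flip E) S v) ≤ #S :=
    card_le_card (union_subset (union_subset outIn_subset outIn_subset) outIn_subset)
  rw [card_union_of_disjoint hdis] at hle
  omega

/-- The graph obtained from `S` by deleting `v` and its in-neighbours, in which the in-neighbours
of `v` have been bypassed by edges to the out-neighbours of `v`. -/
def bypass (E : α → α → Prop) (S : Finset α) (v : α) (x y : α) : Prop :=
  (x ∈ S ∧ x ≠ v ∧ ¬ E x v) ∧ (y ∈ S ∧ y ≠ v ∧ ¬ E y v) ∧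
    (E x y ∨ (E v y ∧ ∃ u, E x u ∧ E u v))

theorem walk_of_walk_bypass {S : Finset α} {v : α} {t : ℕ} {x y : α}
    (h : Walk (bypass E S v) t x y) :
    Walk E t x y ∨ ∃ p q, p + q + 1 ≤ t ∧ Walk E (p + 2) x v ∧ Walk E (1 + q) v y := by
  induction t generalizing x with
  | zero => exact Or.inl h
  | succ t ih =>
    obtain ⟨z, ⟨-, -, hz⟩, hw⟩ := h
    rcases hz with hz | ⟨hvz, u, hxu, huv⟩
    · rcases ih hw with h1 | ⟨p, q, hpq, h1, h2⟩
      · exact Or.inl (Walk.cons hz h1)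
      · exact Or.inr ⟨p + 1, q, by omega, (Walk.cons hz h1).cast (by ring), h2⟩
    · have hxv : Walk E (0 + 2) x v := Walk.cons hxu (walk_one.2 huv)
      rcases ih hw with h1 | ⟨p, q, hpq, h1, h2⟩
      · exact Or.inr ⟨0, t, by omega, hxv, (Walk.cons hvz h1).cast (by ring)⟩
      · exact Or.inr ⟨0, q, by omega, hxv, h2⟩

theorem GirthGE.bypass {g : ℕ} (hg : GirthGE E (g + 2)) (S : Finset α) (v : α) :
    GirthGE (bypass E S v) g := by
  intro t h1 h2 x hw
  rcases walk_of_walk_bypass hw with h | ⟨p, q, hpq, h, h'⟩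
  · exact hg t h1 (by omega) x h
  · exact hg (p + 2 + (1 + q)) (by omega) (by omega) x (h.append h')

theorem outdegree_bound {g : ℕ} (h3 : 3 ≤ g) {E : α → α → Prop} {S : Finset α} (hS : S.Nonempty)
    {r : ℕ} (hg : GirthGE E g) (h : ∀ x ∈ S, r ≤ #(outIn E S x)) : (g + 1) * r ≤ 2 * #S := by
  induction g using Nat.strong_induction_on generalizing E S with
  | _ g ih =>
  rcases Nat.lt_or_ge g 5 with hlt | h5
  · interval_cases g
    · have := outdegree_bound_three hS hg h
      omega
    · exact outdegree_bound_four hS hg h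
  · obtain ⟨f, rfl⟩ : ∃ f, g = f + 2 := ⟨g - 2, by omega⟩
    rcases Nat.eq_zero_or_pos r with rfl | hr
    · simp
    obtain ⟨v, hv, hvr⟩ := exists_indegree_ge hS h
    set T := S.filter (fun x => x ≠ v ∧ ¬ E x v) with hT
    have hvT : ∀ y, y ∈ S → E v y → y ∈ T := by
      intro y hy hvy
      refine mem_filter.2 ⟨hy, ?_, fun hyv => ?_⟩
      · rintro rfl
        exact hg 1 (by norm_num) (by omega) y (walk_one.2 hvy)
      · exact hg 2 (by norm_num) (by omega) v (Walk.cons hvy (walk_one.2 hyv))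
    have hTne : T.Nonempty := by
      obtain ⟨y, hy⟩ := card_pos.1 (hr.trans_le (h v hv))
      rw [mem_outIn] at hy
      exact ⟨y, hvT y hy.1 hy.2⟩
    have hdeg : ∀ x ∈ T, r ≤ #(outIn (bypass E S v) T x) := by
      intro x hx
      have hx' := mem_filter.1 hx
      by_cases hu : ∃ u, E x u ∧ E u v
      · refine (h v hv).trans (card_le_card fun y hy => ?_)
        rw [mem_outIn] at hy ⊢
        have := hvT y hy.1 hy.2
        exact ⟨this, hx', mem_filter.1 this, Or.inr ⟨hy.2, hu⟩⟩
      · refine (h x hx'.1).trans (card_le_card fun y hy => ?_)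
        rw [mem_outIn] at hy ⊢
        have : y ∈ T := by
          refine mem_filter.2 ⟨hy.1, ?_, fun hyv => hu ⟨y, hy.2, hyv⟩⟩
          rintro rfl
          exact hx'.2.2 hy.2
        exact ⟨this, hx', mem_filter.1 this, Or.inl hy.2⟩
    have hT' := ih f (by omega) (by omega) hTne (hg.bypass S v) hdeg
    have hdis : Disjoint T (insert v (outIn (flip E) S v)) := by
      rw [disjoint_left]
      intro y hy hy'
      rw [mem_insert, mem_outIn] at hy'
      have hy := (mem_filter.1 hy).2
      rcases hy' with h | h
      · exact hy.1 h
      · exact hy.2 h.2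
    have hle : #(T ∪ insert v (outIn (flip E) S v)) ≤ #S :=
      card_le_card (union_subset (filter_subset _ _) (insert_subset hv outIn_subset))
    have hnv : v ∉ outIn (flip E) S v := fun hv' =>
      hg 1 (by norm_num) (by omega) v (walk_one.2 (mem_outIn.1 hv').2)
    rw [card_union_of_disjoint hdis, card_insert_of_notMem hnv] at hle
    nlinarith

/-- In a graph without short closed walks, every nonempty vertex set contains a vertex of
small outdegree. -/
theorem exists_small_outdegree {g : ℕ} (h3 : 3 ≤ g) {S : Finset α} (hS : S.Nonempty)
    (hg : GirthGE E g) : ∃ x ∈ S, (g + 1) * #(outIn E S x) ≤ 2 * #S := by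
  obtain ⟨x, hx, hmin⟩ := exists_min_outdegree (E := E) hS
  exact ⟨x, hx, outdegree_bound h3 hS hg hmin⟩

end OutDegree

section Growth

variable {α : Type*} [Fintype α] {E : α → α → Prop}

/-- The out-neighbourhood of `x`. -/
noncomputable def nbr (E : α → α → Prop) (x : α) : Finset α := univ.filter (E x)

theorem mem_nbr {x y : α} : y ∈ nbr E x ↔ E x y := by simp [nbr]

/-- Every outdegree and every indegree is at least `δ`. -/
structure MinDegree (E : α → α → Prop) (δ : ℕ) : Prop where
  pos : 1 ≤ δ
  out : ∀ v, δ ≤ #(nbr E v)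
  inn : ∀ v, δ ≤ #(nbr (flip E) v)

theorem MinDegree.flip {δ : ℕ} (h : MinDegree E δ) : MinDegree (flip E) δ :=
  ⟨h.pos, h.inn, h.out⟩

theorem MinDegree.nonempty {δ : ℕ} (h : MinDegree E δ) (v : α) : (nbr E v).Nonempty :=
  card_pos.1 (h.pos.trans (h.out v))

/-- The vertices reachable from `v` by a walk of length between `1` and `i`. -/
noncomputable def ball (E : α → α → Prop) (i : ℕ) (v : α) : Finset α :=
  univ.filter fun y => ∃ t, 1 ≤ t ∧ t ≤ i ∧ Walk E t v y

theorem mem_ball {i : ℕ} {v y : α} : y ∈ ball E i v ↔ ∃ t, 1 ≤ t ∧ t ≤ i ∧ Walk E t v y := by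
  simp [ball]

theorem nbr_subset_ball {i : ℕ} (hi : 1 ≤ i) (v : α) : nbr E v ⊆ ball E i v := fun _ hy =>
  mem_ball.2 ⟨1, le_rfl, hi, walk_one.2 (mem_nbr.1 hy)⟩

theorem ball_subset_ball {i j : ℕ} (hij : i ≤ j) (v : α) : ball E i v ⊆ ball E j v := by
  intro y hy
  obtain ⟨t, h1, h2, h3⟩ := mem_ball.1 hy
  exact mem_ball.2 ⟨t, h1, h2.trans hij, h3⟩

theorem ball_one (v : α) : ball E 1 v = nbr E v := by
  refine (nbr_subset_ball le_rfl v).antisymm' fun y hy => ?_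
  obtain ⟨t, h1, h2, h3⟩ := mem_ball.1 hy
  obtain rfl : t = 1 := by omega
  exact mem_nbr.2 (walk_one.1 h3)

theorem nbr_subset_ball_succ {i : ℕ} {v x : α} (hx : x ∈ ball E i v) :
    nbr E x ⊆ ball E (i + 1) v := by
  intro y hy
  obtain ⟨t, h1, h2, h3⟩ := mem_ball.1 hx
  exact mem_ball.2 ⟨t + 1, by omega, by omega, h3.snoc (mem_nbr.1 hy)⟩

theorem card_union_nbr (S : Finset α) (x : α) :
    #(S ∪ nbr E x) + #(outIn E S x) = #S + #(nbr E x) := by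
  have : outIn E S x = S ∩ nbr E x := by
    ext y
    simp [mem_outIn, mem_nbr]
  rw [this, card_union_add_card_inter]

theorem card_ball_succ {δ : ℕ} (h : MinDegree E δ) {i : ℕ} {v x : α} (hx : x ∈ ball E i v) :
    #(ball E i v) + δ ≤ #(ball E (i + 1) v) + #(outIn E (ball E i v) x) := by
  have h1 := card_union_nbr (E := E) (ball E i v) x
  have h2 : #(ball E i v ∪ nbr E x) ≤ #(ball E (i + 1) v) :=
    card_le_card (union_subset (ball_subset_ball (by omega) v) (nbr_subset_ball_succ hx))
  have := h.out x
  omega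

theorem MinDegree.le_card_ball {δ : ℕ} (h : MinDegree E δ) {i : ℕ} (hi : 1 ≤ i) (v : α) :
    δ ≤ #(ball E i v) :=
  (h.out v).trans (card_le_card (nbr_subset_ball hi v))

theorem MinDegree.ball_nonempty {δ : ℕ} (h : MinDegree E δ) {i : ℕ} (hi : 1 ≤ i) (v : α) :
    (ball E i v).Nonempty :=
  card_pos.1 (h.pos.trans (h.le_card_ball hi v))

theorem card_ball_succ_of_girth {δ g : ℕ} (h : MinDegree E δ) (h3 : 3 ≤ g) (hg : GirthGE E g)
    {i : ℕ} (hi : 1 ≤ i) (v : α) :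
    (g + 1) * #(ball E i v) + (g + 1) * δ ≤ (g + 1) * #(ball E (i + 1) v) + 2 * #(ball E i v) := by
  obtain ⟨x, hx, hx'⟩ := exists_small_outdegree h3 (h.ball_nonempty hi v) hg
  have := card_ball_succ h hx
  nlinarith

theorem card_ball_bound {δ g : ℕ} (h : MinDegree E δ) (h3 : 3 ≤ g) (hg : GirthGE E g)
    (i : ℕ) (v : α) :
    ((g : ℤ) + 1) ^ i * ((g + 1) * δ - 2 * #(ball E i v)) ≤ (g - 1) ^ i * ((g + 1) * δ) := by
  induction i with
  | zero => simp
  | succ i ih =>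
    have hg0 : (3 : ℤ) ≤ g := by exact_mod_cast h3
    have key : ((g : ℤ) + 1) * ((g + 1) * δ - 2 * #(ball E (i + 1) v)) ≤
        (g - 1) * ((g + 1) * δ - 2 * #(ball E i v)) := by
      rcases Nat.eq_zero_or_pos i with rfl | hi
      · have h0 : ball E 0 v = ∅ := by
          ext y
          simp only [mem_ball, notMem_empty, iff_false, not_exists]
          intro t ht
          omega
        have h1 : (δ : ℤ) ≤ #(ball E (0 + 1) v) := by exact_mod_cast h.le_card_ball le_rfl v
        rw [h0]
        simp only [card_empty]
        push_cast
        nlinarith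
      · have := card_ball_succ_of_girth h h3 hg hi v
        zify at this
        nlinarith
    calc ((g : ℤ) + 1) ^ (i + 1) * ((g + 1) * δ - 2 * #(ball E (i + 1) v))
        = (g + 1) ^ i * ((g + 1) * ((g + 1) * δ - 2 * #(ball E (i + 1) v))) := by ring
      _ ≤ (g + 1) ^ i * ((g - 1) * ((g + 1) * δ - 2 * #(ball E i v))) :=
        mul_le_mul_of_nonneg_left key (by positivity)
      _ = (g - 1) * ((g + 1) ^ i * ((g + 1) * δ - 2 * #(ball E i v))) := by ring
      _ ≤ (g - 1) * ((g - 1) ^ i * ((g + 1) * δ)) := mul_le_mul_of_nonneg_left ih (by linarith)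
      _ = _ := by ring

theorem exists_mem_of_card_lt {A B : Finset α} (h : Fintype.card α < #A + #B) :
    ∃ x, x ∈ A ∧ x ∈ B := by
  by_contra! hc
  rw [← card_union_of_disjoint (disjoint_left.2 hc)] at h
  exact absurd (card_le_univ (A ∪ B)) (not_le.2 h)

theorem exists_walk_of_card_lt {i j : ℕ} {x y : α}
    (h : Fintype.card α < #(ball E i x) + #(ball (flip E) j y)) :
    ∃ t, 2 ≤ t ∧ t ≤ i + j ∧ Walk E t x y := by
  obtain ⟨z, h1, h2⟩ := exists_mem_of_card_lt h
  obtain ⟨s, hs1, hs2, hs⟩ := mem_ball.1 h1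
  obtain ⟨t, ht1, ht2, ht⟩ := mem_ball.1 h2
  exact ⟨s + t, by omega, by omega, hs.append (walk_flip.1 ht)⟩

/-- The numerical form of the minimum semidegree condition. -/
def DegreeBound (k n δ : ℕ) : Prop := 30 * k * n ≤ 30 * k ^ 2 * δ + n

theorem exists_walk_of_pow_lt {k δ : ℕ} (h : MinDegree E δ) (h3 : 3 ≤ k) (hg : GirthGE E k)
    (hδ : DegreeBound k (Fintype.card α) δ) {i : ℕ}
    (hi : (30 * (k : ℤ) ^ 2 + 29 * k - 1) * (k - 1) ^ i < (29 * k - 1) * (k + 1) ^ i) (x y : α) :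
    ∃ t, 2 ≤ t ∧ t ≤ 2 * i ∧ Walk E t x y := by
  have half : ∀ {F : α → α → Prop}, MinDegree F δ → GirthGE F k → ∀ v,
      Fintype.card α < 2 * #(ball F i v) := by
    intro F hF hgF v
    have h1 := card_ball_bound hF h3 hgF i v
    have hn : (0 : ℤ) < Fintype.card α := by
      exact_mod_cast Fintype.card_pos_iff.2 ⟨v⟩
    have hδ' : (30 : ℤ) * k * Fintype.card α ≤ 30 * k ^ 2 * δ + Fintype.card α := by
      exact_mod_cast hδ
    have hk : (3 : ℤ) ≤ k := by exact_mod_cast h3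
    zify
    set n : ℤ := (Fintype.card α : ℤ)
    set b : ℤ := (#(ball F i v) : ℤ)
    set P : ℤ := (k + 1) ^ i
    set Q : ℤ := (k - 1) ^ i
    have hP : 0 < P := by positivity
    have hPQ : 0 ≤ P - Q := sub_nonneg.2 (pow_le_pow_left₀ (by linarith) (by linarith) i)
    have e1 : ((k : ℤ) + 1) * (P - Q) * δ ≤ 2 * b * P := by linarith
    have e2 : ((k : ℤ) + 1) * (P - Q) * (n * (30 * k - 1)) ≤
        (k + 1) * (P - Q) * (30 * k ^ 2 * δ) :=
      mul_le_mul_of_nonneg_left (by linarith) (by positivity)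
    have e3 : 30 * (k : ℤ) ^ 2 * ((k + 1) * (P - Q) * δ) ≤ 30 * k ^ 2 * (2 * b * P) :=
      mul_le_mul_of_nonneg_left e1 (by positivity)
    have e4 := mul_lt_mul_of_pos_left hi hn
    have e5 : (30 * (k : ℤ) ^ 2 * P) * n < (30 * (k : ℤ) ^ 2 * P) * (2 * b) := by nlinarith
    exact lt_of_mul_lt_mul_left e5 (by positivity)
  obtain ⟨t, h1, h2, h3⟩ := exists_walk_of_card_lt (E := E) (i := i) (j := i) (x := x) (y := y)
    (by have := half h hg x; have := half h.flip hg.flip y; omega)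
  exact ⟨t, h1, by omega, h3⟩

end Growth

section Sink

variable {α : Type*} {E : α → α → Prop}

theorem exists_infinite_walk {X : Finset α} (hX : X.Nonempty)
    (h : ∀ x ∈ X, ∃ y ∈ X, E x y) :
    ∃ w : ℕ → α, (∀ i, w i ∈ X) ∧ ∀ i, E (w i) (w (i + 1)) := by
  choose! f hf hE using h
  obtain ⟨x, hx⟩ := hX
  have hm : ∀ i, f^[i] x ∈ X := by
    intro i
    induction i with
    | zero => exact hx
    | succ i ih =>
      rw [Function.iterate_succ_apply']
      exact hf _ ih
  refine ⟨fun i => f^[i] x, hm, fun i => ?_⟩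
  simp only [Function.iterate_succ_apply']
  exact hE _ (hm i)

theorem exists_closed_walk_in_window [Fintype α] {X : Finset α} (hX : X.Nonempty)
    (h : ∀ x ∈ X, ∃ y ∈ X, E x y) {v : α} {j D : ℕ} (hj : X ⊆ ball E j v)
    (hD : ∀ x y, ∃ t, 2 ≤ t ∧ t ≤ D ∧ Walk E t x y) {c : ℕ} (hc : D + 1 ≤ c) :
    ∃ l, c ≤ l ∧ l < c + j ∧ Walk E l v v := by
  obtain ⟨w, hwX, hwE⟩ := exists_infinite_walk hX h
  obtain ⟨i, -, hi, hw⟩ := hD (w c) v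
  obtain ⟨t, h1, h2, h3⟩ := mem_ball.1 (hj (hwX (i + 1)))
  have := walk_of_seq hwE (i + 1) (c - 1 - i)
  rw [show i + 1 + (c - 1 - i) = c by omega] at this
  exact ⟨t + (c - 1 - i) + i, by omega, by omega, (h3.append this).append hw⟩

end Sink

section Arithmetic

theorem four_mul_pow_le_centralBinom {n : ℕ} (hn : 12 ≤ n) :
    4 * (2 * n + 2) ^ 4 ≤ n.centralBinom := by
  induction n, hn using Nat.le_induction with
  | base => decide +kernel
  | succ n hn ih =>
    have h1 := Nat.succ_mul_centralBinom_succ n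
    have h2 : 3 * n.centralBinom ≤ (n + 1).centralBinom := by
      refine Nat.le_of_mul_le_mul_left (c := n + 1) ?_ (by omega)
      rw [h1]
      nlinarith
    have h3 : (2 * (n + 1) + 2) ^ 4 ≤ 3 * (2 * n + 2) ^ 4 := by
      have h4 : 7 * (2 * (n + 1) + 2) ≤ 8 * (2 * n + 2) := by omega
      have h5 := Nat.pow_le_pow_left h4 4
      rw [mul_pow, mul_pow] at h5
      norm_num at h5
      omega
    omega

theorem centralBinom_dvd {n ℓ : ℕ} (hn : 1 ≤ n) (hℓ : ℓ ≠ 0)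
    (h : ∀ m, 1 ≤ m → m ≤ 2 * n → m ∣ ℓ) : n.centralBinom ∣ ℓ := by
  rw [← Nat.factorization_prime_le_iff_dvd n.centralBinom_ne_zero hℓ]
  intro p hp
  rw [← hp.pow_dvd_iff_le_factorization hℓ]
  exact h _ (Nat.one_le_pow _ _ hp.pos)
    (Nat.pow_factorization_choose_le (n := 2 * n) (k := n) (by omega))

theorem four_mul_pow_le_of_dvd {k ℓ : ℕ} (hk : 26 ≤ k) (hℓ : ℓ ≠ 0)
    (h : ∀ m, 1 ≤ m → m < k → m ∣ ℓ) : 4 * k ^ 4 ≤ ℓ := by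
  have h1 := centralBinom_dvd (n := (k - 1) / 2) (by omega) hℓ fun m h1 h2 => h m h1 (by omega)
  have h2 := four_mul_pow_le_centralBinom (n := (k - 1) / 2) (by omega)
  have h3 : k ^ 4 ≤ (2 * ((k - 1) / 2) + 2) ^ 4 := Nat.pow_le_pow_left (by omega) 4
  have h4 := Nat.le_of_dvd (Nat.pos_of_ne_zero hℓ) h1
  omega

theorem pow_lt_pow_of_twentysix_le {k : ℕ} (hk : 26 ≤ k) :
    (30 * (k : ℤ) ^ 2 + 29 * k - 1) * (k - 1) ^ (k * (k - 1)) <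
      (29 * k - 1) * (k + 1) ^ (k * (k - 1)) := by
  obtain ⟨m, rfl⟩ : ∃ m, k = m + 1 := ⟨k - 1, by omega⟩
  have hm : (25 : ℤ) ≤ m := by exact_mod_cast (by omega : 25 ≤ m)
  have h1 : (3 : ℤ) * m ^ m ≤ (m + 2) ^ m := by
    have hq : (3 : ℚ) ≤ (1 + 2 / m) ^ m := by
      have hm0 : (0 : ℚ) < m := by exact_mod_cast (by omega : 0 < m)
      have := one_add_mul_le_pow (a := (2 / m : ℚ)) (by
        have : (0 : ℚ) ≤ 2 / m := by positivity
        linarith) m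
      have e : (m : ℚ) * (2 / m) = 2 := by field_simp
      linarith
    have hm0 : (0 : ℚ) < m := by exact_mod_cast (by omega : 0 < m)
    have e : (1 + 2 / (m : ℚ)) ^ m * m ^ m = (m + 2) ^ m := by
      rw [← mul_pow]
      congr 1
      field_simp
    have : (3 : ℚ) * m ^ m ≤ (m + 2) ^ m := by
      rw [← e]
      gcongr
    exact_mod_cast this
  have h2 : (3 : ℤ) ^ (m + 1) * m ^ (m * (m + 1)) ≤ (m + 2) ^ (m * (m + 1)) := by
    rw [pow_mul, ← mul_pow, pow_mul]
    exact pow_le_pow_left₀ (by positivity) h1 _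
  have h3 : (2 * m + 3 : ℤ) ≤ 3 ^ (m + 1) := by
    have := one_add_mul_le_pow (a := (2 : ℤ)) (by norm_num) (m + 1)
    push_cast at this
    linarith
  have e1 : (m + 1) * (m + 1 - 1) = m * (m + 1) := by
    rw [Nat.add_sub_cancel, mul_comm]
  rw [e1]
  push_cast
  rw [show (m : ℤ) + 1 - 1 = m by ring, show (m : ℤ) + 1 + 1 = m + 2 by ring]
  have hpos : (0 : ℤ) < m ^ (m * (m + 1)) := by positivity
  set P : ℤ := (m : ℤ) ^ (m * (m + 1))
  calc (30 * ((m : ℤ) + 1) ^ 2 + 29 * (m + 1) - 1) * P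
      < (29 * (m + 1) - 1) * (2 * m + 3) * P := by
        refine mul_lt_mul_of_pos_right ?_ hpos
        nlinarith
    _ ≤ (29 * (m + 1) - 1) * (3 ^ (m + 1)) * P := by
        refine mul_le_mul_of_nonneg_right ?_ hpos.le
        exact mul_le_mul_of_nonneg_left h3 (by linarith)
    _ ≤ (29 * (m + 1) - 1) * (m + 2) ^ (m * (m + 1)) := by
        rw [mul_assoc]
        exact mul_le_mul_of_nonneg_left h2 (by linarith)

theorem pow_lt_pow_of_le_twentyfive {k : ℕ} (hk : 13 ≤ k) (hk' : k ≤ 25) :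
    (30 * (k : ℤ) ^ 2 + 29 * k - 1) * (k - 1) ^ (3 * (k - 1)) <
      (29 * k - 1) * (k + 1) ^ (3 * (k - 1)) := by
  interval_cases k <;> norm_num

end Arithmetic

section LargeK

variable {α : Type*} {E : α → α → Prop}

theorem no_closed_walk_of_dvd {a b : ℕ} (hab : a ∣ b) (h : ∀ x, ¬ Walk E b x x) (x : α) :
    ¬ Walk E a x x := by
  obtain ⟨c, rfl⟩ := hab
  exact fun hw => h x ((hw.mul c).cast (by ring))

theorem no_shortcut_of_diameter {k ℓ D s : ℕ} (hℓ : ∀ x, ¬ Walk E ℓ x x)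
    (hdvd : ∀ m, 1 ≤ m → m < k → m ∣ ℓ)
    (hD : ∀ x y, ∃ t, 2 ≤ t ∧ t ≤ D ∧ Walk E t x y) (hs : 2 ≤ s) (hsk : s ≤ k)
    (hDℓ : D * (D + (s - 1)) ≤ ℓ) {v w : α} (hvw : Walk E s v w) : ¬ E v w := by
  intro h
  obtain ⟨i, -, hi, hwv⟩ := hD w v
  have h1 : Walk E (i + 1) v v := Walk.cons h hwv
  have h2 : Walk E (i + s) v v := (hvw.append hwv).cast (by ring)
  have hgcd : (i + 1).gcd (i + s) ∣ ℓ := by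
    have : (i + 1).gcd (i + s) ∣ s - 1 := by
      have := Nat.dvd_sub (Nat.gcd_dvd_right (i + 1) (i + s)) (Nat.gcd_dvd_left (i + 1) (i + s))
      rwa [show i + s - (i + 1) = s - 1 by omega] at this
    exact this.trans (hdvd _ (by omega) (by omega))
  obtain ⟨a, b, hab⟩ := Nat.exists_add_mul_eq_of_gcd_dvd_of_mul_pred_le (i + 1) (i + s) ℓ hgcd (by
    refine le_trans (Nat.mul_le_mul ?_ ?_) hDℓ
    · simpa using hi
    · rw [Nat.pred_eq_sub_one]
      omega)
  exact hℓ v (((h1.mul a).append (h2.mul b)).cast hab)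

theorem no_shortcut_of_eight_le [Fintype α] {k ℓ δ s : ℕ} (h : MinDegree E δ)
    (hδ : DegreeBound k (Fintype.card α) δ) (hg : GirthGE E k) (hℓ0 : ℓ ≠ 0)
    (hℓ : ∀ x, ¬ Walk E ℓ x x) (hdvd : ∀ m, 1 ≤ m → m < k → m ∣ ℓ) (hk : ¬ k ∣ ℓ) (h8 : 8 ≤ k)
    (hs : 2 ≤ s) (hsk : s ≤ k / 2 + 1) {v w : α} (hvw : Walk E s v w) : ¬ E v w := by
  have hpos : 0 < ℓ := Nat.pos_of_ne_zero hℓ0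
  have main : ∀ i, (30 * (k : ℤ) ^ 2 + 29 * k - 1) * (k - 1) ^ i < (29 * k - 1) * (k + 1) ^ i →
      2 * i * (2 * i + (s - 1)) ≤ ℓ → ¬ E v w := by
    intro i hi hi'
    exact no_shortcut_of_diameter hℓ hdvd (exists_walk_of_pow_lt h (by omega) hg hδ hi) hs
      (by omega) hi' hvw
  have d {m : ℕ} (h1 : 1 ≤ m) (h2 : m < k) : m ∣ ℓ := hdvd m h1 h2
  have d420 : 420 ∣ ℓ := Nat.lcm_dvd (Nat.lcm_dvd (d (m := 3) (by norm_num) (by omega))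
    (d (m := 4) (by norm_num) (by omega))) (Nat.lcm_dvd (d (m := 5) (by norm_num) (by omega))
    (d (m := 7) (by norm_num) (by omega)))
  have l420 := Nat.le_of_dvd hpos d420
  rcases Nat.lt_or_ge k 26 with h26 | h26
  · rcases Nat.lt_or_ge k 13 with h13 | h13
    · have l840 (h9 : 9 ≤ k) : 840 ≤ ℓ :=
        Nat.le_of_dvd hpos (Nat.lcm_dvd d420 (d (m := 8) (by norm_num) (by omega)))
      have l2520 (h11 : 11 ≤ k) : 2520 ≤ ℓ := Nat.le_of_dvd hpos (Nat.lcm_dvd d420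
        (Nat.lcm_dvd (d (m := 8) (by norm_num) (by omega)) (d (m := 9) (by norm_num) (by omega))))
      clear hdvd d
      interval_cases k
      · refine main 9 (by norm_num) ?_
        calc _ ≤ 18 * 22 := Nat.mul_le_mul_left _ (by omega)
          _ ≤ ℓ := by omega
      · refine main 11 (by norm_num) ?_
        calc _ ≤ 22 * 26 := Nat.mul_le_mul_left _ (by omega)
          _ ≤ ℓ := by linarith [l840 (by norm_num)]
      · exact absurd ((show 10 ∣ 420 by norm_num).trans d420) hk
      · refine main 14 (by norm_num) ?_
        calc _ ≤ 28 * 33 := Nat.mul_le_mul_left _ (by omega)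
          _ ≤ ℓ := by linarith [l2520 (by norm_num)]
      · exact absurd ((show 12 ∣ 420 by norm_num).trans d420) hk
    · have l27720 : 27720 ≤ ℓ := Nat.le_of_dvd hpos (Nat.lcm_dvd (Nat.lcm_dvd d420
        (d (m := 11) (by norm_num) (by omega))) (Nat.lcm_dvd (d (m := 8) (by norm_num) (by omega))
        (d (m := 9) (by norm_num) (by omega))))
      refine main _ (pow_lt_pow_of_le_twentyfive h13 (by omega)) ?_
      calc 2 * (3 * (k - 1)) * (2 * (3 * (k - 1)) + (s - 1)) ≤ 144 * 156 :=
            Nat.mul_le_mul (by omega) (by omega)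
        _ ≤ ℓ := by omega
  · refine main _ (pow_lt_pow_of_twentysix_le h26) ?_
    refine le_trans ?_ (four_mul_pow_le_of_dvd h26 hℓ0 hdvd)
    obtain ⟨m, rfl⟩ : ∃ m, k = m + 1 := ⟨k - 1, by omega⟩
    rw [Nat.add_sub_cancel]
    have : s - 1 ≤ m + 1 := by omega
    calc 2 * ((m + 1) * m) * (2 * ((m + 1) * m) + (s - 1))
        ≤ 2 * ((m + 1) * (m + 1)) * (2 * ((m + 1) * (m + 1))) :=
          Nat.mul_le_mul (by nlinarith) (by nlinarith)
      _ = 4 * (m + 1) ^ 4 := by ring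

end LargeK

section Seven

variable {α : Type*} [Fintype α] {E : α → α → Prop}

theorem card_ball_succ_of_sink {δ : ℕ} (h : MinDegree E δ) {i : ℕ} {v : α}
    (hs : ∃ x ∈ ball E i v, ∀ y ∈ ball E i v, ¬ E x y) :
    #(ball E i v) + δ ≤ #(ball E (i + 1) v) := by
  obtain ⟨x, hx, hx'⟩ := hs
  simpa [outIn_eq_empty hx'] using card_ball_succ h hx

theorem exists_sink_of_window {v : α} {X : Finset α} {j D : ℕ} (hX : X.Nonempty)
    (hj : X ⊆ ball E j v) (hD : ∀ x y, ∃ t, 2 ≤ t ∧ t ≤ D ∧ Walk E t x y)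
    (h : ¬ ∀ c, D + 1 ≤ c → ∃ l, c ≤ l ∧ l < c + j ∧ Walk E l v v) :
    ∃ x ∈ X, ∀ y ∈ X, ¬ E x y := by
  by_contra! hs
  exact h fun c hc => exists_closed_walk_in_window hX hs hj hD hc

theorem two_mul_le_card_ball_two {δ D : ℕ} (h : MinDegree E δ)
    (hD : ∀ x y, ∃ t, 2 ≤ t ∧ t ≤ D ∧ Walk E t x y) {ℓ : ℕ} (hDℓ : D < ℓ) {v : α}
    (hc : ¬ Walk E ℓ v v) : 2 * δ ≤ #(ball E 2 v) := by
  have h1 := card_ball_succ_of_sink h (exists_sink_of_window (h.ball_nonempty le_rfl v)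
    Subset.rfl hD fun hw => by
      obtain ⟨l, h1, h2, h3⟩ := hw ℓ (by omega)
      obtain rfl : l = ℓ := by omega
      exact hc h3)
  have := h.le_card_ball le_rfl v
  simp only [Nat.reduceAdd] at h1
  omega

theorem card_ball_six_of_girth_seven {δ : ℕ} (h : MinDegree E δ) (hg : GirthGE E 7)
    (hD : ∀ x y, ∃ t, 2 ≤ t ∧ t ≤ 16 ∧ Walk E t x y) (hc : ∀ x, ¬ Walk E 60 x x) (v : α) :
    229 * δ ≤ 64 * #(ball E 6 v) := by
  have h2 := two_mul_le_card_ball_two h hD (by norm_num) (hc v)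
  have h3 := card_ball_succ_of_sink h (exists_sink_of_window
    (h.ball_nonempty (by norm_num : 1 ≤ 2) v) Subset.rfl hD fun hw => by
      obtain ⟨l, h1, h2, h3⟩ := hw 29 (by omega)
      obtain ⟨m, h4, h5, h6⟩ := hw 30 (by omega)
      have hno := no_closed_walk_combination (hc v) h3 h6 h6
      have e1 := hno 2 0 0
      have e2 := hno 0 2 0
      have e3 := hno 1 1 0
      omega)
  have h4 := card_ball_succ_of_girth h (by norm_num) hg (by norm_num : 1 ≤ 3) v
  have h5 := card_ball_succ_of_girth h (by norm_num) hg (by norm_num : 1 ≤ 4) v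
  have h6 := card_ball_succ_of_girth h (by norm_num) hg (by norm_num : 1 ≤ 5) v
  simp only [Nat.reduceAdd] at h3 h4 h5 h6
  omega

theorem four_mul_le_card_ball_four {δ : ℕ} (h : MinDegree E δ)
    (hD : ∀ x y, ∃ t, 2 ≤ t ∧ t ≤ 12 ∧ Walk E t x y) (hc : ∀ x, ¬ Walk E 60 x x) (v : α) :
    4 * δ ≤ #(ball E 4 v) := by
  have sink : ∀ i, 1 ≤ i → i ≤ 3 → #(ball E i v) + δ ≤ #(ball E (i + 1) v) := by
    intro i hi hi3
    refine card_ball_succ_of_sink h (exists_sink_of_window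
      (h.ball_nonempty hi v) (ball_subset_ball hi3 v) hD fun hw => ?_)
    have hno {a b c : ℕ} := @no_closed_walk_combination _ E 60 v (hc v) a b c
    obtain ⟨l₁, h1, h2, w13⟩ := hw 13 (by norm_num)
    obtain ⟨l₂, h3, h4, w15⟩ := hw 15 (by norm_num)
    have e15 : l₁ ≠ 15 := fun e => hno w13 w13 w13 4 0 0 (by omega)
    have e15' : l₂ ≠ 15 := fun e => hno w15 w15 w15 4 0 0 (by omega)
    obtain rfl | rfl : l₁ = 13 ∨ l₁ = 14 := by omega
    · have e17 : l₂ ≠ 17 := fun e => hno w13 w15 w15 2 2 0 (by omega)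
      obtain rfl : l₂ = 16 := by omega
      obtain ⟨l, h5, h6, w20⟩ := hw 20 (by norm_num)
      have e20 : l ≠ 20 := fun e => hno w20 w20 w20 3 0 0 (by omega)
      have e21 : l ≠ 21 := fun e => hno w20 w13 w13 1 3 0 (by omega)
      have e22 : l ≠ 22 := fun e => hno w20 w15 w15 2 1 0 (by omega)
      omega
    · have e16 : l₂ ≠ 16 := fun e => hno w13 w15 w15 2 2 0 (by omega)
      obtain rfl : l₂ = 17 := by omega
      obtain ⟨l₃, h5, h6, w18⟩ := hw 18 (by norm_num)
      have e18 : l₃ ≠ 18 := fun e => hno w18 w13 w13 1 3 0 (by omega)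
      have e20 : l₃ ≠ 20 := fun e => hno w18 w18 w18 3 0 0 (by omega)
      obtain rfl : l₃ = 19 := by omega
      obtain ⟨l₄, h7, h8, w20⟩ := hw 20 (by norm_num)
      have e20 : l₄ ≠ 20 := fun e => hno w20 w20 w20 3 0 0 (by omega)
      have e22 : l₄ ≠ 22 := fun e => hno w20 w18 w18 1 2 0 (by omega)
      obtain rfl : l₄ = 21 := by omega
      obtain ⟨l, h5, h6, w23⟩ := hw 23 (by norm_num)
      have e23 : l ≠ 23 := fun e => hno w23 w13 w13 2 1 0 (by omega)
      have e24 : l ≠ 24 := fun e => hno w23 w15 w18 1 1 1 (by omega)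
      have e25 : l ≠ 25 := fun e => hno w23 w13 w20 1 1 1 (by omega)
      omega
  have h1 := h.le_card_ball le_rfl v
  have h2 := sink 1 (by norm_num) (by norm_num)
  have h3 := sink 2 (by norm_num) (by norm_num)
  have h4 := sink 3 (by norm_num) (by norm_num)
  simp only [Nat.reduceAdd] at h2 h3 h4
  omega

theorem no_shortcut_of_girth_seven {δ s : ℕ} (h : MinDegree E δ)
    (hδ : DegreeBound 7 (Fintype.card α) δ) (hg : GirthGE E 7) (hc : ∀ x, ¬ Walk E 60 x x)
    (hs : 2 ≤ s) (hs4 : s ≤ 4) {v w : α} (hvw : Walk E s v w) : ¬ E v w := by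
  intro hE
  have hn : 0 < Fintype.card α := Fintype.card_pos_iff.2 ⟨v⟩
  have hc' : ∀ x, ¬ Walk (flip E) 60 x x := fun x hx => hc x (walk_flip.1 hx)
  have hδ' : 30 * 7 * Fintype.card α ≤ 30 * 7 ^ 2 * δ + Fintype.card α := hδ
  have D16 := exists_walk_of_pow_lt (i := 8) h (by norm_num) hg hδ (by norm_num)
  have D16' := exists_walk_of_pow_lt (i := 8) h.flip (by norm_num) hg.flip hδ (by norm_num)
  have D12 : ∀ x y, ∃ t, 2 ≤ t ∧ t ≤ 12 ∧ Walk E t x y := fun x y =>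
    exists_walk_of_card_lt (i := 6) (j := 6) (by
      have := card_ball_six_of_girth_seven h hg D16 hc x
      have := card_ball_six_of_girth_seven h.flip hg.flip D16' hc' y
      omega)
  have D12' : ∀ x y, ∃ t, 2 ≤ t ∧ t ≤ 12 ∧ Walk (flip E) t x y := fun x y => by
    obtain ⟨t, h1, h2, h3⟩ := D12 y x
    exact ⟨t, h1, h2, h3.reverse⟩
  obtain ⟨i, hi2, hi8, hi⟩ := exists_walk_of_card_lt (E := E) (i := 4) (j := 4) (x := w) (y := v)
    (by
      have := four_mul_le_card_ball_four h D12 hc w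
      have := four_mul_le_card_ball_four h.flip D12' hc' v
      omega)
  have key : ∀ i ∈ Finset.Icc 2 8, ∀ s ∈ Finset.Icc 2 4, ∃ p ∈ Finset.range 21,
      ∃ q ∈ Finset.range 21, p * (i + 1) + q * (s + i) + 0 * (s + i) = 60 := by
    decide +kernel
  obtain ⟨p, -, q, -, hpq⟩ := key i (Finset.mem_Icc.2 ⟨hi2, hi8⟩) s (Finset.mem_Icc.2 ⟨hs, hs4⟩)
  have hw := hvw.append hi
  exact no_closed_walk_combination (hc v) (Walk.cons hE hi) hw hw p q 0 hpq

end Seven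

section Five

variable {α : Type*} {E : α → α → Prop}

theorem card_union_outIn {T S : Finset α} (hT : T ⊆ S) (x : α) :
    #(T ∪ outIn E S x) + #(outIn E T x) = #T + #(outIn E S x) := by
  have : outIn E T x = T ∩ outIn E S x := by
    ext y
    simp only [mem_outIn, mem_inter]
    exact ⟨fun h => ⟨h.1, hT h.1, h.2⟩, fun h => ⟨h.1, h.2.2⟩⟩
  rw [this, card_union_add_card_inter]

theorem exists_outdegree_le_three_tenths (hg : GirthGE E 5)
    (hsink : ∀ v (X : Finset α), X.Nonempty → (∀ x ∈ X, E v x) → ∃ x ∈ X, ∀ y ∈ X, ¬ E x y)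
    {S : Finset α} (hS : S.Nonempty) : ∃ x ∈ S, 10 * #(outIn E S x) ≤ 3 * #S := by
  obtain ⟨x₀, hx₀, hmin⟩ := exists_min_outdegree (E := E) hS
  refine ⟨x₀, hx₀, ?_⟩
  obtain ⟨v, hv, hvr⟩ := exists_indegree_ge hS hmin
  set r := #(outIn E S x₀)
  rcases Nat.eq_zero_or_pos r with hr | hr
  · omega
  have hA : (outIn E S v).Nonempty := card_pos.1 (hr.trans_le (hmin v hv))
  obtain ⟨w, hw, hw'⟩ := hsink v _ hA fun x hx => (mem_outIn.1 hx).2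
  have hwS := outIn_subset hw
  have hAw := card_union_outIn (E := E) (outIn_subset (E := E) (S := S) (x := v)) w
  rw [outIn_eq_empty hw', card_empty] at hAw
  set U := outIn E S v ∪ outIn E S w with hU
  have hUS : U ⊆ S := union_subset outIn_subset outIn_subset
  obtain ⟨x, hx, hx'⟩ := exists_small_outdegree (by norm_num) (hA.mono subset_union_left : U.Nonempty) hg
  have hF := card_union_outIn (E := E) hUS x
  have hUw : ∀ y ∈ U, ∃ t, 1 ≤ t ∧ t ≤ 2 ∧ Walk E t v y := by
    intro y hy
    rw [hU, mem_union, mem_outIn, mem_outIn] at hy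
    rcases hy with hy | hy
    · exact ⟨1, by norm_num, by norm_num, walk_one.2 hy.2⟩
    · exact ⟨2, by norm_num, by norm_num, Walk.cons (mem_outIn.1 hw).2 (walk_one.2 hy.2)⟩
  have hdis : Disjoint (U ∪ outIn E S x) (outIn (flip E) S v) := by
    rw [disjoint_left]
    intro y hy hy'
    have hyv : E y v := (mem_outIn.1 hy').2
    rcases mem_union.1 hy with hy | hy
    · obtain ⟨t, h1, h2, h3⟩ := hUw y hy
      exact hg (t + 1) (by omega) (by omega) v (h3.snoc hyv)
    · obtain ⟨t, h1, h2, h3⟩ := hUw x hx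
      exact hg (t + 1 + 1) (by omega) (by omega) v ((h3.snoc (mem_outIn.1 hy).2).snoc hyv)
  have hle : #(U ∪ outIn E S x ∪ outIn (flip E) S v) ≤ #S :=
    card_le_card (union_subset (union_subset hUS outIn_subset) outIn_subset)
  rw [card_union_of_disjoint hdis] at hle
  have h1 := hmin v hv
  have h2 := hmin w hwS
  have h3 := hmin x (hUS hx)
  omega

/-- The edges of `E` with both ends in `S`. -/
def restrict (E : α → α → Prop) (S : Finset α) (x y : α) : Prop := x ∈ S ∧ y ∈ S ∧ E x y

theorem Walk.of_restrict {S : Finset α} {t : ℕ} {x y : α} (h : Walk (restrict E S) t x y) :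
    Walk E t x y :=
  h.mono fun _ _ h => h.2.2

theorem exists_outdegree_le_quarter {v : α} {A Z N : Finset α} (hZA : Z ⊆ A)
    (hZ : ∀ x ∈ Z, E v x) (hN : ∀ x ∈ N, Walk E 2 v x ∧ Walk E 3 v x)
    (hne : (Z ∪ N).Nonempty)
    (hcl : ∀ x ∈ Z ∪ N, ∀ y ∈ A ∪ N, E x y → y ∈ Z ∪ N)
    (hd : ∀ x ∈ Z ∪ N, ∃ d, 5 ≤ d ∧ d ≤ 7 ∧ Walk E d x v ∧ ∀ j < d, ¬ Walk E j x v)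
    (h3 : ∀ x, ¬ Walk E 3 x x) (h6 : ∀ x, ¬ Walk E 6 x x) (h12 : ¬ Walk E 12 v v) :
    ∃ x ∈ Z ∪ N, 4 * #(outIn E (A ∪ N) x) ≤ #A := by
  by_contra! hcon
  choose! dst hd5 hd7 hdw hdmin using hd
  have hsucc : ∀ x ∈ Z ∪ N, ∃ y ∈ Z ∪ N, restrict E (Z ∪ N) x y := by
    intro x hx
    have : 0 < #(outIn E (A ∪ N) x) := by have := hcon x hx; omega
    obtain ⟨y, hy⟩ := card_pos.1 this
    rw [mem_outIn] at hy
    have hy' := hcl x hx y hy.1 hy.2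
    exact ⟨y, hy', hx, hy', hy.2⟩
  set W := (Z ∪ N).filter (fun x => ∃ y, Walk (restrict E (Z ∪ N)) 12 y x) with hW
  have hWU : ∀ x ∈ W, x ∈ Z ∪ N := fun x hx => (mem_filter.1 hx).1
  have hWne : W.Nonempty := by
    obtain ⟨w, hw, hwE⟩ := exists_infinite_walk hne hsucc
    exact ⟨w (0 + 12), mem_filter.2 ⟨hw _, w 0, walk_of_seq hwE 0 12⟩⟩
  have hWcl : ∀ x ∈ W, ∀ y ∈ A ∪ N, E x y → y ∈ W := by
    intro x hx y hy hxy
    have hxU := hWU x hx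
    have hyU := hcl x hxU y hy hxy
    obtain ⟨u, hu⟩ := (mem_filter.1 hx).2
    obtain ⟨u', -, hu'⟩ := hu.snoc ⟨hxU, hyU, hxy⟩
    exact mem_filter.2 ⟨hyU, u', hu'⟩
  have hT : ∀ x ∈ W, ∀ t ≤ 11, Walk E (t + 1) v x ∨ (Walk E (t + 2) v x ∧ Walk E (t + 3) v x) := by
    intro x hx t ht
    obtain ⟨u, hu⟩ := (mem_filter.1 hx).2
    obtain ⟨u₁, -, hu₁⟩ := Walk.split (hu.cast (show 12 = (11 - t) + (t + 1) by omega))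
    obtain ⟨u₂, h₂, hu₂⟩ := hu₁
    rcases mem_union.1 h₂.2.1 with h | h
    · exact Or.inl (Walk.cons (hZ _ h) hu₂.of_restrict)
    · exact Or.inr ⟨((hN _ h).1.append hu₂.of_restrict).cast (by ring),
        ((hN _ h).2.append hu₂.of_restrict).cast (by ring)⟩
  have hmiss : ∀ x ∈ Z ∪ N, ∀ l, l + dst x = 12 → ¬ Walk E l v x := fun x hx l hl hw =>
    h12 ((hw.append (hdw x hx)).cast hl)
  have hedge : ∀ x ∈ W, ∀ y ∈ W, E x y →
      (dst x = 7 ∧ dst y = 6) ∨ (dst x = 6 ∧ dst y = 5) ∨ (dst x = 5 ∧ dst y = 7) := by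
    intro x hx y hy hxy
    have hxU := hWU x hx
    have hyU := hWU y hy
    have a1 := hd5 x hxU
    have a2 := hd7 x hxU
    have b1 := hd5 y hyU
    have b2 := hd7 y hyU
    have hle : dst x ≤ dst y + 1 := by
      by_contra! hlt
      exact hdmin x hxU _ hlt (Walk.cons hxy (hdw y hyU))
    have m1 := hmiss x hxU
    have m2 : ∀ l, l + 1 + dst y = 12 → ¬ Walk E l v x := fun l hl hw =>
      hmiss y hyU (l + 1) hl (hw.snoc hxy)
    have hne0 : dst y ≠ dst x := by
      intro he
      rcases hT x hx (10 - dst x) (by omega) with h | h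
      · exact m2 _ (by omega) h
      · exact m1 _ (by omega) h.1
    have hne1 : dst y ≠ dst x + 1 := by
      intro he
      rcases hT x hx (9 - dst x) (by omega) with h | h
      · exact m2 _ (by omega) h
      · exact m1 _ (by omega) h.2
    omega
  obtain ⟨x₀, hx₀, hmin⟩ := exists_min_image W (fun x => #(outIn E (A ∪ N) x)) hWne
  set r := #(outIn E (A ∪ N) x₀) with hr
  have hcon₀ := hcon x₀ (hWU x₀ hx₀)
  have hout : ∀ x ∈ W, ∃ y ∈ W, E x y := by
    intro x hx
    have : 0 < #(outIn E (A ∪ N) x) := by have := hcon x (hWU x hx); omega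
    obtain ⟨y, hy⟩ := card_pos.1 this
    rw [mem_outIn] at hy
    exact ⟨y, hWcl x hx y hy.1 hy.2, hy.2⟩
  have hstep : ∀ x ∈ W, ∃ z ∈ W, Walk E 2 x z ∧ ∀ y ∈ W, E z y → dst y = dst x := by
    intro x hx
    obtain ⟨y, hy, hxy⟩ := hout x hx
    obtain ⟨z, hz, hyz⟩ := hout y hy
    refine ⟨z, hz, Walk.cons hxy (walk_one.2 hyz), fun u hu hzu => ?_⟩
    have e1 := hedge x hx y hy hxy
    have e2 := hedge y hy z hz hyz
    have e3 := hedge z hz u hu hzu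
    omega
  have hcyc : ∀ x ∈ W, ∃ y ∈ W, Walk E 3 x y ∧ dst y = dst x := by
    intro x hx
    obtain ⟨z, hz, hxz, hz'⟩ := hstep x hx
    obtain ⟨y, hy, hzy⟩ := hout z hz
    exact ⟨y, hy, hxz.snoc hzy, hz' y hy hzy⟩
  have hWZ : ∀ x ∈ W, 6 ≤ dst x → x ∈ Z := by
    intro x hx h6x
    refine (mem_union.1 (hWU x hx)).resolve_right fun hxN => ?_
    obtain ⟨y, hy, hxy, hdy⟩ := hcyc x hx
    have := hd7 x (hWU x hx)
    obtain h | h : dst x = 6 ∨ dst x = 7 := by omega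
    · exact hmiss y (hWU y hy) (3 + 3) (by omega) ((hN x hxN).2.append hxy)
    · exact hmiss y (hWU y hy) (2 + 3) (by omega) ((hN x hxN).1.append hxy)
  have hlevel : ∀ d, (∃ x ∈ W, dst x = d) → 2 * r + 1 ≤ #(W.filter fun x => dst x = d) := by
    rintro d ⟨x, hx, hxd⟩
    refine outdegree_bound_three (E := Walk E 3) ⟨x, mem_filter.2 ⟨hx, hxd⟩⟩ ?_ ?_
    · intro t h1 h2 u hu
      interval_cases t
      · exact h3 u (walk_one.1 hu)
      · obtain ⟨y, h, h'⟩ := hu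
        exact h6 u (h.append (walk_one.1 h'))
    · intro u hu
      obtain ⟨huW, hud⟩ := mem_filter.1 hu
      obtain ⟨z, hz, huz, hz'⟩ := hstep u huW
      refine (hmin z hz).trans (card_le_card fun y hy => ?_)
      rw [mem_outIn] at hy
      have hyW := hWcl z hz y hy.1 hy.2
      exact mem_outIn.2 ⟨mem_filter.2 ⟨hyW, (hz' y hyW hy.2).trans hud⟩, huz.snoc hy.2⟩
  have hex : (∃ x ∈ W, dst x = 7) ∧ ∃ x ∈ W, dst x = 6 := by
    obtain ⟨y, hy, hxy⟩ := hout x₀ hx₀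
    obtain ⟨z, hz, hyz⟩ := hout y hy
    have e1 := hedge x₀ hx₀ y hy hxy
    have e2 := hedge y hy z hz hyz
    rcases e1 with e | e | e
    · exact ⟨⟨x₀, hx₀, e.1⟩, ⟨y, hy, e.2⟩⟩
    · exact ⟨⟨z, hz, by omega⟩, ⟨x₀, hx₀, e.1⟩⟩
    · exact ⟨⟨y, hy, e.2⟩, ⟨z, hz, by omega⟩⟩
  have h7 := hlevel 7 hex.1
  have h6' := hlevel 6 hex.2
  have hdis : Disjoint (W.filter fun x => dst x = 7) (W.filter fun x => dst x = 6) := by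
    rw [disjoint_left]
    intro x hx hx'
    have := (mem_filter.1 hx).2
    have := (mem_filter.1 hx').2
    omega
  have hsub : (W.filter fun x => dst x = 7) ∪ (W.filter fun x => dst x = 6) ⊆ A := by
    intro x hx
    rcases mem_union.1 hx with hx | hx
    · exact hZA (hWZ x (mem_filter.1 hx).1 (by rw [(mem_filter.1 hx).2]; norm_num))
    · exact hZA (hWZ x (mem_filter.1 hx).1 (by rw [(mem_filter.1 hx).2]))
  have hle := card_le_card hsub
  rw [card_union_of_disjoint hdis] at hle
  omega

end Five

section TransitiveTriangle

variable {α : Type*} [Fintype α] {E : α → α → Prop}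

theorem card_ball_of_sinks {δ : ℕ} (h : MinDegree E δ) (hg : GirthGE E 5)
    (hsink : ∀ v (X : Finset α), X.Nonempty → (∀ x ∈ X, E v x) → ∃ x ∈ X, ∀ y ∈ X, ¬ E x y)
    (v : α) : 12 * δ ≤ 5 * #(ball E 3 v) ∧ 67 * δ ≤ 25 * #(ball E 4 v) := by
  have step : ∀ i, 1 ≤ i → 10 * #(ball E i v) + 10 * δ ≤
      10 * #(ball E (i + 1) v) + 3 * #(ball E i v) := by
    intro i hi
    obtain ⟨x, hx, hx'⟩ := exists_outdegree_le_three_tenths hg hsink (h.ball_nonempty hi v)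
    have := card_ball_succ h hx
    omega
  have h1 := h.le_card_ball le_rfl v
  have h2 := card_ball_succ_of_sink h (hsink v _ (h.ball_nonempty le_rfl v) fun x hx => by
    rw [ball_one] at hx
    exact mem_nbr.1 hx)
  have h3 := step 2 (by norm_num)
  have h4 := step 3 (by norm_num)
  simp only [Nat.reduceAdd] at h2 h3 h4
  omega

theorem sink_of_diameter {ℓ D : ℕ} (hD : ∀ x y, ∃ t, 2 ≤ t ∧ t ≤ D ∧ Walk E t x y)
    (hDℓ : D < ℓ) (hc : ∀ x, ¬ Walk E ℓ x x) (v : α) (X : Finset α) (hX : X.Nonempty)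
    (hv : ∀ x ∈ X, E v x) : ∃ x ∈ X, ∀ y ∈ X, ¬ E x y :=
  exists_sink_of_window (v := v) hX
    (fun x hx => by rw [ball_one]; exact mem_nbr.2 (hv x hx)) hD fun hw => by
      obtain ⟨l, h1, h2, h3⟩ := hw ℓ hDℓ
      obtain rfl : l = ℓ := by omega
      exact hc v h3

theorem no_transitive_triangle {δ : ℕ} (h : MinDegree E δ)
    (hδ : DegreeBound 5 (Fintype.card α) δ) (hg : GirthGE E 5) (hc : ∀ x, ¬ Walk E 12 x x)
    {v w : α} (hvw : Walk E 2 v w) : ¬ E v w := by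
  intro hE
  have hn : 0 < Fintype.card α := Fintype.card_pos_iff.2 ⟨v⟩
  have hδ' : 30 * 5 * Fintype.card α ≤ 30 * 5 ^ 2 * δ + Fintype.card α := hδ
  have hc' : ∀ x, ¬ Walk (flip E) 12 x x := fun x hx => hc x (walk_flip.1 hx)
  have c3 := no_closed_walk_of_dvd (E := E) (a := 3) (by norm_num) hc
  have c6 := no_closed_walk_of_dvd (E := E) (a := 6) (by norm_num) hc
  have hlen : ∀ t, 1 ≤ t → Walk E t v v → 5 ≤ t ∧ t ≠ 6 := fun t h1 ht =>
    ⟨not_lt.1 fun h5 => hg t h1 h5 v ht, fun h6 => c6 v (ht.cast h6)⟩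
  have hsum : ∀ s t, Walk E s v v → Walk E t v v → s + t ≠ 12 := fun s t h1 h2 he =>
    hc v ((h1.append h2).cast he)
  have sink := sink_of_diameter
    (exists_walk_of_pow_lt (i := 5) h (by norm_num) hg hδ (by norm_num)) (by norm_num) hc
  have sink' := sink_of_diameter
    (exists_walk_of_pow_lt (i := 5) h.flip (by norm_num) hg.flip hδ (by norm_num)) (by norm_num) hc'
  have D7 : ∀ x y, ∃ t, 2 ≤ t ∧ t ≤ 7 ∧ Walk E t x y := fun x y =>
    exists_walk_of_card_lt (i := 3) (j := 4) (by
      have := (card_ball_of_sinks h hg sink x).1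
      have := (card_ball_of_sinks h.flip hg.flip sink' y).2
      omega)
  obtain ⟨w₀, hw₀, hw₀'⟩ := sink v ((nbr E v).filter fun y => Walk E 2 v y)
    ⟨w, mem_filter.2 ⟨mem_nbr.2 hE, hvw⟩⟩ fun x hx => mem_nbr.1 (mem_filter.1 hx).1
  obtain ⟨hvw₀, hvw₀2⟩ := mem_filter.1 hw₀
  rw [mem_nbr] at hvw₀
  set A := nbr E v with hA
  set N := nbr E w₀ with hN
  set Z := A.filter (fun y => Walk E 2 v y ∨ Walk E 3 v y) with hZ
  have hdis : Disjoint A N := by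
    rw [disjoint_left]
    intro y hy hy'
    rw [mem_nbr] at hy'
    exact hw₀' y (mem_filter.2 ⟨hy, Walk.cons hvw₀ (walk_one.2 hy')⟩) hy'
  have hZw : ∀ x ∈ Z, E v x ∧ (Walk E 2 v x ∨ Walk E 3 v x) := fun x hx =>
    ⟨mem_nbr.1 (mem_filter.1 hx).1, (mem_filter.1 hx).2⟩
  have hNw : ∀ x ∈ N, Walk E 2 v x ∧ Walk E 3 v x := fun x hx =>
    ⟨Walk.cons hvw₀ (walk_one.2 (mem_nbr.1 hx)), hvw₀2.snoc (mem_nbr.1 hx)⟩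
  have hlow : ∀ x ∈ Z ∪ N, ∀ i, Walk E i x v → 5 ≤ i := by
    intro x hx i hi
    by_contra! hlt
    rcases mem_union.1 hx with hx | hx
    · have h1 : Walk E (i + 1) v v := Walk.cons (hZw x hx).1 hi
      have := hlen _ (by omega) h1
      rcases (hZw x hx).2 with h2 | h2
      · have := hlen _ (by omega) (h2.append hi)
        omega
      · have := hsum _ _ h1 (h2.append hi)
        omega
    · have := hlen _ (by omega) ((hNw x hx).1.append hi)
      have := hlen _ (by omega) ((hNw x hx).2.append hi)
      omega
  have hcl : ∀ x ∈ Z ∪ N, ∀ y ∈ A ∪ N, E x y → y ∈ Z ∪ N := by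
    intro x hx y hy hxy
    rcases mem_union.1 hy with hy | hy
    · refine mem_union_left _ (mem_filter.2 ⟨hy, ?_⟩)
      rcases mem_union.1 hx with hx | hx
      · exact Or.inl (Walk.cons (hZw x hx).1 (walk_one.2 hxy))
      · exact Or.inr ((hNw x hx).1.snoc hxy)
    · exact mem_union_right _ hy
  obtain ⟨x, hx, hx'⟩ := exists_outdegree_le_quarter (E := E) (v := v) (A := A) (Z := Z) (N := N)
    (filter_subset _ _) (fun x hx => (hZw x hx).1) hNw ((h.nonempty w₀).mono subset_union_right)
    hcl (fun x hx => by
      have hex : ∃ t, Walk E t x v := by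
        obtain ⟨t, -, -, ht⟩ := D7 x v
        exact ⟨t, ht⟩
      refine ⟨Nat.find hex, hlow x hx _ (Nat.find_spec hex), ?_, Nat.find_spec hex,
        fun j hj => Nat.find_min hex hj⟩
      obtain ⟨t, -, ht7, ht⟩ := D7 x v
      exact (Nat.find_min' hex ht).trans ht7) c3 c6 (hc v)
  have hF := card_union_nbr (E := E) (A ∪ N) x
  rw [card_union_of_disjoint hdis] at hF
  have hFdis : ∀ y, y ∈ A ∪ N ∪ nbr E x → y ∉ ball (flip E) 3 v := by
    intro y hy hyb
    obtain ⟨j, h1, h2, hj⟩ := mem_ball.1 hyb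
    rw [walk_flip] at hj
    rcases mem_union.1 hy with hy | hy
    · rcases mem_union.1 hy with hy | hy
      · exact hg (j + 1) (by omega) (by omega) v (Walk.cons (mem_nbr.1 hy) hj)
      · have := hlow y (mem_union_right _ hy) j hj
        omega
    · have := hlow x hx _ (Walk.cons (mem_nbr.1 hy) hj)
      omega
  have hle : #(A ∪ N ∪ nbr E x) + #(ball (flip E) 3 v) ≤ Fintype.card α := by
    by_contra! hlt
    obtain ⟨y, hy, hy'⟩ := exists_mem_of_card_lt hlt
    exact hFdis y hy hy'
  have b3 := (card_ball_of_sinks h.flip hg.flip sink' v).1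
  have hA1 : δ ≤ #A := h.out v
  have hN1 : δ ≤ #N := h.out w₀
  have hx1 := h.out x
  omega

end TransitiveTriangle

section ThreeShortcut

variable {α : Type*} [Fintype α] {E : α → α → Prop}

theorem exists_outdegree_le_two_ninths (hg : GirthGE E 5) (h6 : ∀ x, ¬ Walk E 6 x x)
    (htt : ∀ x y z, E x y → E y z → ¬ E x z) {v w : α} {S : Finset α} (hne : S.Nonempty)
    (hS : S ⊆ nbr E v ∪ nbr E w)
    (hcl : ∀ x ∈ S, ∀ y ∈ nbr E v ∪ nbr E w, E x y → y ∈ S) :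
    ∃ x ∈ S, 9 * #(outIn E (nbr E v ∪ nbr E w) x) ≤ 2 * #(nbr E v ∪ nbr E w) := by
  set U := nbr E v ∪ nbr E w with hU
  have hedge : ∀ x y, restrict E U x y → (y ∈ nbr E v ↔ x ∉ nbr E v) := by
    rintro x y ⟨hx, hy, hxy⟩
    rw [hU, mem_union, mem_nbr, mem_nbr] at hx hy
    rw [mem_nbr, mem_nbr]
    constructor
    · exact fun hvy hvx => htt v x y hvx hxy hvy
    · exact fun hvx => hy.resolve_right (htt w x y (hx.resolve_left hvx) hxy)
  have hpar : ∀ t x y, Walk (restrict E U) t x y → ((y ∈ nbr E v ↔ x ∈ nbr E v) ↔ Even t) := by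
    intro t
    induction t with
    | zero =>
      rintro x y rfl
      simp
    | succ t ih =>
      rintro x y ⟨z, hxz, hz⟩
      have h1 := ih z y hz
      have h2 := hedge x z hxz
      rw [Nat.even_add_one, ← h1]
      tauto
  have hgU : GirthGE (restrict E U) 8 := by
    intro t h1 h8 x hw
    obtain ⟨m, hm⟩ := (hpar t x x hw).1 Iff.rfl
    rcases Nat.lt_or_ge t 5 with h5 | h5
    · exact hg t h1 h5 x hw.of_restrict
    · obtain rfl : t = 6 := by omega
      exact h6 x hw.of_restrict
  obtain ⟨x, hx, hx'⟩ := exists_small_outdegree (by norm_num) hne hgU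
  refine ⟨x, hx, ?_⟩
  have hout : #(outIn E U x) ≤ #(outIn (restrict E U) S x) := by
    refine card_le_card fun y hy => ?_
    rw [mem_outIn] at hy ⊢
    exact ⟨hcl x hx y hy.1 hy.2, hS hx, hy.1, hy.2⟩
  have := card_le_card hS
  omega

theorem two_mul_le_card_union_nbr {δ : ℕ} (h : MinDegree E δ)
    (htt : ∀ x y z, E x y → E y z → ¬ E x z) {v w : α} (hvw : E v w) :
    2 * δ ≤ #(nbr E v ∪ nbr E w) := by
  rw [card_union_of_disjoint (disjoint_left.2 fun y hy hy' =>
    htt v w y hvw (mem_nbr.1 hy') (mem_nbr.1 hy))]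
  have := h.out v
  have := h.out w
  omega

theorem card_ball_three_of_transitive_triangle_free {δ : ℕ} (h : MinDegree E δ)
    (hg : GirthGE E 5) (h6 : ∀ x, ¬ Walk E 6 x x) (htt : ∀ x y z, E x y → E y z → ¬ E x z)
    (v : α) : 23 * δ ≤ 9 * #(ball E 3 v) := by
  obtain ⟨w, hw⟩ := h.nonempty v
  obtain ⟨x, hx, hx'⟩ := exists_outdegree_le_two_ninths hg h6 htt
    ((h.nonempty v).mono subset_union_left : (nbr E v ∪ nbr E w).Nonempty) Subset.rfl
    fun _ _ y hy _ => hy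
  have h2 := two_mul_le_card_union_nbr h htt (mem_nbr.1 hw)
  have hF := card_union_nbr (E := E) (nbr E v ∪ nbr E w) x
  have hxb : x ∈ ball E 2 v := by
    rcases mem_union.1 hx with hx | hx
    · exact nbr_subset_ball (by norm_num) v hx
    · exact nbr_subset_ball_succ (nbr_subset_ball le_rfl v hw) hx
  have hsub : nbr E v ∪ nbr E w ∪ nbr E x ⊆ ball E 3 v :=
    union_subset (union_subset (nbr_subset_ball (by norm_num) v)
      (nbr_subset_ball_succ (nbr_subset_ball (by norm_num) v hw))) (nbr_subset_ball_succ hxb)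
  have := card_le_card hsub
  have := h.out x
  omega

theorem no_three_shortcut {δ : ℕ} (h : MinDegree E δ)
    (hδ : DegreeBound 5 (Fintype.card α) δ) (hg : GirthGE E 5) (hc : ∀ x, ¬ Walk E 12 x x)
    {v w : α} (hvw : Walk E 3 v w) : ¬ E v w := by
  intro hE
  have hn : 0 < Fintype.card α := Fintype.card_pos_iff.2 ⟨v⟩
  have hδ' : 30 * 5 * Fintype.card α ≤ 30 * 5 ^ 2 * δ + Fintype.card α := hδ
  have c6 := no_closed_walk_of_dvd (E := E) (a := 6) (by norm_num) hc
  have c6' : ∀ x, ¬ Walk (flip E) 6 x x := fun x hx => c6 x (walk_flip.1 hx)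
  have hlen : ∀ t, 1 ≤ t → Walk E t v v → 5 ≤ t ∧ t ≠ 6 := fun t h1 ht =>
    ⟨not_lt.1 fun h5 => hg t h1 h5 v ht, fun h6 => c6 v (ht.cast h6)⟩
  have hsum : ∀ s t, Walk E s v v → Walk E t v v → s + t ≠ 12 := fun s t h1 h2 he =>
    hc v ((h1.append h2).cast he)
  have htt : ∀ x y z, E x y → E y z → ¬ E x z := fun x y z hxy hyz =>
    no_transitive_triangle h hδ hg hc (Walk.cons hxy (walk_one.2 hyz))
  have htt' : ∀ x y z, flip E x y → flip E y z → ¬ flip E x z := fun x y z hxy hyz =>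
    htt z y x hyz hxy
  set A := nbr E v with hA
  set N := nbr E w with hN
  set Z := A.filter (fun y => Walk E 3 v y) with hZ
  have hZw : ∀ x ∈ Z, Walk E 1 v x ∧ Walk E 3 v x := fun x hx =>
    ⟨walk_one.2 (mem_nbr.1 (mem_filter.1 hx).1), (mem_filter.1 hx).2⟩
  have hNw : ∀ x ∈ N, Walk E 2 v x ∧ Walk E 4 v x := fun x hx =>
    ⟨Walk.cons hE (walk_one.2 (mem_nbr.1 hx)), hvw.snoc (mem_nbr.1 hx)⟩
  have hlowN : ∀ x ∈ N, ∀ i, Walk E i x v → 5 ≤ i := by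
    intro x hx i hi
    by_contra! hlt
    have h1 := (hNw x hx).1.append hi
    have h2 := (hNw x hx).2.append hi
    have := hlen _ (by omega) h1
    have := hsum _ _ h1 h2
    omega
  have hlowZ : ∀ x ∈ Z, ∀ i, Walk E i x v → 5 ≤ i := by
    intro x hx i hi
    by_contra! hlt
    have h1 := (hZw x hx).1.append hi
    have h2 := (hZw x hx).2.append hi
    have := hlen _ (by omega) h1
    have := hsum _ _ h1 h2
    omega
  have hlow : ∀ x ∈ Z ∪ N, ∀ i, Walk E i x v → 5 ≤ i := fun x hx =>
    (mem_union.1 hx).elim (hlowZ x) (hlowN x)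
  have hcl : ∀ x ∈ Z ∪ N, ∀ y ∈ A ∪ N, E x y → y ∈ Z ∪ N := by
    intro x hx y hy hxy
    rcases mem_union.1 hy with hy | hy
    · refine mem_union_left _ (mem_filter.2 ⟨hy, ?_⟩)
      rcases mem_union.1 hx with hx | hx
      · exact absurd (mem_nbr.1 hy) (htt v x y (walk_one.1 (hZw x hx).1) hxy)
      · exact (hNw x hx).1.snoc hxy
    · exact mem_union_right _ hy
  obtain ⟨x, hx, hx'⟩ : ∃ x ∈ Z ∪ N, 9 * #(outIn E (A ∪ N) x) ≤ 2 * #(A ∪ N) :=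
    exists_outdegree_le_two_ninths hg c6 htt ((h.nonempty w).mono subset_union_right)
      (union_subset_union_left (filter_subset _ _)) hcl
  have hU : 2 * δ ≤ #(A ∪ N) := two_mul_le_card_union_nbr h htt hE
  have hF := card_union_nbr (E := E) (A ∪ N) x
  have hle : #(A ∪ N ∪ nbr E x) + #(ball (flip E) 3 v) ≤ Fintype.card α := by
    by_contra! hlt
    obtain ⟨y, hy, hyb⟩ := exists_mem_of_card_lt hlt
    obtain ⟨j, h1, h2, hj⟩ := mem_ball.1 hyb
    rw [walk_flip] at hj
    rcases mem_union.1 hy with hy | hy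
    · rcases mem_union.1 hy with hy | hy
      · exact hg (j + 1) (by omega) (by omega) v (Walk.cons (mem_nbr.1 hy) hj)
      · have := hlowN y hy j hj
        omega
    · have := hlow x hx _ (Walk.cons (mem_nbr.1 hy) hj)
      omega
  have b3 := card_ball_three_of_transitive_triangle_free h.flip hg.flip c6' htt' v
  have hx1 := h.out x
  omega

end ThreeShortcut

section Main

theorem walk_of_fin {α : Type*} {E : α → α → Prop} {s : ℕ} (v : Fin (s + 1) → α)
    (h : ∀ i : Fin s, E (v i.castSucc) (v i.succ)) : Walk E s (v 0) (v (Fin.last s)) := by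
  induction s with
  | zero => exact rfl
  | succ s ih =>
    exact Walk.cons (h 0) (ih (fun i => v i.succ) fun i => h i.succ)

variable {n : ℕ} {E : Fin n → Fin n → Prop}

theorem outDeg_eq (v : Fin n) : outDeg E v = #(nbr E v) := by
  rw [outDeg, ← Set.ncard_coe_finset]
  congr 1
  ext w
  simp [mem_nbr]

theorem inDeg_eq (v : Fin n) : inDeg E v = #(nbr (flip E) v) := by
  rw [inDeg, ← Set.ncard_coe_finset]
  congr 1
  ext w
  simp [mem_nbr, flip]

theorem not_walk_of_not_hasClosedWalk {ℓ : ℕ} (h : ¬ HasClosedWalk E ℓ) (x : Fin n) :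
    ¬ Walk E ℓ x x := fun hw => by
  obtain ⟨w, h0, h1, h2⟩ := hw.exists_seq
  exact h ⟨w, h0.trans h1.symm, h2⟩

theorem exists_minDegree {k : ℕ} (hn : 0 < n) (hk : 0 < k)
    (h : ∀ v, (n : ℝ) / k * (1 - 1 / (30 * k)) ≤ (semiDeg E v : ℝ)) :
    ∃ δ, MinDegree E δ ∧ DegreeBound k (Fintype.card (Fin n)) δ := by
  have hn' : (0 : ℝ) < n := by exact_mod_cast hn
  have hk' : (1 : ℝ) ≤ k := by exact_mod_cast hk
  refine ⟨⌈(n : ℝ) / k * (1 - 1 / (30 * k))⌉₊, ⟨?_, fun v => ?_, fun v => ?_⟩, ?_⟩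
  · refine Nat.ceil_pos.2 (mul_pos (by positivity) (sub_pos.2 ?_))
    rw [div_lt_one (by positivity)]
    linarith
  · exact (Nat.ceil_le.2 (h v)).trans (outDeg_eq (E := E) v ▸ min_le_left _ _)
  · exact (Nat.ceil_le.2 (h v)).trans (inDeg_eq (E := E) v ▸ min_le_right _ _)
  · have h1 := Nat.le_ceil ((n : ℝ) / k * (1 - 1 / (30 * k)))
    have h2 := mul_le_mul_of_nonneg_left h1 (by positivity : (0 : ℝ) ≤ 30 * k ^ 2)
    have e : 30 * (k : ℝ) ^ 2 * ((n : ℝ) / k * (1 - 1 / (30 * k))) = 30 * k * n - n := by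
      field_simp
    rw [e] at h2
    rw [DegreeBound, Fintype.card_fin]
    have h3 : 30 * (k : ℝ) * n ≤
        30 * k ^ 2 * (⌈(n : ℝ) / k * (1 - 1 / (30 * k))⌉₊ : ℕ) + n := by linarith
    exact_mod_cast h3

end Main

end DirectedWalk

/-- For `ℓ` divisible by `12`, with `k` the smallest integer greater than `2` not dividing
`ℓ`, every sufficiently large oriented graph with minimum semidegree at least
`(n/k)(1 - 1/(30k))` and no closed directed walk of length `ℓ` contains no `s`-shortcut
for any `2 ≤ s ≤ ⌊k/2⌋ + 1`. -/
theorem no_shortcut_of_no_closed_walk (ℓ k : ℕ) (hℓ : 12 ≤ ℓ) (hdvd : 12 ∣ ℓ)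
    (hk2 : 2 < k) (hkd : ¬ k ∣ ℓ) (hkmin : ∀ m : ℕ, 2 < m → ¬ m ∣ ℓ → k ≤ m) :
    ∃ n₀ : ℕ, ∀ n : ℕ, n₀ ≤ n → ∀ E : Fin n → Fin n → Prop, Oriented E →
      (∀ v, (n : ℝ) / k * (1 - 1 / (30 * k)) ≤ (semiDeg E v : ℝ)) →
      ¬ HasClosedWalk E ℓ →
      ∀ s : ℕ, 2 ≤ s → s ≤ k / 2 + 1 → ¬ HasShortcut E s := by
  have hℓ0 : ℓ ≠ 0 := by omega
  have hdiv : ∀ m, 1 ≤ m → m < k → m ∣ ℓ := by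
    intro m h1 hm
    by_contra hmd
    rcases Nat.lt_or_ge 2 m with h2 | h2
    · exact absurd (hkmin m h2 hmd) (by omega)
    · interval_cases m <;> omega
  refine ⟨1, fun n hn E _ hdeg hcl s hs hsk => ?_⟩
  rintro ⟨v, -, hv, hE⟩
  obtain ⟨δ, h, hδ⟩ := DirectedWalk.exists_minDegree hn (by omega) hdeg
  have hc := DirectedWalk.not_walk_of_not_hasClosedWalk hcl
  have hg : DirectedWalk.GirthGE E k := fun t h1 h2 =>
    DirectedWalk.no_closed_walk_of_dvd (hdiv t h1 h2) hc
  have hw := DirectedWalk.walk_of_fin v hv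
  revert hE
  rcases Nat.lt_or_ge k 8 with h8 | h8
  · obtain rfl | rfl : k = 5 ∨ k = 7 := by
      interval_cases k <;> omega
    · have hc12 := DirectedWalk.no_closed_walk_of_dvd hdvd hc
      obtain rfl | rfl : s = 2 ∨ s = 3 := by omega
      · exact DirectedWalk.no_transitive_triangle h hδ hg hc12 hw
      · exact DirectedWalk.no_three_shortcut h hδ hg hc12 hw
    · have h60 : 60 ∣ ℓ := Nat.lcm_dvd hdvd (hdiv 5 (by norm_num) (by norm_num))
      exact DirectedWalk.no_shortcut_of_girth_seven h hδ hg
        (DirectedWalk.no_closed_walk_of_dvd h60 hc) hs (by omega) hw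
  · exact DirectedWalk.no_shortcut_of_eight_le h hδ hg hℓ0 hc hdiv hkd h8 hs hsk hw
end
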